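/- Let r ≥ 2 and let G be a polycyclic group with a subnormal series G = G_1 ⊳ G_2 ⊳ … ⊳ G_{r+1} = {e}, where each G_{i+1} is normal in G_i and each quotient G_i/G_{i+1} is cyclic. For each i let a_i ∈ G_i be an element whose image generates G_i/G_{i+1}, let π : F_r → G be the (surjective) homomorphism with π(s_i) = a_i, and let N = ker π. Assume G has exponential volume growth. Let μ be the lazy simple random walk measure on Γ_2(N) = F_r/[N,N]. Then there exists a constant C ≥ 1 such that for all n ≥ 2: exp(−C·n/(log n)^2) ≤ μ^{(2n)}(e) ≤ exp(−(1/C)·n/(log n)^2). -/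

import Mathlib

open scoped Pointwise

noncomputable section

open Classical in
/-- Convolution of two real-valued functions ("measures") on a group:
`(μ ∗ ν)(g) = Σ_h μ(h) ν(h⁻¹ g)`. -/
noncomputable def conv {G : Type*} [Group G] (μ ν : G → ℝ) : G → ℝ :=
  fun g => ∑' h : G, μ h * ν (h⁻¹ * g)

open Classical in
/-- `convPow μ n` is the `n`-fold convolution power of `μ`;
`convPow μ 0` is the Dirac mass at the identity. -/
noncomputable def convPow {G : Type*} [Group G] (μ : G → ℝ) : ℕ → G → ℝ
  | 0 => fun g => if g = 1 then 1 else 0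
  | n + 1 => conv μ (convPow μ n)

/-- Pushforward of a measure along a map. -/
noncomputable def pushforward {G H : Type*} (f : G → H) (μ : G → ℝ) : H → ℝ :=
  fun h => ∑' g : {g : G // f g = h}, μ g.1

open Classical in
/-- The lazy simple random walk measure on the free group on `r` generators:
mass `1/2` at the identity and mass `1/(4r)` at each `sᵢ^{±1}`. -/
noncomputable def lazySRW (r : ℕ) : FreeGroup (Fin r) → ℝ := fun g =>
  if g = 1 then 1 / 2
  else if ∃ i : Fin r, g = FreeGroup.of i ∨ g = (FreeGroup.of i)⁻¹ then 1 / (4 * r)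
  else 0

/-- The lazy simple random walk measure on the quotient `F_r / M`, i.e. the pushforward
of `lazySRW r` under the quotient map. -/
noncomputable def lazySRWQuot (r : ℕ) (M : Subgroup (FreeGroup (Fin r))) [M.Normal] :
    FreeGroup (Fin r) ⧸ M → ℝ :=
  pushforward (QuotientGroup.mk : FreeGroup (Fin r) → FreeGroup (Fin r) ⧸ M) (lazySRW r)

/-- Iterated logarithms: `iterLog 1 x = log (1 + x)` and
`iterLog (i+1) x = log (1 + iterLog i x)`. -/
noncomputable def iterLog : ℕ → ℝ → ℝ
  | 0, x => x
  | n + 1, x => Real.log (1 + iterLog n x)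

instance derivedSeriesNormal (G : Type*) [Group G] (n : ℕ) : (derivedSeries G n).Normal :=
  derivedSeries_normal G n

/-- `G` has polynomial volume growth of degree `D`: there is a finite symmetric generating
set `S` containing the identity and constants `0 < c ≤ C` with
`c·n^D ≤ #(Sⁿ) ≤ C·n^D` for all `n ≥ 1`. -/
def HasPolyGrowth (G : Type*) [Group G] (D : ℕ) : Prop :=
  ∃ S : Set G, S.Finite ∧ (1 : G) ∈ S ∧ (∀ x ∈ S, x⁻¹ ∈ S) ∧ Subgroup.closure S = ⊤ ∧
    ∃ c C : ℝ, 0 < c ∧ c ≤ C ∧ ∀ n : ℕ, 1 ≤ n →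
      c * (n : ℝ) ^ D ≤ (Nat.card ↥(S ^ n) : ℝ) ∧ (Nat.card ↥(S ^ n) : ℝ) ≤ C * (n : ℝ) ^ D

/-- `G` has exponential volume growth: there is a finite symmetric generating set `S`
containing the identity and `c > 0` with `#(Sⁿ) ≥ e^{cn}` for all `n ≥ 1`. -/
def HasExpGrowth (G : Type*) [Group G] : Prop :=
  ∃ S : Set G, S.Finite ∧ (1 : G) ∈ S ∧ (∀ x ∈ S, x⁻¹ ∈ S) ∧ Subgroup.closure S = ⊤ ∧
    ∃ c : ℝ, 0 < c ∧ ∀ n : ℕ, 1 ≤ n → Real.exp (c * n) ≤ (Nat.card ↥(S ^ n) : ℝ)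

set_option linter.all false

/-! ### Averaging operators and killed walks -/

/-- The averaging operator of a walk whose steps are uniform in `ι`. -/
def avgOp {ι X : Type*} [Fintype ι] (act : ι → X → X) (f : X → ℝ) : X → ℝ :=
  fun x => (∑ i, f (act i x)) / (Fintype.card ι : ℝ)

open Classical in
/-- Probability that the walk stays in `B` at times `0,…,n`. -/
def stayP {ι X : Type*} [Fintype ι] (act : ι → X → X) (B : Set X) : ℕ → X → ℝ
  | 0 => fun x => if x ∈ B then 1 else 0
  | n + 1 => fun x => if x ∈ B then avgOp act (stayP act B n) x else 0

section walk
variable {ι X Y : Type*} [Fintype ι]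

lemma avgOp_mono (act : ι → X → X) {f g : X → ℝ} (x : X)
    (h : ∀ i, f (act i x) ≤ g (act i x)) : avgOp act f x ≤ avgOp act g x := by
  unfold avgOp
  gcongr with i _
  exact h i

lemma avgOp_nonneg (act : ι → X → X) {f : X → ℝ} (x : X)
    (h : ∀ i, 0 ≤ f (act i x)) : 0 ≤ avgOp act f x := by
  unfold avgOp
  have := Finset.sum_nonneg (fun i (_ : i ∈ Finset.univ) => h i)
  positivity

lemma avgOp_le_const [Nonempty ι] (act : ι → X → X) {f : X → ℝ} (x : X) (c : ℝ)
    (h : ∀ i, f (act i x) ≤ c) : avgOp act f x ≤ c := by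
  unfold avgOp
  have hc : (0 : ℝ) < Fintype.card ι := by exact_mod_cast Fintype.card_pos
  rw [div_le_iff₀ hc]
  calc ∑ i, f (act i x) ≤ ∑ i : ι, c := Finset.sum_le_sum fun i _ => h i
    _ = c * Fintype.card ι := by simp [mul_comm]

lemma avgOp_const [Nonempty ι] (act : ι → X → X) (x : X) (c : ℝ) :
    avgOp act (fun _ => c) x = c := by
  unfold avgOp
  have hc : (0 : ℝ) < Fintype.card ι := by exact_mod_cast Fintype.card_pos
  simp only [Finset.sum_const, Finset.card_univ, nsmul_eq_mul]
  field_simp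

lemma avgOp_add (act : ι → X → X) (f g : X → ℝ) (x : X) :
    avgOp act (fun y => f y + g y) x = avgOp act f x + avgOp act g x := by
  unfold avgOp
  rw [Finset.sum_add_distrib, add_div]

lemma avgOp_mul (act : ι → X → X) (c : ℝ) (g : X → ℝ) (x : X) :
    avgOp act (fun y => c * g y) x = c * avgOp act g x := by
  unfold avgOp
  rw [← Finset.mul_sum, mul_div_assoc]

lemma avgOp_sum {κ : Type*} (act : ι → X → X) (s : Finset κ) (g : κ → X → ℝ) (x : X) :
    avgOp act (fun y => ∑ k ∈ s, g k y) x = ∑ k ∈ s, avgOp act (g k) x := by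
  unfold avgOp
  rw [Finset.sum_comm, Finset.sum_div]

lemma stayP_nonneg (act : ι → X → X) (B : Set X) (n : ℕ) (x : X) : 0 ≤ stayP act B n x := by
  induction n generalizing x with
  | zero => simp only [stayP]; split_ifs <;> norm_num
  | succ n ih =>
    simp only [stayP]; split_ifs
    · exact avgOp_nonneg act x fun i => ih _
    · exact le_rfl

lemma stayP_of_notMem (act : ι → X → X) (B : Set X) (n : ℕ) (x : X) (h : x ∉ B) :
    stayP act B n x = 0 := by
  cases n <;> simp [stayP, h]

lemma stayP_le_one [Nonempty ι] (act : ι → X → X) (B : Set X) (n : ℕ) (x : X) :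
    stayP act B n x ≤ 1 := by
  induction n generalizing x with
  | zero => simp only [stayP]; split_ifs <;> norm_num
  | succ n ih =>
    simp only [stayP]; split_ifs
    · exact avgOp_le_const act x 1 fun i => ih _
    · norm_num

lemma stayP_succ_le [Nonempty ι] (act : ι → X → X) (B : Set X) (n : ℕ) (x : X) :
    stayP act B (n + 1) x ≤ stayP act B n x := by
  induction n generalizing x with
  | zero =>
    by_cases h : x ∈ B
    · have := stayP_le_one act B 1 x
      simpa [stayP, h] using this
    · simp [stayP, h]
  | succ n ih =>
    by_cases h : x ∈ B
    · rw [stayP, stayP]; simp only [h, if_true]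
      exact avgOp_mono act x fun i => ih _
    · simp [stayP, h]

lemma stayP_anti [Nonempty ι] (act : ι → X → X) (B : Set X) (x : X) :
    Antitone (fun n => stayP act B n x) :=
  antitone_nat_of_succ_le fun n => stayP_succ_le act B n x

/-- Lifting a confined walk along a relation. -/
lemma stayP_lift (actX : ι → X → X) (actY : ι → Y → Y) (B : Set X) (D : Set Y)
    (Rel : ℕ → Y → X → Prop) (N : ℕ)
    (hstep : ∀ j y x i, j < N → Rel j y x → x ∈ B → actX i x ∈ B →
      Rel (j + 1) (actY i y) (actX i x))
    (hD : ∀ j y x, j ≤ N → Rel j y x → x ∈ B → y ∈ D) (n : ℕ) :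
    ∀ j y x, j + n ≤ N → Rel j y x → stayP actX B n x ≤ stayP actY D n y := by
  induction n with
  | zero =>
    intro j y x hj hR
    by_cases h : x ∈ B
    · simp [stayP, h, hD j y x (by omega) hR h]
    · rw [stayP_of_notMem _ _ _ _ h]; exact stayP_nonneg _ _ _ _
  | succ n ih =>
    intro j y x hj hR
    by_cases h : x ∈ B
    · have hy := hD j y x (by omega) hR h
      simp only [stayP, h, hy, if_true]
      unfold avgOp
      gcongr with i _
      by_cases hi : actX i x ∈ B
      · exact ih (j + 1) _ _ (by omega) (hstep j y x i (by omega) hR h hi)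
      · rw [stayP_of_notMem _ _ _ _ hi]; exact stayP_nonneg _ _ _ _
    · rw [stayP_of_notMem _ _ _ _ h]; exact stayP_nonneg _ _ _ _

open Classical in
lemma stayP_le_iterate (act : ι → X → X) (B : Set X) (n : ℕ) (x : X) :
    stayP act B n x ≤ (avgOp act)^[n] (fun y => if y ∈ B then 1 else 0) x := by
  induction n generalizing x with
  | zero => simp [stayP]
  | succ n ih =>
    rw [Function.iterate_succ_apply']
    by_cases h : x ∈ B
    · simp only [stayP, h, if_true]
      exact avgOp_mono act x fun i => ih _
    · rw [stayP_of_notMem _ _ _ _ h]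
      have : ∀ m y, 0 ≤ (avgOp act)^[m] (fun y => if y ∈ B then (1:ℝ) else 0) y := by
        intro m
        induction m with
        | zero => intro y; simp only [Function.iterate_zero, id]; split_ifs <;> norm_num
        | succ m ihm =>
          intro y; rw [Function.iterate_succ_apply']
          exact avgOp_nonneg act y fun i => ihm _
      exact avgOp_nonneg act x fun i => this _ _

open Classical in
/-- Transition matrix of the walk killed outside `B`. -/
def kmat (act : ι → X → X) (B : Finset X) : Matrix B B ℝ :=
  fun x y => (∑ i, if act i x = y then (1 : ℝ) else 0) / (Fintype.card ι : ℝ)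

open Classical in
lemma kmat_nonneg (act : ι → X → X) (B : Finset X) (x y : B) : 0 ≤ kmat act B x y := by
  unfold kmat
  have : (0:ℝ) ≤ ∑ i, if act i x = y then (1 : ℝ) else 0 :=
    Finset.sum_nonneg fun i _ => by split_ifs <;> norm_num
  positivity

open Classical in
lemma kmat_mulVec (act : ι → X → X) (B : Finset X) (f : X → ℝ) (hf : ∀ x, x ∉ B → f x = 0)
    (x : B) : (kmat act B).mulVec (fun y => f y) x = avgOp act f x := by
  simp only [Matrix.mulVec, dotProduct, kmat, avgOp]
  simp_rw [div_mul_eq_mul_div]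
  rw [← Finset.sum_div]
  congr 1
  simp_rw [Finset.sum_mul]
  rw [Finset.sum_comm]
  refine Finset.sum_congr rfl fun i _ => ?_
  by_cases h : act i x ∈ B
  · rw [Finset.sum_eq_single (⟨act i x, h⟩ : B)]
    · simp
    · intro b _ hb
      rw [if_neg, zero_mul]
      intro h2; exact hb (Subtype.ext h2.symm)
    · simp
  · rw [hf _ h]
    refine Finset.sum_eq_zero fun b _ => ?_
    rw [if_neg, zero_mul]
    intro h2; exact h (h2 ▸ b.2)

open Classical in
lemma kmat_pow_stay (act : ι → X → X) (B : Finset X) (n : ℕ) (x : B) :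
    ((kmat act B) ^ n).mulVec (fun _ => 1) x = stayP act (B : Set X) n x := by
  classical
  induction n generalizing x with
  | zero => simp [stayP]
  | succ n ih =>
    rw [pow_succ', ← Matrix.mulVec_mulVec]
    have : ((kmat act B) ^ n).mulVec (fun _ => 1) = fun y : B => stayP act (B : Set X) n y :=
      funext ih
    rw [this, kmat_mulVec act B (stayP act (B : Set X) n) (fun y hy => stayP_of_notMem act (B : Set X) n y (fun h => hy (Finset.mem_coe.1 h)))]
    simp [stayP]

lemma kmat_symm (act : ι → X → X) (B : Finset X) (inv : ι ≃ ι)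
    (hinv : ∀ i x, act (inv i) (act i x) = x) (hinv2 : ∀ i x, act i (act (inv i) x) = x) :
    (kmat act B).IsSymm := by
  classical
  ext x y
  simp only [Matrix.transpose_apply, kmat]
  congr 1
  rw [← Equiv.sum_comp inv]
  refine Finset.sum_congr rfl fun i _ => ?_
  congr 1
  apply propext
  constructor
  · intro h; rw [← h, hinv2]
  · intro h; rw [← h, hinv]

/-- Quadratic form of the killed matrix. -/
lemma kmat_quad (act : ι → X → X) (B : Finset X) (f : X → ℝ) (hf : ∀ x, x ∉ B → f x = 0) :
    (fun y : B => f y) ⬝ᵥ (kmat act B).mulVec (fun y => f y) =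
      (∑ i, ∑ x ∈ B, f x * f (act i x)) / (Fintype.card ι : ℝ) := by
  have h1 : (kmat act B).mulVec (fun y : B => f y) = fun x : B => avgOp act f x :=
    funext fun x => kmat_mulVec act B f hf x
  rw [h1]
  simp only [dotProduct, avgOp]
  rw [Finset.sum_comm, Finset.sum_coe_sort B (fun x => f x * ((∑ i, f (act i x)) / _)),
    Finset.sum_div]
  refine Finset.sum_congr rfl fun x _ => ?_
  rw [← Finset.mul_sum, mul_div_assoc]

end walk

/-! ### Linear algebra for symmetric nonnegative matrices -/

section linalg
variable {B : Type*} [Fintype B] [DecidableEq B]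

lemma mat_pow_nonneg (A : Matrix B B ℝ) (hA : ∀ x y, 0 ≤ A x y) (n : ℕ) (x y : B) :
    0 ≤ (A ^ n) x y := by
  induction n generalizing x y with
  | zero => simp [Matrix.one_apply]; split_ifs <;> norm_num
  | succ n ih =>
    rw [pow_succ, Matrix.mul_apply]
    exact Finset.sum_nonneg fun z _ => mul_nonneg (ih _ _) (hA _ _)

lemma quad_two_pow (A : Matrix B B ℝ) (hs : A.IsSymm) (ψ : B → ℝ) (κ : ℝ) (hκ : 0 ≤ κ)
    (hψ : 0 < ψ ⬝ᵥ ψ) (h : κ * (ψ ⬝ᵥ ψ) ≤ ψ ⬝ᵥ A.mulVec ψ) (j : ℕ) :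
    κ ^ (2 ^ j) * (ψ ⬝ᵥ ψ) ≤ ψ ⬝ᵥ (A ^ (2 ^ j)).mulVec ψ := by
  induction j with
  | zero => simpa using h
  | succ j ih =>
    set M := A ^ (2 ^ j) with hM
    have hMs : M.IsSymm := hs.pow _
    have h1 : A ^ (2 ^ (j + 1)) = M * M := by rw [hM, ← pow_add]; congr 1; ring
    have h2 : ψ ⬝ᵥ (A ^ (2 ^ (j + 1))).mulVec ψ = M.mulVec ψ ⬝ᵥ M.mulVec ψ := by
      rw [h1, ← Matrix.mulVec_mulVec, Matrix.dotProduct_mulVec, ← Matrix.mulVec_transpose,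
        hMs.eq]
    have h3 : (ψ ⬝ᵥ M.mulVec ψ) ^ 2 ≤ (ψ ⬝ᵥ ψ) * (M.mulVec ψ ⬝ᵥ M.mulVec ψ) := by
      have := Finset.sum_mul_sq_le_sq_mul_sq Finset.univ ψ (M.mulVec ψ)
      simpa [dotProduct, sq] using this
    rw [h2]
    set t := ψ ⬝ᵥ ψ
    have h4 : (κ ^ (2 ^ j) * t) ^ 2 ≤ (ψ ⬝ᵥ M.mulVec ψ) ^ 2 := by
      have : 0 ≤ κ ^ (2 ^ j) * t := by positivity
      gcongr
    have h5 : t * (κ ^ (2 ^ (j + 1)) * t) ≤ t * (M.mulVec ψ ⬝ᵥ M.mulVec ψ) := by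
      refine le_trans (le_of_eq ?_) (h4.trans h3)
      rw [mul_pow, ← pow_mul, pow_succ]; ring
    exact le_of_mul_le_mul_left h5 hψ

lemma exists_row_sum_ge (M : Matrix B B ℝ) (hs : M.IsSymm) (hM : ∀ x y, 0 ≤ M x y)
    (ψ : B → ℝ) (κ : ℝ) (hψ : 0 < ψ ⬝ᵥ ψ) (h : κ * (ψ ⬝ᵥ ψ) ≤ ψ ⬝ᵥ M.mulVec ψ) :
    ∃ x, κ ≤ M.mulVec (fun _ => 1) x := by
  by_contra! hcon
  have hle : ψ ⬝ᵥ M.mulVec ψ ≤ ∑ x, ψ x ^ 2 * M.mulVec (fun _ => 1) x := by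
    have e1 : ψ ⬝ᵥ M.mulVec ψ = ∑ x, ∑ y, M x y * (ψ x * ψ y) := by
      simp only [dotProduct, Matrix.mulVec, Finset.mul_sum]
      refine Finset.sum_congr rfl fun x _ => Finset.sum_congr rfl fun y _ => by ring
    have e2 : ∑ x, ψ x ^ 2 * M.mulVec (fun _ => 1) x = ∑ x, ∑ y, M x y * ψ x ^ 2 := by
      simp only [dotProduct, Matrix.mulVec, Finset.mul_sum]
      refine Finset.sum_congr rfl fun x _ => Finset.sum_congr rfl fun y _ => by ring
    have e3 : ∑ x, ∑ y, M x y * ψ x ^ 2 = ∑ x, ∑ y, M x y * ψ y ^ 2 := by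
      rw [Finset.sum_comm]
      refine Finset.sum_congr rfl fun x _ => Finset.sum_congr rfl fun y _ => ?_
      rw [← hs.apply x y]
    have e4 : ∑ x, ∑ y, M x y * (ψ x * ψ y) ≤
        ∑ x, ∑ y, (M x y * ψ x ^ 2 + M x y * ψ y ^ 2) / 2 := by
      refine Finset.sum_le_sum fun x _ => Finset.sum_le_sum fun y _ => ?_
      nlinarith [mul_nonneg (hM x y) (sq_nonneg (ψ x - ψ y))]
    have e5 : ∑ x, ∑ y, (M x y * ψ x ^ 2 + M x y * ψ y ^ 2) / 2 =
        (∑ x, ∑ y, M x y * ψ x ^ 2 + ∑ x, ∑ y, M x y * ψ y ^ 2) / 2 := by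
      simp only [← Finset.sum_div, Finset.sum_add_distrib]
    rw [e1, e2]
    rw [e5, ← e3] at e4
    linarith
  have hlt : ∑ x, ψ x ^ 2 * M.mulVec (fun _ => 1) x < ∑ x, ψ x ^ 2 * κ := by
    apply Finset.sum_lt_sum
    · intro x _; exact mul_le_mul_of_nonneg_left (hcon x).le (sq_nonneg _)
    · by_contra! hc
      have : ∀ x, ψ x = 0 := by
        intro x
        by_contra hx
        have := hc x (Finset.mem_univ x)
        have h2 : 0 < ψ x ^ 2 := by positivity
        have h3 := hcon x
        nlinarith
      have : ψ ⬝ᵥ ψ = 0 := by simp [dotProduct, this]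
      linarith
  have : ∑ x, ψ x ^ 2 * κ = κ * (ψ ⬝ᵥ ψ) := by
    rw [← Finset.sum_mul, mul_comm]; simp [dotProduct, sq]
  linarith

/-- Norm bound from quadratic form bound on nonnegative functions. -/
lemma mulVec_sq_le (A : Matrix B B ℝ) (hs : A.IsSymm) (hA : ∀ x y, 0 ≤ A x y) (κ : ℝ)
    (hκ : 0 ≤ κ)
    (h : ∀ f : B → ℝ, (∀ x, 0 ≤ f x) → f ⬝ᵥ A.mulVec f ≤ κ * (f ⬝ᵥ f)) (f : B → ℝ) :
    A.mulVec f ⬝ᵥ A.mulVec f ≤ κ ^ 2 * (f ⬝ᵥ f) := by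
  have habs : ∀ f : B → ℝ, |f ⬝ᵥ A.mulVec f| ≤ κ * (f ⬝ᵥ f) := by
    intro f
    have h1 := h (fun x => |f x|) (fun x => abs_nonneg _)
    have h2 : (fun x => |f x|) ⬝ᵥ (fun x => |f x|) = f ⬝ᵥ f := by
      simp [dotProduct]
    rw [h2] at h1
    refine le_trans ?_ h1
    simp only [dotProduct, Matrix.mulVec]
    refine (Finset.abs_sum_le_sum_abs _ _).trans ?_
    refine Finset.sum_le_sum fun x _ => ?_
    rw [abs_mul]
    gcongr
    refine (Finset.abs_sum_le_sum_abs _ _).trans ?_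
    refine Finset.sum_le_sum fun y _ => ?_
    rw [abs_mul, abs_of_nonneg (hA x y)]
  have hsym : ∀ f g : B → ℝ, f ⬝ᵥ A.mulVec g = g ⬝ᵥ A.mulVec f := by
    intro f g
    rw [Matrix.dotProduct_mulVec, ← Matrix.mulVec_transpose, hs.eq, dotProduct_comm]
  have hbil : ∀ f g : B → ℝ, 2 * (f ⬝ᵥ A.mulVec g) ≤ κ * (f ⬝ᵥ f + g ⬝ᵥ g) := by
    intro f g
    have h1 := (abs_le.1 (habs (f + g))).2
    have h2 := (abs_le.1 (habs (f - g))).1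
    simp only [Matrix.mulVec_add, Matrix.mulVec_sub, dotProduct_add, add_dotProduct,
      dotProduct_sub, sub_dotProduct] at h1 h2
    have h3 := hsym f g
    have h4 := dotProduct_comm f g
    nlinarith
  set s := A.mulVec f ⬝ᵥ A.mulVec f with hsdef
  set t := f ⬝ᵥ f with ht
  have hs0 : 0 ≤ s := by simp only [hsdef, dotProduct]; exact Finset.sum_nonneg fun x _ => mul_self_nonneg _
  have ht0 : 0 ≤ t := by simp only [ht, dotProduct]; exact Finset.sum_nonneg fun x _ => mul_self_nonneg _
  have key : ∀ c : ℝ, 2 * (c * s) ≤ κ * (c ^ 2 * s + t) := by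
    intro c
    have := hbil (c • A.mulVec f) f
    simp only [smul_dotProduct, dotProduct_smul, smul_eq_mul] at this
    rw [← hsdef, ← ht] at this
    nlinarith
  rcases hκ.eq_or_lt with h0 | h0
  · have := key 1
    rw [← h0] at this ⊢
    nlinarith
  · have := key (1 / κ)
    have h5 : 2 * (1 / κ * s) * κ ≤ κ * ((1 / κ) ^ 2 * s + t) * κ := by gcongr
    field_simp at h5
    nlinarith

lemma pow_row_sum_le (A : Matrix B B ℝ) (hs : A.IsSymm) (hA : ∀ x y, 0 ≤ A x y) (κ : ℝ)
    (hκ : 0 ≤ κ)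
    (h : ∀ f : B → ℝ, (∀ x, 0 ≤ f x) → f ⬝ᵥ A.mulVec f ≤ κ * (f ⬝ᵥ f)) (n : ℕ) (x : B) :
    (A ^ n).mulVec (fun _ => 1) x ≤ κ ^ n * Fintype.card B := by
  have key : ∀ n, (A ^ n).mulVec (fun _ => (1:ℝ)) ⬝ᵥ (A ^ n).mulVec (fun _ => (1:ℝ)) ≤
      (κ ^ n) ^ 2 * Fintype.card B := by
    intro n
    induction n with
    | zero => simp [dotProduct]
    | succ n ih =>
      rw [pow_succ', ← Matrix.mulVec_mulVec]
      refine (mulVec_sq_le A hs hA κ hκ h _).trans ?_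
      calc _ ≤ κ ^ 2 * ((κ ^ n) ^ 2 * Fintype.card B) := by gcongr
        _ = _ := by ring
  have hx : ((A ^ n).mulVec (fun _ => (1:ℝ)) x) ^ 2 ≤ (κ ^ n * Fintype.card B) ^ 2 := by
    have h1 : ((A ^ n).mulVec (fun _ => (1:ℝ)) x) ^ 2 ≤
        (A ^ n).mulVec (fun _ => (1:ℝ)) ⬝ᵥ (A ^ n).mulVec (fun _ => (1:ℝ)) := by
      rw [sq]
      exact Finset.single_le_sum (f := fun x => (A ^ n).mulVec (fun _ => (1:ℝ)) x *
        (A ^ n).mulVec (fun _ => (1:ℝ)) x) (fun i _ => mul_self_nonneg _) (Finset.mem_univ x)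
    refine h1.trans ((key n).trans ?_)
    rw [mul_pow]
    have hc : (1:ℝ) ≤ Fintype.card B := by
      exact_mod_cast Fintype.card_pos_iff.2 ⟨x⟩
    gcongr
    nlinarith
  exact le_of_sq_le_sq hx (by positivity)

lemma loop_ge (A : Matrix B B ℝ) (hs : A.IsSymm) (k : ℕ) (x : B) :
    ((A ^ k).mulVec (fun _ => 1) x) ^ 2 ≤ Fintype.card B * (A ^ (2 * k)) x x := by
  have h1 : (A ^ (2 * k)) x x = ∑ y, (A ^ k) x y ^ 2 := by
    rw [two_mul, pow_add, Matrix.mul_apply]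
    refine Finset.sum_congr rfl fun y _ => ?_
    rw [sq, (hs.pow k).apply]
  rw [h1]
  have := sq_sum_le_card_mul_sum_sq (s := (Finset.univ : Finset B)) (f := fun y => (A ^ k) x y)
  simpa [Matrix.mulVec, dotProduct] using this

lemma loop_pow (A : Matrix B B ℝ) (hA : ∀ x y, 0 ≤ A x y) (q : ℕ) (x : B) :
    (A x x) ^ q ≤ (A ^ q) x x := by
  induction q with
  | zero => simp
  | succ q ih =>
    rw [pow_succ, pow_succ, Matrix.mul_apply]
    refine le_trans ?_ (Finset.single_le_sum (f := fun y => (A ^ q) x y * A y x)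
      (fun y _ => mul_nonneg (mat_pow_nonneg A hA q x y) (hA y x)) (Finset.mem_univ x))
    exact mul_le_mul_of_nonneg_right ih (hA x x)

lemma entry_le_row (A : Matrix B B ℝ) (hA : ∀ x y, 0 ≤ A x y) (x : B) :
    A x x ≤ A.mulVec (fun _ => 1) x := by
  simp only [Matrix.mulVec, dotProduct, mul_one]
  exact Finset.single_le_sum (f := fun y => A x y) (fun y _ => hA x y) (Finset.mem_univ x)

end linalg

/-- Concatenating loops: confinement for `k` steps yields confinement for `2kq` steps. -/
lemma stayP_loops {ι X : Type*} [Fintype ι] (act : ι → X → X) (B : Finset X) (inv : ι ≃ ι)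
    (hinv : ∀ i x, act (inv i) (act i x) = x) (hinv2 : ∀ i x, act i (act (inv i) x) = x)
    (x : X) (hx : x ∈ B) (k q : ℕ) :
    (stayP act (B : Set X) k x ^ 2 / B.card) ^ q ≤ stayP act (B : Set X) (2 * k * q) x := by
  classical
  have hs := kmat_symm act B inv hinv hinv2
  have hnn := kmat_nonneg act B
  have h1 := loop_ge (kmat act B) hs k ⟨x, hx⟩
  rw [kmat_pow_stay] at h1
  have hc : (0:ℝ) < B.card := by exact_mod_cast Finset.card_pos.2 ⟨x, hx⟩
  have h2 : stayP act (B : Set X) k x ^ 2 / B.card ≤ (kmat act B ^ (2 * k)) ⟨x, hx⟩ ⟨x, hx⟩ := by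
    rw [div_le_iff₀ hc]
    simpa [mul_comm] using h1
  have h3 := loop_pow (kmat act B ^ (2 * k)) (mat_pow_nonneg _ hnn _) q ⟨x, hx⟩
  rw [← pow_mul] at h3
  have h4 := entry_le_row (kmat act B ^ (2 * k * q)) (mat_pow_nonneg _ hnn _) ⟨x, hx⟩
  rw [kmat_pow_stay] at h4
  refine le_trans ?_ (h3.trans h4)
  gcongr

/-- Confinement from a test function. -/
lemma exists_stayP_ge {ι X : Type*} [Fintype ι] [Nonempty ι] (act : ι → X → X) (B : Finset X)
    (inv : ι ≃ ι)
    (hinv : ∀ i x, act (inv i) (act i x) = x) (hinv2 : ∀ i x, act i (act (inv i) x) = x)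
    (f : X → ℝ) (hf : ∀ x, x ∉ B → f x = 0) (κ : ℝ) (hκ : 0 ≤ κ)
    (hpos : 0 < ∑ x ∈ B, f x ^ 2)
    (hq : κ * ∑ x ∈ B, f x ^ 2 ≤ (∑ i, ∑ x ∈ B, f x * f (act i x)) / (Fintype.card ι : ℝ))
    (j : ℕ) : ∃ x ∈ B, κ ^ (2 ^ j) ≤ stayP act (B : Set X) (2 ^ j) x := by
  classical
  have hs := kmat_symm act B inv hinv hinv2
  have hnn := kmat_nonneg act B
  have e : (fun y : B => f y) ⬝ᵥ (fun y : B => f y) = ∑ x ∈ B, f x ^ 2 := by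
    simp only [dotProduct, ← sq]
    exact Finset.sum_coe_sort B (fun x => f x ^ 2)
  have h1 := quad_two_pow (kmat act B) hs (fun y : B => f y) κ hκ (by rw [e]; exact hpos)
    (by rw [e, kmat_quad act B f hf]; exact hq) j
  obtain ⟨x, hx⟩ := exists_row_sum_ge _ (hs.pow _) (mat_pow_nonneg _ hnn _) _ _
    (by rw [e]; exact hpos) h1
  rw [kmat_pow_stay] at hx
  exact ⟨x, x.2, hx⟩

open Classical in
/-- Indicator of a proposition. -/
def ind (P : Prop) : ℝ := if P then 1 else 0

lemma ind_true {P : Prop} (h : P) : ind P = 1 := by simp [ind, h]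
lemma ind_false {P : Prop} (h : ¬ P) : ind P = 0 := by simp [ind, h]
lemma ind_nonneg (P : Prop) : 0 ≤ ind P := by unfold ind; split_ifs <;> norm_num
lemma ind_le_one (P : Prop) : ind P ≤ 1 := by unfold ind; split_ifs <;> norm_num
lemma ind_mono {P Q : Prop} (h : P → Q) : ind P ≤ ind Q := by
  by_cases hp : P
  · rw [ind_true hp, ind_true (h hp)]
  · rw [ind_false hp]; exact ind_nonneg _

/-! ### Letters and the lazy walk -/

/-- Letters: generator index, sign, and lazy bit. -/
abbrev Letter (r : ℕ) := Fin r × Bool × Bool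

/-- The group element of a letter. -/
def stepOf {Q : Type*} [Group Q] {r : ℕ} (a : Fin r → Q) (l : Letter r) : Q :=
  if l.2.2 then 1 else if l.2.1 then a l.1 else (a l.1)⁻¹

/-- Inverse letter. -/
def letterInv (r : ℕ) : Letter r ≃ Letter r where
  toFun l := (l.1, !l.2.1, l.2.2)
  invFun l := (l.1, !l.2.1, l.2.2)
  left_inv l := by simp
  right_inv l := by simp

lemma stepOf_inv {Q : Type*} [Group Q] {r : ℕ} (a : Fin r → Q) (l : Letter r) :
    stepOf a (letterInv r l) = (stepOf a l)⁻¹ := by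
  obtain ⟨i, b, z⟩ := l
  cases b <;> cases z <;> simp [stepOf, letterInv]

lemma stepOf_map {Q Q' : Type*} [Group Q] [Group Q'] {r : ℕ} (φ : Q →* Q') (a : Fin r → Q)
    (l : Letter r) : φ (stepOf a l) = stepOf (fun i => φ (a i)) l := by
  obtain ⟨i, b, z⟩ := l
  cases b <;> cases z <;> simp [stepOf]

/-- Right multiplication action. -/
def ract {ι Q : Type*} [Group Q] (s : ι → Q) (i : ι) (q : Q) : Q := q * s i

lemma iter_semiconj {ι X Y : Type*} [Fintype ι] (actX : ι → X → X) (actY : ι → Y → Y)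
    (φ : X → Y) (h : ∀ i x, φ (actX i x) = actY i (φ x)) (f : Y → ℝ) (n : ℕ) (x : X) :
    (avgOp actX)^[n] (fun y => f (φ y)) x = (avgOp actY)^[n] f (φ x) := by
  induction n generalizing x with
  | zero => rfl
  | succ n ih =>
    rw [Function.iterate_succ_apply', Function.iterate_succ_apply']
    unfold avgOp
    congr 1
    refine Finset.sum_congr rfl fun i _ => ?_
    rw [← h]; exact ih _

lemma iter_mono {ι X : Type*} [Fintype ι] (act : ι → X → X) {f g : X → ℝ} (h : ∀ x, f x ≤ g x)
    (n : ℕ) (x : X) : (avgOp act)^[n] f x ≤ (avgOp act)^[n] g x := by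
  induction n generalizing x with
  | zero => exact h x
  | succ n ih =>
    rw [Function.iterate_succ_apply', Function.iterate_succ_apply']
    exact avgOp_mono act x fun i => ih _

lemma iter_le_const {ι X : Type*} [Fintype ι] [Nonempty ι] (act : ι → X → X) {f : X → ℝ} {c : ℝ}
    (h : ∀ x, f x ≤ c) (n : ℕ) (x : X) : (avgOp act)^[n] f x ≤ c := by
  induction n generalizing x with
  | zero => exact h x
  | succ n ih =>
    rw [Function.iterate_succ_apply']
    exact avgOp_le_const act x _ fun i => ih _

lemma iter_nonneg {ι X : Type*} [Fintype ι] (act : ι → X → X) {f : X → ℝ}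
    (h : ∀ x, 0 ≤ f x) (n : ℕ) (x : X) : 0 ≤ (avgOp act)^[n] f x := by
  induction n generalizing x with
  | zero => exact h x
  | succ n ih =>
    rw [Function.iterate_succ_apply']
    exact avgOp_nonneg act x fun i => ih _

lemma of_ne_inv_of {r : ℕ} (i j : Fin r) :
    (FreeGroup.of i : FreeGroup (Fin r)) ≠ (FreeGroup.of j)⁻¹ := by
  intro h
  have := congrArg (FreeGroup.lift (fun _ : Fin r => Multiplicative.ofAdd (1:ℤ))) h
  simp only [FreeGroup.lift_apply_of, map_inv] at this
  have h2 := congrArg Multiplicative.toAdd this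
  simp at h2

open Classical in
lemma lazySRW_eq (r : ℕ) (hr : 0 < r) (g : FreeGroup (Fin r)) :
    lazySRW r g = (∑ l : Letter r, if stepOf FreeGroup.of l = g then (1:ℝ) else 0) /
      (Fintype.card (Letter r) : ℝ) := by
  have hr' : (0:ℝ) < r := by exact_mod_cast hr
  have hcard : (Fintype.card (Letter r) : ℝ) = 4 * r := by
    simp [Fintype.card_prod]; ring
  rw [hcard]
  have hsum : (∑ l : Letter r, if stepOf FreeGroup.of l = g then (1:ℝ) else 0) =
      2 * r * (if g = 1 then 1 else 0) +
      ∑ i : Fin r, ((if FreeGroup.of i = g then (1:ℝ) else 0) +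
        (if (FreeGroup.of i)⁻¹ = g then 1 else 0)) := by
    rw [Fintype.sum_prod_type]
    have : ∀ i : Fin r, (∑ y : Bool × Bool, if stepOf FreeGroup.of (i, y) = g then (1:ℝ) else 0)
        = 2 * (if g = 1 then 1 else 0) + ((if FreeGroup.of i = g then (1:ℝ) else 0) +
        (if (FreeGroup.of i)⁻¹ = g then 1 else 0)) := by
      intro i
      rw [Fintype.sum_prod_type]
      simp only [Fintype.sum_bool, stepOf]
      simp only [if_true, Bool.false_eq_true, if_false, eq_comm (a := (1 : FreeGroup (Fin r)))]
      ring
    rw [Finset.sum_congr rfl fun i _ => this i, Finset.sum_add_distrib]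
    congr 1
    simp only [Finset.sum_const, Finset.card_univ, Fintype.card_fin, nsmul_eq_mul]; ring
  rw [hsum]
  unfold lazySRW
  by_cases h1 : g = 1
  · subst h1
    simp [FreeGroup.of_ne_one]
    field_simp; norm_num
  · simp only [h1, if_false]
    by_cases h2 : ∃ i : Fin r, g = FreeGroup.of i ∨ g = (FreeGroup.of i)⁻¹
    · rw [if_pos h2]
      obtain ⟨i, hi | hi⟩ := h2
      · subst hi
        have : ∀ j : Fin r, ((FreeGroup.of j : FreeGroup (Fin r))⁻¹ = FreeGroup.of i) = False :=
          fun j => eq_false fun h => of_ne_inv_of i j h.symm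
        simp [this, FreeGroup.of_injective.eq_iff]
      · subst hi
        have : ∀ j : Fin r, ((FreeGroup.of j : FreeGroup (Fin r)) = (FreeGroup.of i)⁻¹) = False :=
          fun j => eq_false fun h => of_ne_inv_of j i h
        simp [this, FreeGroup.of_injective.eq_iff]
    · rw [if_neg h2]
      push Not at h2
      have e1 : ∀ j : Fin r, ((FreeGroup.of j : FreeGroup (Fin r)) = g) = False :=
          fun j => eq_false fun h => (h2 j).1 h.symm
      have e2 : ∀ j : Fin r, ((FreeGroup.of j : FreeGroup (Fin r))⁻¹ = g) = False :=
          fun j => eq_false fun h => (h2 j).2 h.symm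
      simp [e1, e2]

open Classical in
lemma lazySRWQuot_eq (r : ℕ) (hr : 0 < r) (M : Subgroup (FreeGroup (Fin r))) [M.Normal]
    (q : FreeGroup (Fin r) ⧸ M) :
    lazySRWQuot r M q = (∑ l : Letter r,
      if stepOf (fun i => (QuotientGroup.mk (FreeGroup.of i) : FreeGroup (Fin r) ⧸ M)) l = q
        then (1:ℝ) else 0) / (Fintype.card (Letter r) : ℝ) := by
  unfold lazySRWQuot pushforward
  simp_rw [lazySRW_eq r hr]
  rw [tsum_div_const]
  congr 1
  have hs : ∀ l : Letter r, HasSum (fun g : {g : FreeGroup (Fin r) // (g : FreeGroup (Fin r) ⧸ M) = q} =>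
      if stepOf FreeGroup.of l = g.1 then (1:ℝ) else 0)
      (if stepOf (fun i => (QuotientGroup.mk (FreeGroup.of i) : FreeGroup (Fin r) ⧸ M)) l = q
        then (1:ℝ) else 0) := by
    intro l
    have hm : stepOf (fun i => (QuotientGroup.mk (FreeGroup.of i) : FreeGroup (Fin r) ⧸ M)) l =
        (QuotientGroup.mk (stepOf FreeGroup.of l) : FreeGroup (Fin r) ⧸ M) :=
      (stepOf_map (QuotientGroup.mk' M) FreeGroup.of l).symm
    rw [hm]
    split_ifs with h
    · have := hasSum_single (f := fun g : {g : FreeGroup (Fin r) // (g : FreeGroup (Fin r) ⧸ M) = q} =>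
        if stepOf FreeGroup.of l = g.1 then (1:ℝ) else 0) ⟨stepOf FreeGroup.of l, h⟩ (by
          intro b hb
          rw [if_neg]
          intro h3; exact hb (Subtype.ext h3.symm))
      simpa using this
    · have : (fun g : {g : FreeGroup (Fin r) // (g : FreeGroup (Fin r) ⧸ M) = q} =>
        if stepOf FreeGroup.of l = g.1 then (1:ℝ) else 0) = fun _ => 0 := by
        funext g
        rw [if_neg]
        intro h3; apply h; rw [h3]; exact g.2
      rw [this]; exact hasSum_zero
  exact (hasSum_sum fun l _ => hs l).tsum_eq

open Classical in
lemma conv_steps {ι Q : Type*} [Fintype ι] [Group Q] (s : ι → Q) (μ : Q → ℝ)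
    (hμ : ∀ q, μ q = (∑ i, if s i = q then (1:ℝ) else 0) / (Fintype.card ι : ℝ))
    (u : Q → ℝ) (g : Q) :
    conv μ u g = (∑ i, u ((s i)⁻¹ * g)) / (Fintype.card ι : ℝ) := by
  unfold conv
  simp_rw [hμ, div_mul_eq_mul_div, Finset.sum_mul]
  rw [tsum_div_const]
  congr 1
  refine HasSum.tsum_eq ?_
  refine hasSum_sum fun i _ => ?_
  have := hasSum_single (f := fun h : Q => (if s i = h then (1:ℝ) else 0) * u (h⁻¹ * g)) (s i) (by
    intro b hb; rw [if_neg (Ne.symm hb), zero_mul])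
  simpa using this

lemma convPow_eq_iter {ι Q : Type*} [Fintype ι] [Group Q] (s : ι → Q) (μ : Q → ℝ)
    (hμ : ∀ q, μ q = (∑ i, ind (s i = q)) / (Fintype.card ι : ℝ))
    (n : ℕ) (g : Q) :
    convPow μ n g⁻¹ = (avgOp (ract s))^[n] (fun q => ind (q = 1)) g := by
  classical
  induction n generalizing g with
  | zero => simp [convPow, ind]
  | succ n ih =>
    rw [Function.iterate_succ_apply', convPow, conv_steps s μ (by
      intro q; rw [hμ]; simp only [ind])]
    rw [avgOp]
    congr 1
    refine Finset.sum_congr rfl fun i _ => ?_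
    rw [← ih]; simp [ract]

/-- Step in the quotient group. -/
def qstep {r : ℕ} (M : Subgroup (FreeGroup (Fin r))) [M.Normal] : Letter r → FreeGroup (Fin r) ⧸ M :=
  stepOf (fun i => (QuotientGroup.mk (FreeGroup.of i) : FreeGroup (Fin r) ⧸ M))

lemma return_eq (r : ℕ) (hr : 0 < r) (M : Subgroup (FreeGroup (Fin r))) [M.Normal] (n : ℕ) :
    convPow (lazySRWQuot r M) n 1 =
      (avgOp (ract (qstep M)))^[n] (fun q => ind (q = 1)) 1 := by
  have := convPow_eq_iter (qstep M) (lazySRWQuot r M) (by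
    intro q; rw [lazySRWQuot_eq r hr M]; simp only [ind]; congr 1; refine Finset.sum_congr rfl fun l _ => ?_; unfold qstep; congr) n 1
  simpa using this

/-! ### Faber–Krahn inequality from exponential growth -/

section FK
variable {G : Type*} [Group G]

/-- Squared `ℓ²` distance between `f` and its translate. -/
def dsq (f : G → ℝ) (y : G) : ℝ := ∑' x, (f x - f (x * y)) ^ 2

lemma supp_translate (f : G → ℝ) (hf : (Function.support f).Finite) (y : G) :
    (Function.support fun x => f (x * y)).Finite := by
  refine (hf.image (fun z => z * y⁻¹)).subset ?_
  intro x hx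
  exact ⟨x * y, hx, by simp⟩

lemma summable_diff (f : G → ℝ) (hf : (Function.support f).Finite) (y z : G) :
    Summable fun x => (f (x * y) - f (x * z)) ^ 2 := by
  apply summable_of_finite_support
  refine ((supp_translate f hf y).union (supp_translate f hf z)).subset ?_
  intro x hx
  by_contra hcon
  simp only [Set.mem_union, Function.mem_support, not_or, not_not] at hcon
  apply hx
  simp [hcon.1, hcon.2]

lemma summable_diff' (f : G → ℝ) (hf : (Function.support f).Finite) (z : G) :
    Summable fun x => (f x - f (x * z)) ^ 2 := by
  simpa using summable_diff f hf 1 z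

lemma dsq_nonneg (f : G → ℝ) (y : G) : 0 ≤ dsq f y := tsum_nonneg fun _ => sq_nonneg _

lemma dsq_translate (f : G → ℝ) (y z : G) :
    ∑' x, (f (x * y) - f (x * (y * z))) ^ 2 = dsq f z := by
  unfold dsq
  rw [← Equiv.tsum_eq (Equiv.mulRight y) (fun x => (f x - f (x * z)) ^ 2)]
  simp [mul_assoc]

/-- Telescoping bound. -/
lemma dsq_prod_le {ι : Type*} (s : ι → G) (f : G → ℝ) (hf : (Function.support f).Finite)
    (d : ℝ) (hd0 : 0 ≤ d) (hd : ∀ i, dsq f (s i) ≤ d) (l : List ι) :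
    dsq f ((l.map s).prod) ≤ (l.length : ℝ) ^ 2 * d := by
  induction l using List.reverseRecOn with
  | nil => simp [dsq]
  | append_singleton l i ih =>
    simp only [List.map_append, List.map_cons, List.map_nil, List.prod_append, List.prod_singleton,
      List.length_append, List.length_singleton]
    set y := (l.map s).prod
    set k : ℝ := (l.length : ℝ) with hk
    have hk0 : 0 ≤ k := by positivity
    rcases Nat.eq_zero_or_pos l.length with h0 | hpos
    · have : l = [] := List.length_eq_zero_iff.1 h0
      have hy : y = 1 := by simp [y, this]
      have hk' : k = 0 := by simp [hk, h0]
      rw [hy, one_mul]; push_cast; rw [← hk, hk']; simpa using hd i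
    have hkpos : 0 < k := by rw [hk]; exact_mod_cast hpos
    have hpt : ∀ x, (f x - f (x * (y * s i))) ^ 2 ≤
        (1 + 1 / k) * (f x - f (x * y)) ^ 2 + (1 + k) * (f (x * y) - f (x * (y * s i))) ^ 2 := by
      intro x
      set A := f x - f (x * y)
      set B := f (x * y) - f (x * (y * s i))
      have : f x - f (x * (y * s i)) = A + B := by simp [A, B]
      rw [this]
      have h2 : 0 ≤ 1 / k * (A - k * B) ^ 2 := by positivity
      have h3 : 1 / k * (A - k * B) ^ 2 = 1 / k * A ^ 2 - 2 * A * B + k * B ^ 2 := by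
        field_simp; ring
      nlinarith
    have hle : dsq f (y * s i) ≤ (1 + 1 / k) * dsq f y + (1 + k) * dsq f (s i) := by
      have h1 := summable_diff' f hf (y * s i)
      have h2 := (summable_diff' f hf y).mul_left (1 + 1 / k)
      have h3 := (summable_diff f hf y (y * s i)).mul_left (1 + k)
      have := h1.tsum_le_tsum hpt (h2.add h3)
      rw [h2.tsum_add h3, tsum_mul_left, tsum_mul_left, dsq_translate] at this
      exact this
    refine hle.trans ?_
    have h4 : (1 + 1 / k) * dsq f y ≤ (1 + 1 / k) * (k ^ 2 * d) := by gcongr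
    have h5 : (1 + k) * dsq f (s i) ≤ (1 + k) * d := by gcongr; exact hd i
    have h6 : (1 + 1 / k) * (k ^ 2 * d) = (k ^ 2 + k) * d := by field_simp
    push_cast
    rw [← hk]
    nlinarith

lemma dsq_eq (f : G → ℝ) (W : Finset G) (hW : ∀ x, x ∉ W → f x = 0) (y : G) :
    dsq f y = 2 * ∑ x ∈ W, f x ^ 2 - 2 * ∑ x ∈ W, f x * f (x * y) := by
  have hf : (Function.support f).Finite := W.finite_toSet.subset fun x hx => by
    by_contra h; exact hx (hW x h)
  have hs1 : HasSum (fun x => f x ^ 2) (∑ x ∈ W, f x ^ 2) :=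
    hasSum_sum_of_ne_finset_zero fun x hx => by simp [hW x hx]
  have hs2 : HasSum (fun x => f (x * y) ^ 2) (∑ x ∈ W, f x ^ 2) := by
    have := (Equiv.hasSum_iff (Equiv.mulRight y)).2 hs1
    exact this
  have hs3 : HasSum (fun x => f x * f (x * y)) (∑ x ∈ W, f x * f (x * y)) :=
    hasSum_sum_of_ne_finset_zero fun x hx => by simp [hW x hx]
  have := (hs1.add hs2).sub (hs3.mul_left 2)
  unfold dsq
  have h2 : (fun x => (f x - f (x * y)) ^ 2) =
      fun x => f x ^ 2 + f (x * y) ^ 2 - 2 * (f x * f (x * y)) := by funext x; ring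
  rw [h2, this.tsum_eq]; ring

/-- Some element of a large finite set moves `f` a lot. -/
lemma exists_dsq_ge (f : G → ℝ) (hf0 : ∀ x, 0 ≤ f x) (W A : Finset G)
    (hW : ∀ x, x ∉ W → f x = 0) (hA : 2 * W.card ≤ A.card) (hne : A.Nonempty) :
    ∃ y ∈ A, ∑ x ∈ W, f x ^ 2 ≤ dsq f y := by
  by_contra! hcon
  have h1 : ∀ y ∈ A, (∑ x ∈ W, f x ^ 2) / 2 < ∑ x ∈ W, f x * f (x * y) := by
    intro y hy
    have := hcon y hy
    rw [dsq_eq f W hW] at this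
    linarith
  have h2 : (A.card : ℝ) * ((∑ x ∈ W, f x ^ 2) / 2) < ∑ y ∈ A, ∑ x ∈ W, f x * f (x * y) := by
    rw [← nsmul_eq_mul, ← Finset.sum_const]
    exact Finset.sum_lt_sum_of_nonempty hne h1
  have h3 : ∑ y ∈ A, ∑ x ∈ W, f x * f (x * y) ≤ (∑ x ∈ W, f x) ^ 2 := by
    rw [Finset.sum_comm, sq, Finset.sum_mul]
    refine Finset.sum_le_sum fun x _ => ?_
    rw [← Finset.mul_sum]
    refine mul_le_mul_of_nonneg_left ?_ (hf0 x)
    classical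
    have : ∑ y ∈ A, f (x * y) = ∑ z ∈ A.image (fun y => x * y), f z := by
      rw [Finset.sum_image]; intro a _ b _ h; exact mul_left_cancel h
    rw [this]
    calc ∑ z ∈ A.image (fun y => x * y), f z
        ≤ ∑ z ∈ A.image (fun y => x * y) ∪ W, f z :=
          Finset.sum_le_sum_of_subset_of_nonneg Finset.subset_union_left fun z _ _ => hf0 z
      _ = ∑ z ∈ W, f z := by
          symm
          exact Finset.sum_subset Finset.subset_union_right fun z _ hz => hW z hz
  have h4 : (∑ x ∈ W, f x) ^ 2 ≤ W.card * ∑ x ∈ W, f x ^ 2 := sq_sum_le_card_mul_sum_sq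
  have h5 : (2 * W.card : ℝ) ≤ A.card := by exact_mod_cast hA
  have h6 : 0 ≤ ∑ x ∈ W, f x ^ 2 := Finset.sum_nonneg fun _ _ => sq_nonneg _
  nlinarith

/-- Words in a symmetric generating family. -/
lemma exists_word {ι : Type*} (s : ι → G) (inv : ι → ι) (hinv : ∀ i, s (inv i) = (s i)⁻¹)
    (hgen : Subgroup.closure (Set.range s) = ⊤) (g : G) : ∃ l : List ι, (l.map s).prod = g := by
  have hg : g ∈ Subgroup.closure (Set.range s) := by rw [hgen]; trivial
  induction hg using Subgroup.closure_induction with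
  | mem x hx => obtain ⟨i, rfl⟩ := hx; exact ⟨[i], by simp⟩
  | one => exact ⟨[], by simp⟩
  | mul x y _ _ hx hy =>
    obtain ⟨l, rfl⟩ := hx; obtain ⟨m, rfl⟩ := hy
    exact ⟨l ++ m, by simp⟩
  | inv x _ hx =>
    obtain ⟨l, rfl⟩ := hx
    refine ⟨(l.map inv).reverse, ?_⟩
    rw [List.prod_inv_reverse]
    simp [List.map_map, Function.comp_def, hinv]

lemma exists_word_pow {ι : Type*} (s : ι → G) (inv : ι → ι) (hinv : ∀ i, s (inv i) = (s i)⁻¹)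
    (hgen : Subgroup.closure (Set.range s) = ⊤) (S : Set G) (hS : S.Finite) :
    ∃ K : ℕ, 1 ≤ K ∧ ∀ n, ∀ g ∈ S ^ n, ∃ l : List ι, (l.map s).prod = g ∧ l.length ≤ K * n := by
  choose w hw using exists_word s inv hinv hgen
  obtain ⟨K, hK⟩ := (hS.image fun g => (w g).length).bddAbove
  refine ⟨K + 1, by omega, fun n => ?_⟩
  induction n with
  | zero => intro g hg; exact ⟨[], by simpa using hg.symm, by simp⟩
  | succ n ih =>
    intro g hg
    rw [pow_succ] at hg
    obtain ⟨x, hx, y, hy, rfl⟩ := Set.mem_mul.1 hg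
    obtain ⟨l, hl, hlen⟩ := ih x hx
    refine ⟨l ++ w y, by simp [hl, hw], ?_⟩
    have := hK ⟨y, hy, rfl⟩
    simp only [List.length_append]
    simp only at this
    nlinarith

lemma set_finite_pow {S : Set G} (hS : S.Finite) (n : ℕ) : (S ^ n).Finite := by
  induction n with
  | zero => simp
  | succ n ih => rw [pow_succ]; exact ih.mul hS

/-- Faber–Krahn: decay of staying probabilities in finite sets. -/
lemma faber_krahn {ι : Type*} [Fintype ι] [Nonempty ι] (s : ι → G) (inv : ι ≃ ι)
    (hinv : ∀ i, s (inv i) = (s i)⁻¹)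
    (hgen : Subgroup.closure (Set.range s) = ⊤) (hexp : HasExpGrowth G) :
    ∃ c0 : ℝ, 0 < c0 ∧ c0 ≤ 1 ∧ ∀ (W : Finset G), W.Nonempty → ∀ (m : ℕ) (x : G),
      stayP (ract s) (W : Set G) m x ≤ (1 - c0 / (1 + Real.log W.card) ^ 2) ^ m * W.card := by
  classical
  obtain ⟨S, hSf, -, -, -, c, hc, hgrow⟩ := hexp
  obtain ⟨K, hK1, hK⟩ := exists_word_pow s inv hinv hgen S hSf
  set p : ℝ := (Fintype.card ι : ℝ) with hp
  have hp1 : 1 ≤ p := by rw [hp]; exact_mod_cast Fintype.card_pos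
  set C1 : ℝ := 1 / c + 1 with hC1
  have hC1p : 1 ≤ C1 := by have : 0 < 1 / c := by positivity
                           linarith
  have hKr : (1:ℝ) ≤ K := by exact_mod_cast hK1
  refine ⟨1 / (2 * (K * C1) ^ 2 * p), by positivity, ?_, ?_⟩
  · rw [div_le_one (by positivity)]
    have : 1 ≤ (K * C1) ^ 2 := one_le_pow₀ (by nlinarith)
    nlinarith
  intro W hWne m x
  have hWc : (1:ℝ) ≤ W.card := by exact_mod_cast hWne.card_pos
  set L := Real.log W.card with hL
  have hL0 : 0 ≤ L := Real.log_nonneg hWc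
  -- choose the radius
  set n : ℕ := ⌈Real.log (2 * W.card) / c⌉₊ with hn
  have hlog2 : 0 < Real.log (2 * W.card) := Real.log_pos (by linarith)
  have hn1 : 1 ≤ n := Nat.one_le_iff_ne_zero.2 (by
    rw [hn]; exact (Nat.ceil_pos.2 (by positivity)).ne')
  have hlog2le : Real.log (2 * W.card) ≤ 1 + L := by
    rw [Real.log_mul (by norm_num) (by linarith)]
    have := Real.log_two_lt_d9
    linarith
  have hnle : (n : ℝ) ≤ C1 * (1 + L) := by
    have h1 := Nat.ceil_lt_add_one (a := Real.log (2 * W.card) / c) (by positivity)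
    have h2 : Real.log (2 * W.card) / c ≤ (1 + L) / c := by gcongr
    rw [hC1]
    have : (1 / c + 1) * (1 + L) = (1 + L) / c + (1 + L) := by field_simp
    rw [← hn] at h1
    linarith
  have hSn : (S ^ n).Finite := set_finite_pow hSf n
  set A := hSn.toFinset with hA
  have hAc : 2 * W.card ≤ A.card := by
    have h1 := hgrow n hn1
    have h2 : Nat.card ↥(S ^ n) = A.card := by
      rw [Nat.card_coe_set_eq, Set.ncard_eq_toFinset_card _ hSn]
    rw [h2] at h1
    have h3 : Real.log (2 * W.card) ≤ c * n := by
      have := Nat.le_ceil (Real.log (2 * W.card) / c)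
      rw [div_le_iff₀ hc] at this
      rw [← hn] at this; linarith
    have h4 : (2 * W.card : ℝ) ≤ A.card := by
      rw [← Real.exp_log (show (0:ℝ) < 2 * W.card by linarith)]
      exact (Real.exp_le_exp.2 h3).trans h1
    exact_mod_cast h4
  have hAne : A.Nonempty := Finset.card_pos.1 (by have := hWne.card_pos; omega)
  set c0 := 1 / (2 * (K * C1) ^ 2 * p) with hc0
  set κ := 1 - c0 / (1 + L) ^ 2 with hκ
  have hc0le : c0 ≤ 1 := by
    rw [hc0, div_le_one (by positivity)]
    have : 1 ≤ (K * C1) ^ 2 := one_le_pow₀ (by nlinarith)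
    nlinarith
  have hκ0 : 0 ≤ κ := by
    rw [hκ, sub_nonneg, div_le_one (by positivity)]
    have : 1 ≤ (1 + L) ^ 2 := one_le_pow₀ (by linarith)
    linarith
  by_cases hxW : x ∉ W
  · rw [stayP_of_notMem _ _ _ _ (by simpa using hxW)]
    positivity
  push Not at hxW
  have hi1 : ∀ i x, ract s (inv i) (ract s i x) = x := by intro i x; simp [ract, hinv]
  have hi2 : ∀ i x, ract s i (ract s (inv i) x) = x := by intro i x; simp [ract, hinv]
  have hmain := pow_row_sum_le (kmat (ract s) W) (kmat_symm _ W inv hi1 hi2)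
    (kmat_nonneg _ W) κ hκ0 ?_ m ⟨x, hxW⟩
  · rw [kmat_pow_stay] at hmain
    simpa using hmain
  intro f hf
  set F : G → ℝ := fun y => if h : y ∈ W then f ⟨y, h⟩ else 0 with hF
  have hFf : (fun y : W => F y) = f := by funext y; simp [hF]
  have hFW : ∀ y, y ∉ W → F y = 0 := by intro y hy; simp [hF, hy]
  have hF0 : ∀ y, 0 ≤ F y := by
    intro y; simp only [hF]; split_ifs
    · exact hf _
    · exact le_rfl
  have hsup : (Function.support F).Finite := W.finite_toSet.subset fun y hy => by
    by_contra h; exact hy (hFW y h)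
  have hq := kmat_quad (ract s) W F hFW
  rw [hFf] at hq
  rw [hq]
  have hff : f ⬝ᵥ f = ∑ x ∈ W, F x ^ 2 := by
    rw [← hFf]
    simp only [dotProduct, ← sq]
    exact Finset.sum_coe_sort W (fun x => F x ^ 2)
  rw [hff]
  set T := ∑ x ∈ W, F x ^ 2 with hT
  have hT0 : 0 ≤ T := Finset.sum_nonneg fun _ _ => sq_nonneg _
  obtain ⟨y, hyA, hy⟩ := exists_dsq_ge F hF0 W A hFW hAc hAne
  obtain ⟨l, hl, hlen⟩ := hK n y (by simpa [hA] using hyA)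
  set dd := ∑ i, dsq F (s i) with hdd
  have hdd0 : 0 ≤ dd := Finset.sum_nonneg fun i _ => dsq_nonneg _ _
  have hb := dsq_prod_le s F hsup dd hdd0
    (fun i => Finset.single_le_sum (f := fun i => dsq F (s i)) (fun i _ => dsq_nonneg _ _)
      (Finset.mem_univ i)) l
  rw [hl] at hb
  have hlen' : (l.length : ℝ) ≤ K * C1 * (1 + L) := by
    have : (l.length : ℝ) ≤ K * n := by exact_mod_cast hlen
    calc (l.length : ℝ) ≤ K * n := this
      _ ≤ K * (C1 * (1 + L)) := by gcongr
      _ = _ := by ring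
  have hb2 : T ≤ (K * C1 * (1 + L)) ^ 2 * dd := hy.trans (hb.trans (by gcongr))
  have hdd2 : dd = 2 * p * T - 2 * ∑ i, ∑ x ∈ W, F x * F (ract s i x) := by
    rw [hdd]
    simp_rw [dsq_eq F W hFW]
    rw [Finset.sum_sub_distrib, ← Finset.mul_sum, ← Finset.mul_sum]
    simp [hp, ract]
    ring
  set Q := ∑ i, ∑ x ∈ W, F x * F (ract s i x) with hQ
  rw [div_le_iff₀ (by linarith)]
  rw [hdd2] at hb2
  have hpos : 0 < (K * C1 * (1 + L)) ^ 2 := by positivity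
  have e1 : c0 / (1 + L) ^ 2 * (2 * p * (K * C1 * (1 + L)) ^ 2) = 1 := by
    rw [hc0]; field_simp
  rw [hκ]
  have h7 : T / (K * C1 * (1 + L)) ^ 2 ≤ 2 * p * T - 2 * Q := by
    rw [div_le_iff₀ hpos]; linarith
  have e2 : T / (K * C1 * (1 + L)) ^ 2 = 2 * p * (c0 / (1 + L) ^ 2) * T := by
    rw [div_eq_iff hpos.ne']
    linear_combination (-T) * e1
  rw [e2] at h7
  linarith

end FK

/-! ### Flows and the visited-set recursion -/

section flow
variable {G R ι : Type*} [Group G] [Fintype ι]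

/-- Walk on pairs (flow, position). -/
def flowAct (s : ι → G) (c : ι → G × R → ℤ) (i : ι) (p : (G × R → ℤ) × G) :
    (G × R → ℤ) × G :=
  (fun e => p.1 e + c i (p.2⁻¹ * e.1, e.2), p.2 * s i)

/-- Covered positions. -/
def covered (Sg : Set G) (Z : Finset G) (y : G) : Prop := ∃ z ∈ Z, ∃ σ ∈ Sg, y = z * σ

open Classical in
/-- The bounding recursion. -/
def bfun (s : ι → G) (Sg : Set G) (p0 : G) (θ : ℝ) : ℕ → G → Finset G → ℝ
  | 0 => fun _ _ => 1
  | m + 1 => fun x Z =>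
    if covered Sg Z (x * p0) then (∑ i, bfun s Sg p0 θ m (x * s i) Z) / (Fintype.card ι : ℝ)
    else θ * ((∑ i, bfun s Sg p0 θ m (x * s i) (insert x Z)) / (Fintype.card ι : ℝ))

lemma div_card_mono {f g : ι → ℝ} (h : ∀ i, f i ≤ g i) :
    (∑ i, f i) / (Fintype.card ι : ℝ) ≤ (∑ i, g i) / (Fintype.card ι : ℝ) := by
  gcongr with i _; exact h i

lemma div_card_const [Nonempty ι] (c : ℝ) : (∑ _i : ι, c) / (Fintype.card ι : ℝ) = c := by
  have hc : (0 : ℝ) < Fintype.card ι := by exact_mod_cast Fintype.card_pos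
  simp only [Finset.sum_const, Finset.card_univ, nsmul_eq_mul]; field_simp

lemma bfun_nonneg (s : ι → G) (Sg : Set G) (p0 : G) (θ : ℝ) (hθ : 0 ≤ θ) (m : ℕ) (x : G)
    (Z : Finset G) : 0 ≤ bfun s Sg p0 θ m x Z := by
  induction m generalizing x Z with
  | zero => simp [bfun]
  | succ m ih =>
    have h1 : ∀ Z', 0 ≤ (∑ i, bfun s Sg p0 θ m (x * s i) Z') / (Fintype.card ι : ℝ) :=
      fun Z' => div_nonneg (Finset.sum_nonneg fun i _ => ih _ _) (by positivity)
    simp only [bfun]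
    split_ifs
    · exact h1 _
    · exact mul_nonneg hθ (h1 _)

lemma bfun_succ_le [Nonempty ι] (s : ι → G) (Sg : Set G) (p0 : G) (θ : ℝ) (hθ : 0 ≤ θ)
    (hθ1 : θ ≤ 1) (m : ℕ) (x : G)
    (Z : Finset G) : bfun s Sg p0 θ (m + 1) x Z ≤ bfun s Sg p0 θ m x Z := by
  induction m generalizing x Z with
  | zero =>
    simp only [bfun]
    rw [div_card_const]
    split_ifs <;> linarith
  | succ m ih =>
    rw [bfun, bfun]
    dsimp only
    split_ifs
    · exact div_card_mono fun i => ih _ _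
    · exact mul_le_mul_of_nonneg_left (div_card_mono fun i => ih _ _) hθ

lemma bfun_le_one [Nonempty ι] (s : ι → G) (Sg : Set G) (p0 : G) (θ : ℝ) (hθ : 0 ≤ θ)
    (hθ1 : θ ≤ 1) (m : ℕ) (x : G)
    (Z : Finset G) : bfun s Sg p0 θ m x Z ≤ 1 := by
  induction m with
  | zero => simp [bfun]
  | succ m ih => exact (bfun_succ_le s Sg p0 θ hθ hθ1 m x Z).trans ih

lemma iter_add {X : Type*} (act : ι → X → X) (f g : X → ℝ) (n : ℕ) (x : X) :
    (avgOp act)^[n] (fun y => f y + g y) x = (avgOp act)^[n] f x + (avgOp act)^[n] g x := by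
  induction n generalizing x with
  | zero => rfl
  | succ n ih =>
    rw [Function.iterate_succ_apply', Function.iterate_succ_apply', Function.iterate_succ_apply']
    rw [← avgOp_add]
    congr 1; funext y; exact ih y

/-- Main recursion: probability that the flow matches a target outside the covered zone. -/
lemma flow_le_bfun [Nonempty ι] (s : ι → G) (c : ι → G × R → ℤ) (i0 i1 : ι) (hne : i0 ≠ i1)
    (hs0 : s i0 = 1) (hc0 : ∀ e, c i0 e = 0) (hs1 : s i1 = 1) (Sg : Set G)
    (hSg : ∀ e, c i1 e ≠ 0 → e.1 ∈ Sg) (e0 : G × R) (he0 : c i1 e0 ≠ 0) (m : ℕ) :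
    ∀ (D : G × R → ℤ) (x : G) (Z : Finset G) (f : G × R → ℤ),
    (avgOp (flowAct s c))^[m] (fun p => ind (∀ e, ¬ covered Sg Z e.1 → p.1 e = f e)) (D, x) ≤
      bfun s Sg e0.1 (1 - 1 / (Fintype.card ι : ℝ)) m x Z := by
  classical
  have hcard : (0:ℝ) < Fintype.card ι := by exact_mod_cast Fintype.card_pos
  have hcard1 : (1:ℝ) ≤ Fintype.card ι := by exact_mod_cast Fintype.card_pos
  set θ : ℝ := 1 - 1 / (Fintype.card ι : ℝ) with hθ
  have hθ0 : 0 ≤ θ := by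
    rw [hθ, sub_nonneg, div_le_one hcard]; exact hcard1
  have hθ1 : θ ≤ 1 := by rw [hθ]; have : 0 < 1 / (Fintype.card ι : ℝ) := by positivity
                         linarith
  induction m with
  | zero => intro D x Z f; simp only [Function.iterate_zero, id, bfun]; exact ind_le_one _
  | succ m ih =>
    intro D x Z f
    rw [Function.iterate_succ_apply', bfun, avgOp]
    dsimp only
    split_ifs with hnear
    · exact div_card_mono fun i => ih _ _ _ _
    · set Z' := insert x Z with hZ'
      set φ : (G × R → ℤ) × G → ℝ := fun p => ind (∀ e, ¬ covered Sg Z e.1 → p.1 e = f e) with hφ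
      set φ' : (G × R → ℤ) × G → ℝ := fun p => ind (∀ e, ¬ covered Sg Z' e.1 → p.1 e = f e) with hφ'
      have hcov : ∀ y, covered Sg Z y → covered Sg Z' y := by
        rintro y ⟨z, hz, σ, hσ, rfl⟩
        exact ⟨z, Finset.mem_insert_of_mem hz, σ, hσ, rfl⟩
      have hle : ∀ p, φ p ≤ φ' p := fun p => ind_mono fun h e he => h e fun h2 => he (hcov _ h2)
      set P : ι → ℝ := fun i => (avgOp (flowAct s c))^[m] φ (flowAct s c i (D, x)) with hP
      set b : ι → ℝ := fun i => bfun s Sg e0.1 θ m (x * s i) Z' with hb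
      have h1 : ∀ i, P i ≤ b i := fun i =>
        (iter_mono _ hle m _).trans (ih _ _ _ _)
      -- the two special letters
      have h2 : P i0 + P i1 ≤ b i0 := by
        set shift : (G × R → ℤ) × G → (G × R → ℤ) × G :=
          fun p => (fun e => p.1 e + c i1 (x⁻¹ * e.1, e.2), p.2) with hshift
        have e0' : flowAct s c i0 (D, x) = (D, x) := by
          simp [flowAct, hs0, hc0]
        have e1' : flowAct s c i1 (D, x) = shift (D, x) := by
          simp [flowAct, hs1, hshift]
        have e2 : P i1 = (avgOp (flowAct s c))^[m] (fun p => φ (shift p)) (D, x) := by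
          rw [hP]; simp only; rw [e1']
          exact (iter_semiconj (flowAct s c) (flowAct s c) shift (by
            intro i p; simp only [flowAct, hshift]; congr 1; funext e; ring) φ m (D, x)).symm
        have e3 : P i0 = (avgOp (flowAct s c))^[m] φ (D, x) := by
          rw [hP]; simp only; rw [e0']
        rw [e2, e3, ← iter_add]
        have hb0 : b i0 = bfun s Sg e0.1 θ m x Z' := by simp [hb, hs0]
        rw [hb0]
        refine (iter_mono _ ?_ m _).trans (ih D x Z' f)
        intro p
        have hxe : ¬ covered Sg Z (x * e0.1) := hnear
        by_cases hA : ∀ e, ¬ covered Sg Z e.1 → p.1 e = f e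
        · have hB : ¬ ∀ e, ¬ covered Sg Z e.1 → (shift p).1 e = f e := by
            intro hB
            have a1 := hA (x * e0.1, e0.2) hxe
            have a2 := hB (x * e0.1, e0.2) hxe
            simp only [hshift] at a2
            rw [a1] at a2
            simp at a2
            exact he0 a2
          simp only [hφ]
          rw [ind_false hB, add_zero]
          exact hle p
        · simp only [hφ]
          rw [ind_false hA, zero_add]
          apply ind_mono
          intro h e he
          have := h e fun h2 => he (hcov _ h2)
          simp only [hshift] at this
          have hz : c i1 (x⁻¹ * e.1, e.2) = 0 := by
            by_contra hcz
            apply he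
            exact ⟨x, Finset.mem_insert_self _ _, _, hSg _ hcz, by simp⟩
          rw [hz, add_zero] at this
          exact this
      have h3 : ∑ i, P i ≤ ∑ i, b i - b i0 := by
        have hd : ∑ i, P i = P i1 + ∑ i ∈ Finset.univ.erase i1, P i :=
          (Finset.add_sum_erase _ _ (Finset.mem_univ i1)).symm
        have hd2 : ∑ i ∈ Finset.univ.erase i1, P i = P i0 + ∑ i ∈ (Finset.univ.erase i1).erase i0, P i :=
          (Finset.add_sum_erase _ _ (by simp [hne])).symm
        have hd' : ∑ i, b i = b i1 + ∑ i ∈ Finset.univ.erase i1, b i :=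
          (Finset.add_sum_erase _ _ (Finset.mem_univ i1)).symm
        have hd2' : ∑ i ∈ Finset.univ.erase i1, b i = b i0 + ∑ i ∈ (Finset.univ.erase i1).erase i0, b i :=
          (Finset.add_sum_erase _ _ (by simp [hne])).symm
        have h4 : ∑ i ∈ (Finset.univ.erase i1).erase i0, P i ≤
          ∑ i ∈ (Finset.univ.erase i1).erase i0, b i := Finset.sum_le_sum fun i _ => h1 i
        have h5 : b i1 = b i0 := by simp [hb, hs0, hs1]
        linarith
      have h6 : (∑ i, b i) / (Fintype.card ι : ℝ) ≤ b i0 := by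
        have h7 := bfun_succ_le s Sg e0.1 θ hθ0 hθ1 m x Z'
        rw [bfun] at h7
        dsimp only at h7
        rw [if_pos ⟨x, Finset.mem_insert_self _ _, e0.1, hSg _ he0, rfl⟩] at h7
        simpa [hb, hs0] using h7
      calc (∑ i, P i) / (Fintype.card ι : ℝ) ≤ (∑ i, b i - b i0) / (Fintype.card ι : ℝ) := by gcongr
        _ ≤ (∑ i, b i - (∑ i, b i) / (Fintype.card ι : ℝ)) / (Fintype.card ι : ℝ) := by gcongr
        _ = θ * ((∑ i, b i) / (Fintype.card ι : ℝ)) := by rw [hθ]; field_simp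

/-! ### Ranges of words -/

open Classical in
/-- Positions visited by a word from `x`. -/
def rangeFrom (s : ι → G) : G → List ι → Finset G
  | x, [] => {x}
  | x, i :: l => insert x (rangeFrom s (x * s i) l)

lemma self_mem_rangeFrom (s : ι → G) (x : G) (l : List ι) : x ∈ rangeFrom s x l := by
  cases l <;> simp [rangeFrom]

lemma card_rangeFrom (s : ι → G) (x : G) (l : List ι) : (rangeFrom s x l).card ≤ l.length + 1 := by
  induction l generalizing x with
  | nil => simp [rangeFrom]
  | cons i l ih =>
    classical
    simp only [rangeFrom, List.length_cons]
    exact (Finset.card_insert_le _ _).trans (by have := ih (x * s i); omega)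

open Classical in
lemma rangeFrom_detour (s : ι → G) (inv : ι → ι) (hinv : ∀ i, s (inv i) = (s i)⁻¹) (i : ι)
    (y : G) (l : List ι) : ∀ x, y ∈ rangeFrom s x l →
    ∃ l' : List ι, l'.length = l.length + 2 ∧ rangeFrom s x l' = insert (y * s i) (rangeFrom s x l) := by
  induction l with
  | nil =>
    intro x hy
    simp only [rangeFrom, Finset.mem_singleton] at hy
    subst hy
    refine ⟨[i, inv i], rfl, ?_⟩
    simp only [rangeFrom, hinv, mul_inv_cancel_right]
    ext z; simp
  | cons j l ih =>
    intro x hy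
    simp only [rangeFrom, Finset.mem_insert] at hy
    rcases hy with rfl | hy
    · refine ⟨i :: inv i :: j :: l, rfl, ?_⟩
      simp only [rangeFrom, hinv, mul_inv_cancel_right]
      ext z; simp
    · obtain ⟨l', hl', hr⟩ := ih _ hy
      refine ⟨j :: l', by simp [hl'], ?_⟩
      simp only [rangeFrom, hr]
      exact Finset.insert_comm _ _ _

lemma rangeFrom_pad (s : ι → G) (i0 : ι) (hs0 : s i0 = 1) (x : G) (l : List ι) (k : ℕ) :
    rangeFrom s x (List.replicate k i0 ++ l) = rangeFrom s x l := by
  classical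
  induction k with
  | zero => rfl
  | succ k ih =>
    rw [List.replicate_succ, List.cons_append, rangeFrom, hs0, mul_one, ih]
    exact Finset.insert_eq_self.2 (self_mem_rangeFrom _ _ _)

/-- Bounding `bfun` by short-range events. -/
lemma bfun_le [Nonempty ι] (s : ι → G) (inv : ι → ι) (hinv : ∀ i, s (inv i) = (s i)⁻¹)
    (i0 : ι) (hs0 : s i0 = 1) (Sg : Finset G) (p0 : G) (hp0 : p0 ∈ Sg) (θ : ℝ) (hθ0 : 0 ≤ θ)
    (hθ1 : θ ≤ 1) (v T : ℕ) (hT : 2 * (v * Sg.card + 1) ≤ T) (m : ℕ) :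
    ∀ (x : G) (Z : Finset G) (l : List ι), x ∈ rangeFrom s 1 l →
      l.length ≤ 2 * (rangeFrom s 1 l).card →
      (∀ y ∈ rangeFrom s 1 l, y ≠ x → covered (Sg : Set G) Z (y * p0)) →
      bfun s (Sg : Set G) p0 θ m x Z ≤ θ ^ (v - Z.card) +
        ∑ t : Fin T → ι, ind (rangeFrom s 1 l ⊆ rangeFrom s 1 (List.ofFn t)) *
          stayP (ract s) (rangeFrom s 1 (List.ofFn t) : Set G) m x := by
  classical
  have hterm : ∀ (l : List ι) (m : ℕ) (x : G), ∀ t : Fin T → ι,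
      0 ≤ ind (rangeFrom s 1 l ⊆ rangeFrom s 1 (List.ofFn t)) *
          stayP (ract s) (rangeFrom s 1 (List.ofFn t) : Set G) m x :=
    fun l m x t => mul_nonneg (ind_nonneg _) (stayP_nonneg _ _ _ _)
  -- bookkeeping of one step
  have hstep : ∀ (m : ℕ) (x : G) (Z' : Finset G) (l : List ι) (w : ℕ), x ∈ rangeFrom s 1 l →
      (∀ i, ∃ l', rangeFrom s 1 l' = insert (x * s i) (rangeFrom s 1 l) ∧
        bfun s (Sg : Set G) p0 θ m (x * s i) Z' ≤ θ ^ w +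
        ∑ t : Fin T → ι, ind (rangeFrom s 1 l' ⊆ rangeFrom s 1 (List.ofFn t)) *
          stayP (ract s) (rangeFrom s 1 (List.ofFn t) : Set G) m (x * s i)) →
      (∑ i, bfun s (Sg : Set G) p0 θ m (x * s i) Z') / (Fintype.card ι : ℝ) ≤ θ ^ w +
        ∑ t : Fin T → ι, ind (rangeFrom s 1 l ⊆ rangeFrom s 1 (List.ofFn t)) *
          stayP (ract s) (rangeFrom s 1 (List.ofFn t) : Set G) (m + 1) x := by
    intro m x Z' l w hx h
    have h1 : ∀ i, bfun s (Sg : Set G) p0 θ m (x * s i) Z' ≤ θ ^ w +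
        ∑ t : Fin T → ι, ind (rangeFrom s 1 l ⊆ rangeFrom s 1 (List.ofFn t)) *
          stayP (ract s) (rangeFrom s 1 (List.ofFn t) : Set G) m (x * s i) := by
      intro i
      obtain ⟨l', hl', hb⟩ := h i
      refine hb.trans ?_
      gcongr with t _
      · exact stayP_nonneg _ _ _ _
      · apply ind_mono
        intro hsub
        rw [hl'] at hsub
        exact (Finset.subset_insert _ _).trans hsub
    refine (div_card_mono h1).trans ?_
    rw [Finset.sum_add_distrib, add_div, div_card_const, Finset.sum_comm, Finset.sum_div]
    gcongr with t _
    by_cases hsub : rangeFrom s 1 l ⊆ rangeFrom s 1 (List.ofFn t)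
    · rw [ind_true hsub]
      simp only [one_mul]
      rw [stayP]; dsimp only
      rw [if_pos (Finset.mem_coe.2 (hsub hx))]
      exact le_of_eq rfl
    · rw [ind_false hsub]; simp
  induction m with
  | zero =>
    intro x Z l hx hlen hcov
    by_cases hZ : v ≤ Z.card
    · rw [Nat.sub_eq_zero_of_le hZ, pow_zero]
      simp only [bfun]
      have := Finset.sum_nonneg fun t (_ : t ∈ Finset.univ) => hterm l 0 x t
      linarith
    · push Not at hZ
      have hcard : (rangeFrom s 1 l).card ≤ v * Sg.card + 1 := by
        have hsub : rangeFrom s 1 l ⊆ insert x (((Z ×ˢ Sg).image fun q => q.1 * q.2 * p0⁻¹)) := by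
          intro y hy
          by_cases hyx : y = x
          · simp [hyx]
          · obtain ⟨z, hz, σ, hσ, h⟩ := hcov y hy hyx
            apply Finset.mem_insert_of_mem
            rw [Finset.mem_image]
            exact ⟨(z, σ), Finset.mem_product.2 ⟨hz, by simpa using hσ⟩, by simp [← h]⟩
        refine (Finset.card_le_card hsub).trans ((Finset.card_insert_le _ _).trans ?_)
        have := (Finset.card_image_le (s := Z ×ˢ Sg) (f := fun q => q.1 * q.2 * p0⁻¹))
        rw [Finset.card_product] at this
        have h2 : Z.card * Sg.card ≤ v * Sg.card := Nat.mul_le_mul_right _ hZ.le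
        omega
      have hlT : l.length ≤ T := by omega
      set l2 := List.replicate (T - l.length) i0 ++ l with hl2
      have hl2len : l2.length = T := by simp [hl2]; omega
      have hl2r : rangeFrom s 1 l2 = rangeFrom s 1 l := rangeFrom_pad s i0 hs0 1 l _
      obtain ⟨t, ht⟩ : ∃ t : Fin T → ι, List.ofFn t = l2 := by
        clear_value l2
        subst hl2len
        exact ⟨l2.get, List.ofFn_get l2⟩
      have h1 := Finset.single_le_sum (f := fun t : Fin T → ι =>
        ind (rangeFrom s 1 l ⊆ rangeFrom s 1 (List.ofFn t)) *
          stayP (ract s) (rangeFrom s 1 (List.ofFn t) : Set G) 0 x)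
          (fun t _ => hterm l 0 x t) (Finset.mem_univ t)
      have h2 : ind (rangeFrom s 1 l ⊆ rangeFrom s 1 (List.ofFn t)) *
          stayP (ract s) (rangeFrom s 1 (List.ofFn t) : Set G) 0 x = 1 := by
        rw [ht, hl2r, ind_true (Finset.Subset.refl _), stayP, one_mul]
        dsimp only
        rw [if_pos (Finset.mem_coe.2 hx)]
      simp only [bfun]
      have h3 : 0 ≤ θ ^ (v - Z.card) := by positivity
      linarith
  | succ m ih =>
    intro x Z l hx hlen hcov
    -- extension of words
    have hext : ∀ (Z' : Finset G), (∀ y ∈ rangeFrom s 1 l, covered (Sg : Set G) Z' (y * p0)) →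
        ∀ i, ∃ l', rangeFrom s 1 l' = insert (x * s i) (rangeFrom s 1 l) ∧
        bfun s (Sg : Set G) p0 θ m (x * s i) Z' ≤ θ ^ (v - Z'.card) +
        ∑ t : Fin T → ι, ind (rangeFrom s 1 l' ⊆ rangeFrom s 1 (List.ofFn t)) *
          stayP (ract s) (rangeFrom s 1 (List.ofFn t) : Set G) m (x * s i) := by
      intro Z' hc i
      by_cases hin : x * s i ∈ rangeFrom s 1 l
      · refine ⟨l, (Finset.insert_eq_self.2 hin).symm, ih _ Z' l hin hlen fun y hy _ => hc y hy⟩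
      · obtain ⟨l', hl', hr⟩ := rangeFrom_detour s inv hinv i x l 1 hx
        refine ⟨l', hr, ih _ Z' l' (by rw [hr]; simp) ?_ ?_⟩
        · rw [hr, Finset.card_insert_of_notMem hin, hl']; omega
        · intro y hy hne
          rw [hr, Finset.mem_insert] at hy
          rcases hy with rfl | hy
          · exact absurd rfl hne
          · exact hc y hy
    rw [bfun]
    dsimp only
    split_ifs with hnear
    · refine hstep m x Z l _ hx (hext Z fun y hy => ?_)
      by_cases hyx : y = x
      · rw [hyx]; exact hnear
      · exact hcov y hy hyx
    · have hc' : ∀ y ∈ rangeFrom s 1 l, covered (Sg : Set G) (insert x Z) (y * p0) := by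
        intro y hy
        by_cases hyx : y = x
        · exact ⟨x, Finset.mem_insert_self _ _, p0, hp0, by rw [hyx]⟩
        · obtain ⟨z, hz, σ, hσ, h⟩ := hcov y hy hyx
          exact ⟨z, Finset.mem_insert_of_mem hz, σ, hσ, h⟩
      have h1 := hstep m x (insert x Z) l _ hx (hext (insert x Z) hc')
      have h2 := mul_le_mul_of_nonneg_left h1 hθ0
      refine h2.trans ?_
      rw [mul_add]
      have hs : 0 ≤ ∑ t : Fin T → ι, ind (rangeFrom s 1 l ⊆ rangeFrom s 1 (List.ofFn t)) *
          stayP (ract s) (rangeFrom s 1 (List.ofFn t) : Set G) (m + 1) x :=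
        Finset.sum_nonneg fun t _ => hterm l (m + 1) x t
      have h3 : θ * θ ^ (v - (insert x Z).card) ≤ θ ^ (v - Z.card) := by
        rw [← pow_succ']
        apply pow_le_pow_of_le_one hθ0 hθ1
        have := Finset.card_insert_le x Z
        omega
      nlinarith

end flow

/-! ### The flow homomorphism -/

section flowhom
variable {G : Type*} [Group G] {r : ℕ}

open Classical in
/-- Homomorphism to the wreath product recording flows. -/
def flowHom (a : Fin r → G) :
    FreeGroup (Fin r) →* RegularWreathProduct (Fin r → Multiplicative ℤ) G :=
  FreeGroup.lift fun i =>
    ⟨fun x j => if x = 1 ∧ j = i then Multiplicative.ofAdd 1 else 1, a i⟩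

/-- The flow of a free group element. -/
def flowD (a : Fin r → G) (q : FreeGroup (Fin r)) (e : G × Fin r) : ℤ :=
  Multiplicative.toAdd ((flowHom a q).left e.1 e.2)

lemma flowHom_right (a : Fin r → G) (q : FreeGroup (Fin r)) :
    (flowHom a q).right = FreeGroup.lift a q := by
  have : (RegularWreathProduct.rightHom.comp (flowHom a)) = FreeGroup.lift a := by
    ext i; simp [flowHom]
  exact DFunLike.congr_fun this q

lemma flowD_mul (a : Fin r → G) (p q : FreeGroup (Fin r)) (e : G × Fin r) :
    flowD a (p * q) e = flowD a p e + flowD a q ((FreeGroup.lift a p)⁻¹ * e.1, e.2) := by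
  unfold flowD
  rw [map_mul, RegularWreathProduct.mul_left, flowHom_right]
  simp

lemma flowD_one (a : Fin r → G) (e : G × Fin r) : flowD a 1 e = 0 := by
  unfold flowD
  rw [map_one]; simp

lemma flowD_inv (a : Fin r → G) (p : FreeGroup (Fin r)) (e : G × Fin r) :
    flowD a p⁻¹ e = - flowD a p (FreeGroup.lift a p * e.1, e.2) := by
  have h := flowD_mul a p p⁻¹ (FreeGroup.lift a p * e.1, e.2)
  rw [mul_inv_cancel, flowD_one] at h
  simp at h
  linarith

open Classical in
lemma flowD_of (a : Fin r → G) (i : Fin r) (e : G × Fin r) :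
    flowD a (FreeGroup.of i) e = if e.1 = 1 ∧ e.2 = i then 1 else 0 := by
  unfold flowD flowHom
  rw [FreeGroup.lift_apply_of]
  dsimp only
  split_ifs <;> simp

lemma flowD_support (a : Fin r → G) (q : FreeGroup (Fin r)) :
    {x : G | ∃ j, flowD a q (x, j) ≠ 0}.Finite := by
  classical
  induction q using FreeGroup.induction_on with
  | C1 => simp [flowD_one]
  | of i =>
    refine (Set.finite_singleton (1:G)).subset ?_
    rintro x ⟨j, hj⟩
    rw [flowD_of] at hj
    by_contra hx
    apply hj
    rw [if_neg]; rintro ⟨h, -⟩; exact hx h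
  | inv_of i ih =>
    refine (ih.image fun x => (FreeGroup.lift a (FreeGroup.of i))⁻¹ * x).subset ?_
    rintro x ⟨j, hj⟩
    rw [flowD_inv] at hj
    exact ⟨FreeGroup.lift a (FreeGroup.of i) * x, ⟨j, fun h => hj (by rw [h]; simp)⟩, by simp⟩
  | mul p q hp hq =>
    refine (hp.union (hq.image fun x => (FreeGroup.lift a p) * x)).subset ?_
    rintro x ⟨j, hj⟩
    rw [flowD_mul] at hj
    by_cases h : flowD a p (x, j) = 0
    · right
      exact ⟨(FreeGroup.lift a p)⁻¹ * x, ⟨j, fun h2 => hj (by rw [h]; simpa using h2)⟩, by simp⟩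
    · left; exact ⟨j, h⟩

lemma flowD_commutator (a : Fin r → G) (q : FreeGroup (Fin r))
    (hq : q ∈ ⁅(FreeGroup.lift a).ker, (FreeGroup.lift a).ker⁆) (e : G × Fin r) :
    flowD a q e = 0 := by
  have hle : ⁅(FreeGroup.lift a).ker, (FreeGroup.lift a).ker⁆ ≤ (flowHom a).ker := by
    rw [Subgroup.commutator_le]
    intro g hg h hh
    rw [MonoidHom.mem_ker, map_commutatorElement, commutatorElement_eq_one_iff_mul_comm]
    rw [MonoidHom.mem_ker] at hg hh
    have h1 := flowHom_right a g
    have h2 := flowHom_right a h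
    rw [hg] at h1
    rw [hh] at h2
    ext1
    · rw [RegularWreathProduct.mul_left, RegularWreathProduct.mul_left, h1, h2]
      simp [mul_comm]
    · rw [RegularWreathProduct.mul_right, RegularWreathProduct.mul_right, h1, h2]
  have := hle hq
  rw [MonoidHom.mem_ker] at this
  unfold flowD
  rw [this]; simp

/-- Existence of a relator with a nonzero flow. -/
lemma exists_rho (hr : 2 ≤ r)
    (H : Fin (r + 1) → Subgroup G) (hbot : H (Fin.last r) = ⊥)
    (a : Fin r → G) (ha : ∀ i : Fin r, a i ∈ H i.castSucc)
    (hnormal : ∀ i : Fin r, ∀ g ∈ H i.castSucc, ∀ x ∈ H i.succ, g * x * g⁻¹ ∈ H i.succ)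
    (hcyclic : ∀ i : Fin r, ∀ g ∈ H i.castSucc, ∃ n : ℤ, ((a i) ^ n)⁻¹ * g ∈ H i.succ) :
    ∃ ρ : FreeGroup (Fin r), FreeGroup.lift a ρ = 1 ∧ ∃ e, flowD a ρ e ≠ 0 := by
  classical
  set l : Fin r := ⟨r - 1, by omega⟩ with hl
  set p : Fin r := ⟨r - 2, by omega⟩ with hp
  by_cases h1 : a l = 1
  · exact ⟨FreeGroup.of l, by simpa using h1, (1, l), by rw [flowD_of]; simp⟩
  have hls : l.succ = Fin.last r := by ext; simp [hl]; omega
  have hps : p.succ = l.castSucc := by ext; simp [hl, hp]; omega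
  have hc : a p * a l * (a p)⁻¹ ∈ H l.castSucc := by
    have := hnormal p (a p) (ha p) (a l) (by rw [hps]; exact ha l)
    rwa [hps] at this
  obtain ⟨k, hk⟩ := hcyclic l _ hc
  rw [hls, hbot, Subgroup.mem_bot] at hk
  have hk' : a p * a l * (a p)⁻¹ = a l ^ k := by
    rw [inv_mul_eq_one] at hk; exact hk.symm
  have hpl : p ≠ l := by intro h; rw [Fin.ext_iff] at h; simp [hp, hl] at h; omega
  set s : FreeGroup (Fin r) := FreeGroup.of p with hs
  set t : FreeGroup (Fin r) := FreeGroup.of l with ht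
  have ht0 : ∀ x, flowD a t (x, p) = 0 := by
    intro x; rw [ht, flowD_of, if_neg]; rintro ⟨-, h⟩; exact hpl h
  have htn : ∀ n : ℤ, ∀ x, flowD a (t ^ n) (x, p) = 0 := by
    intro n
    induction n using Int.induction_on with
    | zero => intro x; rw [zpow_zero, flowD_one]
    | succ n ih => intro x; rw [zpow_add_one, flowD_mul, ih, ht0]; simp
    | pred n ih => intro x; rw [zpow_sub_one, flowD_mul, ih, flowD_inv, ht0]; simp
  refine ⟨s * t * s⁻¹ * t ^ (-k), ?_, (1, p), ?_⟩
  · simp only [map_mul, map_inv, map_zpow, hs, ht, FreeGroup.lift_apply_of]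
    rw [hk', zpow_neg, mul_inv_cancel]
  · rw [flowD_mul, htn, flowD_mul, flowD_mul, flowD_inv, ht0, hs, flowD_of, flowD_of]
    simp only [map_mul, ht, FreeGroup.lift_apply_of]
    have hne : ¬ (a p * ((a p * a l)⁻¹ * 1) = 1) := by
      intro h
      apply h1
      rw [mul_one, mul_inv_rev, ← mul_assoc] at h
      have h2 := congrArg (fun z => z * a p) h
      simp at h2
      exact h2
    rw [mul_one, mul_inv_rev] at hne
    simp [hne]

/-! ### Blocks -/

/-- Value of a block of letters. -/
def blockVal {Λ Q : Type*} [Group Q] (s : Λ → Q) {L : ℕ} (b : Fin L → Λ) : Q :=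
  (List.ofFn fun k => s (b k)).prod

lemma iter_block {Λ Q : Type*} [Fintype Λ] [Group Q] (s : Λ → Q) (L : ℕ) (f : Q → ℝ) (x : Q) :
    (avgOp (ract s))^[L] f x = avgOp (ract (fun b : Fin L → Λ => blockVal s b)) f x := by
  classical
  induction L generalizing x with
  | zero => simp [avgOp, ract, blockVal]
  | succ L ih =>
    rw [Function.iterate_succ_apply']
    unfold avgOp
    rw [← Equiv.sum_comp (Fin.consEquiv fun _ => Λ), Fintype.sum_prod_type]
    have h1 : ∀ i, (avgOp (ract s))^[L] f (ract s i x) =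
      (∑ b : Fin L → Λ, f (ract (fun b : Fin (L+1) → Λ => blockVal s b) ((Fin.consEquiv fun _ => Λ) (i, b)) x)) /
        (Fintype.card (Fin L → Λ) : ℝ) := by
      intro i
      rw [ih, avgOp]
      congr 1
      refine Finset.sum_congr rfl fun b _ => ?_
      simp [ract, blockVal, Fin.consEquiv, List.ofFn_succ, mul_assoc]
    change (∑ i, (avgOp (ract s))^[L] f (ract s i x)) / _ = _
    rw [Finset.sum_congr rfl fun i _ => h1 i, ← Finset.sum_div, div_div]
    congr 1
    simp [pow_succ]

lemma iter_mul {ι X : Type*} [Fintype ι] (act : ι → X → X) (L m : ℕ) (f : X → ℝ) :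
    (avgOp act)^[L * m] f = ((avgOp act)^[L])^[m] f := by rw [Function.iterate_mul]

/-- Inverse block. -/
def blockInv {Λ : Type*} (inv : Λ ≃ Λ) (L : ℕ) : (Fin L → Λ) ≃ (Fin L → Λ) :=
  (Equiv.arrowCongr Fin.revPerm inv)

lemma blockVal_inv {Λ Q : Type*} [Group Q] (s : Λ → Q) (inv : Λ ≃ Λ)
    (hinv : ∀ i, s (inv i) = (s i)⁻¹) {L : ℕ} (b : Fin L → Λ) :
    blockVal s (blockInv inv L b) = (blockVal s b)⁻¹ := by
  unfold blockVal
  rw [List.prod_inv_reverse]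
  congr 1
  apply List.ext_getElem
  · simp
  · intro n h1 h2
    simp [blockInv, hinv, List.getElem_reverse]
    congr 2
    ext
    simp [Fin.rev]
    try omega

end flowhom

section upper
variable {G : Type*} [Group G] {r : ℕ}

lemma blockVal_map {Λ Q Q' : Type*} [Group Q] [Group Q'] (φ : Q →* Q') (s : Λ → Q) {L : ℕ}
    (b : Fin L → Λ) : φ (blockVal s b) = blockVal (fun l => φ (s l)) b := by
  unfold blockVal
  rw [map_list_prod, List.map_ofFn]; rfl

lemma closure_stepOf_of : Subgroup.closure (Set.range (stepOf (FreeGroup.of : Fin r → _))) = ⊤ := by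
  rw [eq_top_iff, ← FreeGroup.closure_range_of]
  apply Subgroup.closure_mono
  rintro _ ⟨i, rfl⟩
  exact ⟨(i, true, false), by simp [stepOf]⟩

lemma exists_block_eq (L : ℕ) (hL : 1 ≤ L) (l : Letter r) :
    ∃ b : Fin L → Letter r, blockVal (stepOf (FreeGroup.of : Fin r → _)) b = stepOf FreeGroup.of l := by
  obtain ⟨L', hL'⟩ : ∃ L', L = L' + 1 := ⟨L - 1, by omega⟩
  subst hL'
  refine ⟨Fin.cons l (fun _ => (l.1, true, true)), ?_⟩
  simp [blockVal, List.ofFn_succ, stepOf]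

lemma upper_core (a : Fin r → G) (hsurj : Function.Surjective (FreeGroup.lift a))
    (hexp : HasExpGrowth G) (ρ : FreeGroup (Fin r)) (hρ : FreeGroup.lift a ρ = 1)
    (e0 : G × Fin r) (he0 : flowD a ρ e0 ≠ 0) :
    ∃ (L : ℕ) (S : ℕ) (A θ c0 : ℝ), 1 ≤ L ∧ 1 ≤ S ∧ 1 ≤ A ∧ 0 ≤ θ ∧ θ < 1 ∧ 0 < c0 ∧ c0 ≤ 1 ∧
      ∀ (f : G × Fin r → ℤ) (m v : ℕ),
      (avgOp (ract (stepOf (FreeGroup.of : Fin r → _))))^[L * m]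
        (fun q => ind (∀ e, flowD a q e = f e)) 1 ≤
        θ ^ v + A ^ (2 * (v * S + 1)) * ((1 - c0 / (1 + Real.log (2 * (v * S + 1) + 1 : ℕ)) ^ 2) ^ m *
          (2 * (v * S + 1) + 1 : ℕ)) := by
  classical
  have hstinv : ∀ l, stepOf (FreeGroup.of : Fin r → _) (letterInv r l) = (stepOf FreeGroup.of l)⁻¹ :=
    stepOf_inv _
  obtain ⟨w, hw⟩ := exists_word (stepOf (FreeGroup.of : Fin r → _)) (letterInv r) hstinv
    closure_stepOf_of ρ
  set L := w.length with hL
  have hL1 : 1 ≤ L := by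
    rw [Nat.one_le_iff_ne_zero]
    intro h0
    have : w = [] := List.length_eq_zero_iff.1 h0
    rw [this] at hw
    simp at hw
    rw [← hw, flowD_one] at he0
    exact he0 rfl
  set W : (Fin L → Letter r) → FreeGroup (Fin r) := fun b => blockVal (stepOf FreeGroup.of) b with hW
  set i1 : Fin L → Letter r := fun k => w.get k with hi1
  set i0 : Fin L → Letter r := fun k => ((w.get k).1, true, true) with hi0
  have hW1 : W i1 = ρ := by
    rw [← hw]
    simp only [hW, blockVal, hi1]
    congr 1
    apply List.ext_getElem
    · simp [hL]
    · intro n h1 h2; simp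
  have hW0 : W i0 = 1 := by
    simp only [hW, blockVal, hi0, stepOf]
    apply List.prod_eq_one
    intro x hx
    rw [List.mem_ofFn] at hx
    obtain ⟨k, hk⟩ := hx
    simpa using hk.symm
  have hne : i0 ≠ i1 := by
    intro h
    rw [← hW1, ← h, hW0, flowD_one] at he0
    exact he0 rfl
  haveI : Nonempty (Fin L → Letter r) := ⟨i0⟩
  set s : (Fin L → Letter r) → G := fun b => FreeGroup.lift a (W b) with hs
  set c : (Fin L → Letter r) → G × Fin r → ℤ := fun b => flowD a (W b) with hc
  have hsinv : ∀ b, s (blockInv (letterInv r) L b) = (s b)⁻¹ := by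
    intro b
    simp only [hs, hW]
    rw [blockVal_inv _ _ hstinv, map_inv]
  have hgen : Subgroup.closure (Set.range s) = ⊤ := by
    have h1 : Subgroup.closure (Set.range W) = ⊤ := by
      rw [eq_top_iff, ← closure_stepOf_of, Subgroup.closure_le]
      rintro _ ⟨l, rfl⟩
      apply Subgroup.subset_closure
      exact exists_block_eq L hL1 l
    have h2 : Set.range s = FreeGroup.lift a '' Set.range W := by
      rw [← Set.range_comp]; rfl
    rw [h2, ← MonoidHom.map_closure, h1, ← MonoidHom.range_eq_map]
    exact MonoidHom.range_eq_top.2 hsurj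
  obtain ⟨c0, hc0, hc01, hfk⟩ := faber_krahn s (blockInv (letterInv r) L) hsinv hgen hexp
  set Sg : Finset G := (flowD_support a ρ).toFinset with hSg
  have hcard : (1:ℝ) ≤ Fintype.card (Fin L → Letter r) := by exact_mod_cast Fintype.card_pos
  have hp0 : e0.1 ∈ Sg := by
    rw [hSg, Set.Finite.mem_toFinset]; exact ⟨e0.2, he0⟩
  refine ⟨L, Sg.card, Fintype.card (Fin L → Letter r), 1 - 1 / (Fintype.card (Fin L → Letter r) : ℝ), c0, hL1,
    Finset.card_pos.2 ⟨_, hp0⟩, hcard, ?_, ?_, hc0, hc01, fun f m v => ?_⟩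
  · rw [sub_nonneg, div_le_one (by linarith)]; exact hcard
  · have : 0 < 1 / (Fintype.card (Fin L → Letter r) : ℝ) := by positivity
    linarith
  rw [iter_mul]
  have hblk : (avgOp (ract (stepOf (FreeGroup.of : Fin r → _))))^[L] =
      fun g : FreeGroup (Fin r) → ℝ => avgOp (ract W) g := by
    funext g x; exact iter_block _ _ _ _
  rw [hblk]
  have hsem := iter_semiconj (ract W) (flowAct s c) (fun q => (flowD a q, FreeGroup.lift a q))
    (by
      intro b q
      simp only [ract, flowAct, Prod.mk.injEq]
      refine ⟨?_, by simp [hs]⟩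
      funext e
      rw [flowD_mul]) (fun p => ind (∀ e, p.1 e = f e)) m 1
  change (avgOp (ract W))^[m] _ 1 ≤ _
  rw [hsem]
  have h1 := flow_le_bfun s c i0 i1 hne (by simp [hs, hW0]) (by intro e; simp [hc, hW0, flowD_one])
    (by simp [hs, hW1, hρ]) (Sg : Set G)
    (by
      intro e he
      rw [hSg, Set.Finite.coe_toFinset]
      simp only [hc, hW1] at he
      exact ⟨e.2, he⟩) e0 (by simp only [hc, hW1]; exact he0) m (flowD a 1) (FreeGroup.lift a 1) ∅ f
  have hnc : ∀ y, ¬ covered (Sg : Set G) ∅ y := by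
    rintro y ⟨z, hz, -⟩; simp at hz
  have h2 : (fun p : (G × Fin r → ℤ) × G => ind (∀ e, ¬ covered (Sg : Set G) ∅ e.1 → p.1 e = f e)) =
      fun p => ind (∀ e, p.1 e = f e) := by
    funext p; congr 1; simp [hnc]
  rw [h2] at h1
  refine h1.trans ?_
  have hθ0 : 0 ≤ 1 - 1 / (Fintype.card (Fin L → Letter r) : ℝ) := by
    rw [sub_nonneg, div_le_one (by linarith)]; exact hcard
  have hθ1 : 1 - 1 / (Fintype.card (Fin L → Letter r) : ℝ) ≤ 1 := by
    have : 0 < 1 / (Fintype.card (Fin L → Letter r) : ℝ) := by positivity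
    linarith
  have h3 := bfun_le s (blockInv (letterInv r) L) hsinv i0 (by simp [hs, hW0]) Sg e0.1 hp0
    _ hθ0 hθ1 v (2 * (v * Sg.card + 1)) le_rfl m (FreeGroup.lift a 1) ∅ [] (by simp [rangeFrom])
    (by simp) (by simp [rangeFrom])
  refine h3.trans ?_
  rw [Finset.card_empty, Nat.sub_zero]
  gcongr
  set T := 2 * (v * Sg.card + 1) with hT
  have h4 : ∀ t : Fin T → (Fin L → Letter r),
      ind (rangeFrom s 1 [] ⊆ rangeFrom s 1 (List.ofFn t)) *
          stayP (ract s) (rangeFrom s 1 (List.ofFn t) : Set G) m (FreeGroup.lift a 1) ≤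
      (1 - c0 / (1 + Real.log (T + 1 : ℕ)) ^ 2) ^ m * (T + 1 : ℕ) := by
    intro t
    have hcd := card_rangeFrom s 1 (List.ofFn t)
    rw [List.length_ofFn] at hcd
    have hne : (rangeFrom s 1 (List.ofFn t)).Nonempty := ⟨1, self_mem_rangeFrom _ _ _⟩
    have hcd1 : 1 ≤ (rangeFrom s 1 (List.ofFn t)).card := Finset.card_pos.2 hne
    have h5 := hfk _ hne m (FreeGroup.lift a 1)
    have h6 : ind (rangeFrom s 1 [] ⊆ rangeFrom s 1 (List.ofFn t)) *
          stayP (ract s) (rangeFrom s 1 (List.ofFn t) : Set G) m (FreeGroup.lift a 1) ≤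
          stayP (ract s) (rangeFrom s 1 (List.ofFn t) : Set G) m (FreeGroup.lift a 1) :=
      mul_le_of_le_one_left (stayP_nonneg _ _ _ _) (ind_le_one _)
    refine h6.trans (h5.trans ?_)
    have hlog0 : 0 ≤ Real.log ((rangeFrom s 1 (List.ofFn t)).card : ℝ) :=
      Real.log_nonneg (by exact_mod_cast hcd1)
    have hb : 0 ≤ 1 - c0 / (1 + Real.log ((rangeFrom s 1 (List.ofFn t)).card : ℝ)) ^ 2 := by
      rw [sub_nonneg, div_le_one (by positivity)]
      nlinarith
    refine mul_le_mul (pow_le_pow_left₀ hb ?_ m) (by exact_mod_cast hcd) (by positivity) ?_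
    · gcongr
    · refine pow_nonneg ?_ _
      have hlog1 : 0 ≤ Real.log ((T + 1 : ℕ) : ℝ) := Real.log_nonneg (by push_cast; linarith [(Nat.cast_nonneg T : (0:ℝ) ≤ T)])
      rw [sub_nonneg, div_le_one (by positivity)]
      nlinarith
  refine (Finset.sum_le_sum fun t _ => h4 t).trans ?_
  rw [Finset.sum_const, nsmul_eq_mul]
  simp only [Finset.card_univ]
  rw [Fintype.card_fun, Fintype.card_fin]
  push_cast
  exact le_rfl

lemma upper_all (a : Fin r → G) (hr : 0 < r) (hsurj : Function.Surjective (FreeGroup.lift a))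
    (hexp : HasExpGrowth G) (ρ : FreeGroup (Fin r)) (hρ : FreeGroup.lift a ρ = 1)
    (e0 : G × Fin r) (he0 : flowD a ρ e0 ≠ 0) :
    ∃ (L : ℕ) (S : ℕ) (A θ c0 : ℝ), 1 ≤ L ∧ 1 ≤ S ∧ 1 ≤ A ∧ 0 ≤ θ ∧ θ < 1 ∧ 0 < c0 ∧ c0 ≤ 1 ∧
      ∀ (m v n : ℕ), L * m ≤ n →
      convPow (lazySRWQuot r ⁅(FreeGroup.lift a).ker, (FreeGroup.lift a).ker⁆) n 1 ≤
        θ ^ v + A ^ (2 * (v * S + 1)) * ((1 - c0 / (1 + Real.log (2 * (v * S + 1) + 1 : ℕ)) ^ 2) ^ m *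
          (2 * (v * S + 1) + 1 : ℕ)) := by
  obtain ⟨L, S, A, θ, c0, h1, h2, h3, h4, h5, h6, h7, h8⟩ := upper_core a hsurj hexp ρ hρ e0 he0
  refine ⟨L, S, A, θ, c0, h1, h2, h3, h4, h5, h6, h7, fun m v n hn => ?_⟩
  haveI : Nonempty (Letter r) := ⟨(⟨0, hr⟩, true, true)⟩
  rw [return_eq r hr]
  set M := ⁅(FreeGroup.lift a).ker, (FreeGroup.lift a).ker⁆ with hM
  have hsem := iter_semiconj (ract (stepOf (FreeGroup.of : Fin r → _))) (ract (qstep M))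
    (fun q => (QuotientGroup.mk q : FreeGroup (Fin r) ⧸ M)) (by
      intro l q
      simp only [ract, qstep, QuotientGroup.mk_mul]
      congr 1
      exact stepOf_map (QuotientGroup.mk' M) FreeGroup.of l) (fun q => ind (q = 1)) n 1
  rw [QuotientGroup.mk_one] at hsem
  rw [← hsem]
  refine (iter_mono _ (g := fun q => ind (∀ e, flowD a q e = 0)) (fun q => ind_mono fun h => ?_) n 1).trans ?_
  · rw [QuotientGroup.eq_one_iff] at h
    exact flowD_commutator a q h
  obtain ⟨k, rfl⟩ := Nat.exists_eq_add_of_le hn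
  rw [add_comm, Function.iterate_add_apply]
  refine iter_le_const _ (fun q => ?_) k 1
  have hsem2 := iter_semiconj (ract (stepOf (FreeGroup.of : Fin r → _)))
    (ract (stepOf (FreeGroup.of : Fin r → _)))
    (fun p => q * p) (by intro l p; simp [ract, mul_assoc]) (fun q => ind (∀ e, flowD a q e = 0)) (L * m) 1
  rw [mul_one] at hsem2
  rw [← hsem2]
  refine (iter_mono _ (fun p => ?_) _ _).trans
    (h8 (fun e => - flowD a q (FreeGroup.lift a q * e.1, e.2)) m v)
  apply ind_mono
  intro h e
  have := h (FreeGroup.lift a q * e.1, e.2)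
  rw [flowD_mul] at this
  simp at this
  linarith

end upper

section uppernum
open Filter

lemma ev_log (K : ℝ) : ∀ᶠ n : ℕ in atTop, 1 ≤ Real.log n ∧ K ≤ Real.log n ∧
    K * Real.log n ≤ n / (Real.log n) ^ 2 := by
  have h1 : Tendsto (fun n : ℕ => Real.log n) atTop atTop :=
    Real.tendsto_log_atTop.comp tendsto_natCast_atTop_atTop
  have h2 := (Real.isLittleO_pow_log_id_atTop (n := 3)).bound (c := 1 / (|K| + 1)) (by positivity)
  have h3 := tendsto_natCast_atTop_atTop (R := ℝ).eventually h2
  filter_upwards [h1.eventually_ge_atTop 1, h1.eventually_ge_atTop K, h3] with n ha hb hc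
  refine ⟨ha, hb, ?_⟩
  have h0 : 0 < Real.log n := by linarith
  simp only [id, Real.norm_eq_abs] at hc
  rw [abs_of_nonneg (show 0 ≤ Real.log n ^ 3 by positivity), abs_of_nonneg (show (0:ℝ) ≤ n by positivity)] at hc
  rw [le_div_iff₀ (by positivity)]
  have h4 : (|K| + 1) * Real.log n ^ 3 ≤ n := by
    have := mul_le_mul_of_nonneg_left hc (show 0 ≤ |K| + 1 by positivity)
    calc _ ≤ _ := this
      _ = n := by field_simp
  have h5 : K * Real.log n ^ 3 ≤ (|K| + 1) * Real.log n ^ 3 := by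
    gcongr; linarith [le_abs_self K]
  calc _ = K * Real.log n ^ 3 := by ring
    _ ≤ _ := by linarith

lemma log_ge_two {n : ℕ} (hn : 2 ≤ n) : (1/2 : ℝ) ≤ Real.log n := by
  have h1 : Real.log 2 ≤ Real.log n := Real.log_le_log (by norm_num) (by exact_mod_cast hn)
  linarith [Real.log_two_gt_d9]

lemma small_n_upper (p : ℕ → ℝ) (η : ℝ) (hη : 0 < η) (n0 : ℕ) (κ : ℝ) (hκ : κ < 1)
    (hsm : ∀ n, 2 ≤ n → p n ≤ κ)
    (hl : ∀ n, n0 ≤ n → 2 ≤ n → p n ≤ Real.exp (-η * (n / (Real.log n) ^ 2))) :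
    ∃ C0 : ℝ, 1 ≤ C0 ∧ ∀ C, C0 ≤ C → ∀ n : ℕ, 2 ≤ n →
      p n ≤ Real.exp (-(1 / C) * (n : ℝ) / (Real.log n) ^ 2) := by
  set κ' := max κ (1/2) with hκ'
  have hk0 : 0 < κ' := lt_of_lt_of_le (by norm_num) (le_max_right _ _)
  have hk1 : κ' < 1 := max_lt hκ (by norm_num)
  have hlk : 0 < - Real.log κ' := by
    have := Real.log_neg hk0 hk1; linarith
  refine ⟨max 1 (max (1/η) (4 * n0 / (-Real.log κ'))), le_max_left _ _, fun C hC n hn => ?_⟩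
  have hC1 : 1 ≤ C := (le_max_left _ _).trans hC
  have hC2 : 1 / η ≤ C := (le_max_left _ _).trans ((le_max_right _ _).trans hC)
  have hC3 : 4 * n0 / (-Real.log κ') ≤ C := (le_max_right _ _).trans ((le_max_right _ _).trans hC)
  have hlog := log_ge_two hn
  have hX : 0 ≤ (n:ℝ) / (Real.log n) ^ 2 := by positivity
  by_cases h : n0 ≤ n
  · refine (hl n h hn).trans ?_
    rw [Real.exp_le_exp, mul_div_assoc]
    have : 1 / C ≤ η := by
      rw [div_le_iff₀ (by linarith)]
      rw [div_le_iff₀ hη] at hC2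
      linarith
    nlinarith
  · refine (hsm n hn).trans ((le_max_left _ (1/2)).trans ?_)
    rw [← hκ', ← Real.log_le_iff_le_exp hk0]
    rw [mul_div_assoc]
    have hX2 : (n:ℝ) / (Real.log n) ^ 2 ≤ 4 * n0 := by
      have hnn : (n:ℝ) ≤ n0 := by exact_mod_cast (by omega : n ≤ n0)
      rw [div_le_iff₀ (by positivity)]
      have : (1:ℝ)/4 ≤ Real.log n ^ 2 := by nlinarith
      have hn0 : (0:ℝ) ≤ n0 := by positivity
      nlinarith
    rw [div_le_iff₀ hlk] at hC3
    have h5 : 1 / C * (n / Real.log n ^ 2) ≤ - Real.log κ' := by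
      rw [div_mul_eq_mul_div, one_mul, div_le_iff₀ (by linarith)]
      linarith
    linarith

set_option maxHeartbeats 1000000 in
lemma upper_numeric (p : ℕ → ℝ) (L S : ℕ) (A θ c0 : ℝ) (hL : 1 ≤ L) (hS : 1 ≤ S) (hA : 1 ≤ A)
    (hθ0 : 0 ≤ θ) (hθ1 : θ < 1) (hc0 : 0 < c0) (hc01 : c0 ≤ 1)
    (hp : ∀ (m v n : ℕ), L * m ≤ n → p n ≤
      θ ^ v + A ^ (2 * (v * S + 1)) * ((1 - c0 / (1 + Real.log (2 * (v * S + 1) + 1 : ℕ)) ^ 2) ^ m *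
          (2 * (v * S + 1) + 1 : ℕ))) :
    ∃ (η : ℝ) (n0 : ℕ), 0 < η ∧ ∀ n : ℕ, n0 ≤ n → 2 ≤ n →
      p (2 * n) ≤ Real.exp (-η * (n / (Real.log n) ^ 2)) := by
  have hLr : (1:ℝ) ≤ L := by exact_mod_cast hL
  have hSr : (1:ℝ) ≤ S := by exact_mod_cast hS
  have hlA : 0 ≤ Real.log A := Real.log_nonneg hA
  set δ : ℝ := min (1 / (4 * S)) (c0 / (32 * L * (2 * S * (Real.log A + 1)))) with hδ
  have hδ0 : 0 < δ := lt_min (by positivity) (by positivity)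
  have hδ1 : 2 * S * δ ≤ 1 / 2 := by
    have : δ ≤ 1 / (4 * S) := min_le_left _ _
    calc 2 * S * δ ≤ 2 * S * (1 / (4 * S)) := by gcongr
      _ = 1/2 := by field_simp; norm_num
  have hδ2 : 2 * S * Real.log A * δ ≤ c0 / (32 * L) := by
    have : δ ≤ c0 / (32 * L * (2 * S * (Real.log A + 1))) := min_le_right _ _
    calc 2 * S * Real.log A * δ ≤ 2 * S * (Real.log A + 1) * (c0 / (32 * L * (2 * S * (Real.log A + 1)))) := by
          gcongr; linarith
      _ = _ := by field_simp
  set lam := 1 - θ with hlam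
  have hlam0 : 0 < lam := by linarith
  set η : ℝ := min (lam * δ / 2) (c0 / (16 * L)) / 2 with hη
  have hη0 : 0 < η := by
    have : 0 < min (lam * δ / 2) (c0 / (16 * L)) := lt_min (by positivity) (by positivity)
    positivity
  have hη1 : 2 * η ≤ lam * δ / 2 := by
    rw [hη]; linarith [min_le_left (lam * δ / 2) (c0 / (16 * L))]
  have hη2 : 2 * η ≤ c0 / (16 * L) := by
    rw [hη]; linarith [min_le_right (lam * δ / 2) (c0 / (16 * L))]
  set K : ℝ := 2 / δ + 1 / η + 64 * L / c0 + 2 * Real.log A + 1 with hK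
  have hKp : 0 < 2/δ ∧ 0 < 1/η ∧ 0 < 64 * L / c0 := ⟨by positivity, by positivity, by positivity⟩
  obtain ⟨n1, hn1⟩ := eventually_atTop.1 (ev_log K)
  refine ⟨η, n1 + 2 * L + 6, hη0, fun n hn hn2 => ?_⟩
  obtain ⟨hlog1, hlogK, hX⟩ := hn1 n (by omega)
  set l := Real.log n with hl
  set X : ℝ := n / l ^ 2 with hXd
  have hl0 : 0 < l := by linarith
  have hX0 : 0 ≤ X := by positivity
  have hK0 : 0 ≤ K := by linarith [hKp.1, hKp.2.1, hKp.2.2]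
  have hXK : K ≤ X := le_trans (le_mul_of_one_le_right hK0 hlog1) hX
  have hnr : (2 * L + 6 : ℝ) ≤ n := by exact_mod_cast (by omega : 2 * L + 6 ≤ n)
  have hXn : X ≤ n := by
    rw [hXd]; apply div_le_self (by positivity); exact one_le_pow₀ hlog1
  set v := ⌊δ * X⌋₊ with hv
  set m := n / L with hm
  have hv1 : (v:ℝ) ≤ δ * X := Nat.floor_le (by positivity)
  have hv2 : δ * X / 2 ≤ v := by
    have h1 : δ * X < v + 1 := Nat.lt_floor_add_one _
    have h2 : 2 / δ ≤ X := by linarith [hKp.1, hKp.2.1, hKp.2.2]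
    rw [div_le_iff₀ hδ0] at h2
    linarith
  have hm1 : (n:ℝ) / (2 * L) ≤ m := by
    rw [div_le_iff₀ (by positivity)]
    have : n < (m + 1) * L := by rw [hm, mul_comm]; exact Nat.lt_mul_div_succ n (by omega)
    have h2 : (n:ℝ) < (m + 1) * L := by exact_mod_cast this
    linarith
  set T := 2 * (v * S + 1) with hT
  have hTr : (T:ℝ) = 2 * v * S + 2 := by rw [hT]; push_cast; ring
  have hTn : ((T + 1 : ℕ) : ℝ) ≤ n := by
    push_cast
    rw [hTr]
    have q1 : (2 * S : ℝ) * v ≤ (2 * S) * (δ * X) := by gcongr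
    have q2 : (2 * S * δ) * X ≤ 1 / 2 * X := by gcongr
    linarith
  have hTlog : Real.log ((T + 1 : ℕ) : ℝ) ≤ l := Real.log_le_log (by positivity) hTn
  have hTlog0 : 0 ≤ Real.log ((T + 1 : ℕ) : ℝ) := Real.log_natCast_nonneg _
  have h1 := hp m v (2 * n) (by
    have := Nat.mul_div_le n L
    rw [← hm] at this
    omega)
  have hA1 : θ ^ v ≤ Real.exp (-(2 * η) * X) := by
    have h2 : θ ≤ Real.exp (-lam) := by
      have := Real.add_one_le_exp (-lam); linarith
    calc θ ^ v ≤ Real.exp (-lam) ^ v := pow_le_pow_left₀ hθ0 h2 v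
      _ = Real.exp (-lam * v) := by rw [← Real.exp_nat_mul]; ring_nf
      _ ≤ _ := by
        rw [Real.exp_le_exp]
        have q1 : lam * (δ * X / 2) ≤ lam * v := by gcongr
        have q2 : 2 * η * X ≤ lam * δ / 2 * X := by gcongr
        linarith
  have hA2 : A ^ T * ((1 - c0 / (1 + Real.log (T + 1 : ℕ)) ^ 2) ^ m * (T + 1 : ℕ)) ≤
      Real.exp (-(2 * η) * X) := by
    have e1 : A ^ T ≤ Real.exp (Real.log A * T) := by
      rw [mul_comm, Real.exp_nat_mul, Real.exp_log (by linarith)]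
    have e2 : ((T + 1 : ℕ) : ℝ) ≤ Real.exp l := by
      rw [hl, Real.exp_log (by linarith)]; exact hTn
    have e3 : (1 - c0 / (1 + Real.log (T + 1 : ℕ)) ^ 2) ^ m ≤ Real.exp (-(c0 / (8 * L)) * X) := by
      have b0 : 0 ≤ 1 - c0 / (1 + Real.log (T + 1 : ℕ)) ^ 2 := by
        rw [sub_nonneg, div_le_one (by positivity)]; exact hc01.trans (one_le_pow₀ (by linarith))
      have b1 : 1 - c0 / (1 + Real.log (T + 1 : ℕ)) ^ 2 ≤ 1 - c0 / (2 * l) ^ 2 := by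
        gcongr; linarith
      have b2 : 1 - c0 / (2 * l) ^ 2 ≤ Real.exp (-(c0 / (2 * l) ^ 2)) := by
        have := Real.add_one_le_exp (-(c0 / (2 * l) ^ 2)); linarith
      calc _ ≤ Real.exp (-(c0 / (2 * l) ^ 2)) ^ m := pow_le_pow_left₀ b0 (b1.trans b2) m
        _ = Real.exp (-(c0 / (2 * l) ^ 2) * m) := by rw [← Real.exp_nat_mul]; ring_nf
        _ ≤ _ := by
          rw [Real.exp_le_exp]
          have : c0 / (2 * l) ^ 2 * (n / (2 * L)) ≤ c0 / (2 * l) ^ 2 * m := by gcongr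
          have e : c0 / (2 * l) ^ 2 * (n / (2 * L)) = c0 / (8 * L) * X := by
            rw [hXd]; field_simp; ring
          linarith
    have b0 : 0 ≤ (1 - c0 / (1 + Real.log (T + 1 : ℕ)) ^ 2) := by
        rw [sub_nonneg, div_le_one (by positivity)]; exact hc01.trans (one_le_pow₀ (by linarith))
    calc _ ≤ Real.exp (Real.log A * T) * (Real.exp (-(c0 / (8 * L)) * X) * Real.exp l) := by
          gcongr
      _ = Real.exp (Real.log A * T + (-(c0 / (8 * L)) * X + l)) := by
          rw [Real.exp_add, Real.exp_add]
      _ ≤ _ := by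
        rw [Real.exp_le_exp]
        have f1 : Real.log A * T ≤ c0 / (32 * L) * X + 2 * Real.log A := by
          rw [hTr]
          have : Real.log A * (2 * v * S) ≤ (2 * S * Real.log A * δ) * X := by
            have : (2 * S * Real.log A) * v ≤ (2 * S * Real.log A) * (δ * X) := by gcongr
            linarith
          have : (2 * S * Real.log A * δ) * X ≤ c0 / (32 * L) * X := by gcongr
          linarith
        have f2 : 2 * Real.log A + l ≤ c0 / (32 * L) * X := by
          have g1 : 2 * Real.log A ≤ l := by linarith [hKp.1, hKp.2.1, hKp.2.2]
          have g2 : 64 * L / c0 * l ≤ X := by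
            have : 64 * L / c0 ≤ K := by linarith [hKp.1, hKp.2.1, hKp.2.2]
            have : 64 * L / c0 * l ≤ K * l := by gcongr
            linarith
          have g3 : c0 / (32 * L) * (64 * L / c0 * l) ≤ c0 / (32 * L) * X := by gcongr
          have g4 : c0 / (32 * L) * (64 * L / c0 * l) = 2 * l := by field_simp; norm_num
          linarith
        have f3 : c0 / (8 * L) * X = c0 / (32 * L) * X + c0 / (32 * L) * X + c0 / (16 * L) * X := by
          field_simp; ring
        have f4 : 2 * η * X ≤ c0 / (16 * L) * X := by gcongr
        linarith
  calc p (2 * n) ≤ Real.exp (-(2 * η) * X) + Real.exp (-(2 * η) * X) := by linarith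
    _ = 2 * Real.exp (-(2 * η) * X) := by ring
    _ ≤ Real.exp (η * X) * Real.exp (-(2 * η) * X) := by
      gcongr
      have : 1 / η ≤ X := by linarith [hKp.1, hKp.2.1, hKp.2.2]
      rw [div_le_iff₀ hη0] at this
      linarith [Real.add_one_le_exp (η * X)]
    _ = _ := by rw [← Real.exp_add]; congr 1; ring

lemma small_bound {G : Type*} [Group G] {r : ℕ} (hr : 0 < r) (a : Fin r → G) :
    ∃ κ : ℝ, κ < 1 ∧ ∀ n, 2 ≤ n →
      convPow (lazySRWQuot r ⁅(FreeGroup.lift a).ker, (FreeGroup.lift a).ker⁆) (2 * n) 1 ≤ κ := by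
  classical
  set M := ⁅(FreeGroup.lift a).ker, (FreeGroup.lift a).ker⁆ with hM
  haveI : Nonempty (Letter r) := ⟨(⟨0, hr⟩, true, true)⟩
  have hcard : (0:ℝ) < Fintype.card (Letter r) := by exact_mod_cast Fintype.card_pos
  refine ⟨1 - 1 / (Fintype.card (Letter r) : ℝ), by
    have : 0 < 1 / (Fintype.card (Letter r) : ℝ) := by positivity
    linarith, fun n hn => ?_⟩
  rw [return_eq r hr, show 2 * n = (2 * n - 1) + 1 by omega, Function.iterate_succ_apply]
  refine iter_le_const _ (fun x => ?_) _ _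
  have hgen : (QuotientGroup.mk (FreeGroup.of (⟨0, hr⟩ : Fin r)) : FreeGroup (Fin r) ⧸ M) ≠ 1 := by
    rw [Ne, QuotientGroup.eq_one_iff]
    intro h
    have := flowD_commutator a _ h (1, ⟨0, hr⟩)
    rw [flowD_of] at this
    simp at this
  have hex : ∃ l : Letter r, x * qstep M l ≠ 1 := by
    by_contra! hcon
    have h1 := hcon (⟨0, hr⟩, true, true)
    have h2 := hcon (⟨0, hr⟩, true, false)
    simp [qstep, stepOf] at h1 h2
    rw [h1, one_mul] at h2
    exact hgen h2
  obtain ⟨l, hl⟩ := hex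
  unfold avgOp
  rw [← Finset.add_sum_erase _ _ (Finset.mem_univ l)]
  rw [div_le_iff₀ hcard]
  have h1 : (fun q => ind (q = 1)) (ract (qstep M) l x) = 0 := ind_false hl
  rw [h1, zero_add]
  refine (Finset.sum_le_card_nsmul _ _ 1 fun i _ => ind_le_one _).trans ?_
  rw [Finset.card_erase_of_mem (Finset.mem_univ _), Finset.card_univ, nsmul_eq_mul,
    Nat.cast_sub Fintype.card_pos]
  push_cast
  rw [sub_mul (1:ℝ), one_div, inv_mul_cancel₀ hcard.ne', mul_one, one_mul]

theorem upper_bound {G : Type*} [Group G] {r : ℕ} (a : Fin r → G) (hr : 0 < r)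
    (hsurj : Function.Surjective (FreeGroup.lift a))
    (hexp : HasExpGrowth G) (ρ : FreeGroup (Fin r)) (hρ : FreeGroup.lift a ρ = 1)
    (e0 : G × Fin r) (he0 : flowD a ρ e0 ≠ 0) :
    ∃ C0 : ℝ, 1 ≤ C0 ∧ ∀ C, C0 ≤ C → ∀ n : ℕ, 2 ≤ n →
      convPow (lazySRWQuot r ⁅(FreeGroup.lift a).ker, (FreeGroup.lift a).ker⁆) (2 * n) 1
        ≤ Real.exp (-(1 / C) * (n : ℝ) / (Real.log n) ^ 2) := by
  obtain ⟨L, S, A, θ, c0, h1, h2, h3, h4, h5, h6, h7, h8⟩ := upper_all a hr hsurj hexp ρ hρ e0 he0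
  obtain ⟨η, n0, hη, hl⟩ := upper_numeric
    (fun n => convPow (lazySRWQuot r ⁅(FreeGroup.lift a).ker, (FreeGroup.lift a).ker⁆) n 1)
    L S A θ c0 h1 h2 h3 h4 h5 h6 h7 h8
  obtain ⟨κ, hκ, hsm⟩ := small_bound hr a
  exact small_n_upper
    (fun n => convPow (lazySRWQuot r ⁅(FreeGroup.lift a).ker, (FreeGroup.lift a).ker⁆) (2 * n) 1)
    η hη n0 κ hκ hsm hl

end uppernum

section poly
universe u

/-- Polycyclic of length at most `n`. -/
def PolyCyc : ℕ → ∀ (G : Type u) [Group G], Prop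
  | 0, G, _ => Subsingleton G
  | n + 1, G, _ => ∃ K : Subgroup G, K.Normal ∧ PolyCyc n K ∧ ∃ b : G, ∀ g : G, ∃ k : ℤ, (b ^ k)⁻¹ * g ∈ K

lemma cyc_iff {G : Type*} [Group G] (K : Subgroup G) [K.Normal] :
    (∃ b : G, ∀ g : G, ∃ k : ℤ, (b ^ k)⁻¹ * g ∈ K) ↔ IsCyclic (G ⧸ K) := by
  constructor
  · rintro ⟨b, hb⟩
    refine ⟨⟨(b : G ⧸ K), fun x => ?_⟩⟩
    induction x using QuotientGroup.induction_on with
    | H g =>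
      obtain ⟨k, hk⟩ := hb g
      refine ⟨k, ?_⟩
      rw [← QuotientGroup.eq] at hk
      simpa using hk
  · rintro ⟨⟨x, hx⟩⟩
    induction x using QuotientGroup.induction_on with
    | H b =>
      refine ⟨b, fun g => ?_⟩
      obtain ⟨k, hk⟩ := hx (g : G ⧸ K)
      refine ⟨k, ?_⟩
      rw [← QuotientGroup.eq]
      simpa using hk

lemma PolyCyc.of_injective : ∀ (n : ℕ) {G L : Type u} [Group G] [Group L] (φ : L →* G)
    (hφ : Function.Injective φ) (h : PolyCyc n G), PolyCyc n L
  | 0, G, L, _, _, φ, hφ, h => by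
    haveI : Subsingleton G := h
    exact hφ.subsingleton
  | n + 1, G, L, _, _, φ, hφ, h => by
    obtain ⟨K, hK, hP, hb⟩ := h
    haveI := hK
    rw [cyc_iff] at hb
    haveI := hb
    haveI : (K.comap φ).Normal := inferInstance
    refine ⟨K.comap φ, this, PolyCyc.of_injective n (φ.subgroupComap K) ?_ hP, ?_⟩
    · intro x y h
      apply Subtype.ext
      apply hφ
      exact congrArg Subtype.val h
    · rw [cyc_iff]
      refine isCyclic_of_injective (QuotientGroup.map (K.comap φ) K φ le_rfl) ?_
      rw [injective_iff_map_eq_one]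
      intro x
      induction x using QuotientGroup.induction_on with
      | H g =>
        intro h
        rw [QuotientGroup.map_mk, QuotientGroup.eq_one_iff] at h
        rw [QuotientGroup.eq_one_iff]
        exact h

lemma PolyCyc.subgroup {n : ℕ} {G : Type u} [Group G] (h : PolyCyc n G) (K : Subgroup G) : PolyCyc n K :=
  PolyCyc.of_injective n K.subtype K.subtype_injective h

lemma PolyCyc.fg : ∀ (n : ℕ) {G : Type u} [Group G] (h : PolyCyc n G), Group.FG G
  | 0, G, _, h => by
    haveI : Subsingleton G := h
    infer_instance
  | n + 1, G, _, h => by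
    obtain ⟨K, hK, hP, b, hb⟩ := h
    have hfg := PolyCyc.fg n hP
    rw [Group.fg_iff_subgroup_fg] at hfg
    rw [Group.fg_def]
    have h2 : K ⊔ Subgroup.zpowers b = ⊤ := by
      rw [eq_top_iff]
      intro g _
      obtain ⟨k, hk⟩ := hb g
      have : g = b ^ k * ((b ^ k)⁻¹ * g) := by group
      rw [this]
      exact mul_mem (Subgroup.mem_sup_right (Subgroup.zpow_mem_zpowers b k)) (Subgroup.mem_sup_left hk)
    rw [← h2]
    exact hfg.sup ((Subgroup.fg_iff _).2 ⟨{b}, (Subgroup.zpowers_eq_closure b).symm, Set.finite_singleton b⟩)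

lemma PolyCyc.solvable : ∀ (n : ℕ) {G : Type u} [Group G] (h : PolyCyc n G), Group.IsSolvable G
  | 0, G, _, h => by
    haveI : Subsingleton G := h
    infer_instance
  | n + 1, G, _, h => by
    obtain ⟨K, hK, hP, hb⟩ := h
    haveI := hK
    rw [cyc_iff] at hb
    haveI := hb
    haveI := PolyCyc.solvable n hP
    letI : CommGroup (G ⧸ K) := IsCyclic.commGroup
    haveI : Group.IsSolvable (G ⧸ K) := inferInstance
    refine solvable_of_ker_le_range K.subtype (QuotientGroup.mk' K) ?_
    rw [QuotientGroup.ker_mk', Subgroup.range_subtype]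

lemma isPoly_of_series {G : Type u} [Group G] (r : ℕ)
    (H : Fin (r + 1) → Subgroup G)
    (htop : H 0 = ⊤) (hbot : H (Fin.last r) = ⊥)
    (a : Fin r → G) (ha : ∀ i : Fin r, a i ∈ H i.castSucc)
    (hnormal : ∀ i : Fin r, ∀ g ∈ H i.castSucc, ∀ x ∈ H i.succ, g * x * g⁻¹ ∈ H i.succ)
    (hcyclic : ∀ i : Fin r, ∀ g ∈ H i.castSucc, ∃ n : ℤ, ((a i) ^ n)⁻¹ * g ∈ H i.succ) :
    PolyCyc r G := by
  have key : ∀ i : Fin (r + 1), PolyCyc (r - i) (H i) := by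
    intro i
    induction i using Fin.reverseInduction with
    | last =>
      have h : r - (Fin.last r : ℕ) = 0 := by simp
      rw [h]
      change Subsingleton (H (Fin.last r))
      rw [hbot]; infer_instance
    | cast i ih =>
      have h : r - (i.castSucc : ℕ) = (r - (i.succ : ℕ)) + 1 := by
        simp; omega
      rw [h]
      refine ⟨(H i.succ).subgroupOf (H i.castSucc), ?_, ?_, ⟨⟨a i, ha i⟩, ?_⟩⟩
      · constructor
        rintro ⟨x, hx⟩ hxK ⟨g, hg⟩
        rw [Subgroup.mem_subgroupOf] at hxK ⊢
        exact hnormal i g hg x hxK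
      · refine PolyCyc.of_injective _ (((H i.castSucc).subtype).subgroupComap (H i.succ)) ?_ ih
        intro x y hxy
        apply Subtype.ext
        apply Subtype.ext
        exact congrArg (fun z : H i.succ => (z : G)) hxy
      · rintro ⟨g, hg⟩
        obtain ⟨k, hk⟩ := hcyclic i g hg
        refine ⟨k, ?_⟩
        rw [Subgroup.mem_subgroupOf]
        simpa using hk
  have h0 := key 0
  rw [htop] at h0
  exact PolyCyc.of_injective _ (Subgroup.topEquiv (G := G)).symm.toMonoidHom
    (Subgroup.topEquiv (G := G)).symm.injective h0

lemma surj_of_series {G : Type u} [Group G] (r : ℕ)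
    (H : Fin (r + 1) → Subgroup G)
    (htop : H 0 = ⊤) (hbot : H (Fin.last r) = ⊥)
    (a : Fin r → G)
    (hcyclic : ∀ i : Fin r, ∀ g ∈ H i.castSucc, ∃ n : ℤ, ((a i) ^ n)⁻¹ * g ∈ H i.succ) :
    Function.Surjective (FreeGroup.lift a) := by
  have key : ∀ i : Fin (r + 1), H i ≤ (FreeGroup.lift a).range := by
    intro i
    induction i using Fin.reverseInduction with
    | last => rw [hbot]; exact bot_le
    | cast i ih =>
      intro g hg
      obtain ⟨k, hk⟩ := hcyclic i g hg
      have : g = a i ^ k * ((a i ^ k)⁻¹ * g) := by group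
      rw [this]
      exact mul_mem ⟨FreeGroup.of i ^ k, by simp⟩ (ih hk)
  have := key 0
  rw [htop, top_le_iff] at this
  exact MonoidHom.range_eq_top.1 this

end poly

section eig
universe u v

lemma finite_hom_of_fg {K P : Type*} [Group K] [Group P] [Finite P] (h : Group.FG K) :
    Finite (K →* P) := by
  obtain ⟨S, hS, hSf⟩ := Group.fg_iff.1 h
  haveI := hSf.to_subtype
  refine Finite.of_injective (fun (f : K →* P) (x : S) => f x) ?_
  intro f g hfg
  apply MonoidHom.eq_of_eqOn_dense hS
  intro x hx
  exact congrFun hfg ⟨x, hx⟩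

lemma exists_char_fi {K : Type*} [Group K] (h : Group.FG K) (K' : Subgroup K) (hK' : K'.FiniteIndex) :
    ∃ L : Subgroup K, L ≤ K' ∧ L.FiniteIndex ∧ ∀ (φ : K ≃* K), ∀ x ∈ L, φ x ∈ L := by
  haveI : Finite (K ⧸ K') := Subgroup.finite_quotient_of_finiteIndex
  haveI : Finite (K →* Equiv.Perm (K ⧸ K')) := finite_hom_of_fg h
  refine ⟨⨅ f : K →* Equiv.Perm (K ⧸ K'), f.ker, ?_, ?_, ?_⟩
  · refine (iInf_le _ (MulAction.toPermHom K (K ⧸ K'))).trans ?_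
    rw [← Subgroup.normalCore_eq_ker]
    exact Subgroup.normalCore_le K'
  · exact Subgroup.finiteIndex_iInf fun f => inferInstance
  · intro φ x hx
    rw [Subgroup.mem_iInf] at hx ⊢
    intro f
    exact hx (f.comp φ.toMonoidHom)

lemma indep_of_char {ι Λ V : Type*} [AddCommGroup V] [Module ℂ V] (T : Λ → Module.End ℂ V)
    (v : ι → V) (hv : ∀ i, v i ≠ 0) (c : ι → Λ → ℂ) (hc : Function.Injective c)
    (hT : ∀ i x, T x (v i) = c i x • v i) : LinearIndependent ℂ v := by
  classical
  rw [linearIndependent_iff']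
  intro s
  induction s using Finset.induction_on with
  | empty => simp
  | insert a s ha ih =>
    intro g hg
    have h1 : ∀ i ∈ s, g i = 0 := by
      intro i hi
      have hne : c i ≠ c a := fun h => ha (hc h ▸ hi)
      obtain ⟨x, hx⟩ := Function.ne_iff.1 hne
      have h2 : ∑ j ∈ s, (g j * (c j x - c a x)) • v j = 0 := by
        have h3 : T x (∑ i ∈ insert a s, g i • v i) - c a x • (∑ i ∈ insert a s, g i • v i) = 0 := by
          rw [hg]; simp
        rw [map_sum, Finset.smul_sum, ← Finset.sum_sub_distrib, Finset.sum_insert ha] at h3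
        simp only [map_smul, hT, smul_smul] at h3
        rw [mul_comm (g a), sub_self, zero_add] at h3
        rw [← h3]
        refine Finset.sum_congr rfl fun j _ => ?_
        rw [← sub_smul]; congr 1; ring
      have := ih _ h2 i hi
      rcases mul_eq_zero.1 this with h | h
      · exact h
      · exact absurd (sub_eq_zero.1 h) hx
    rw [Finset.sum_insert ha, Finset.sum_eq_zero (fun i hi => by rw [h1 i hi, zero_smul]), add_zero] at hg
    intro i hi
    rcases Finset.mem_insert.1 hi with rfl | hi
    · exact (smul_eq_zero.1 hg).resolve_right (hv _)
    · exact h1 i hi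

/-- Stabilizer of a line. -/
def lineStab {G V : Type*} [Group G] [AddCommGroup V] [Module ℂ V] (ρ : G →* Module.End ℂ V)
    (w : V) (hw : w ≠ 0) : Subgroup G where
  carrier := {g | ∃ c : ℂ, ρ g w = c • w}
  one_mem' := ⟨1, by simp⟩
  mul_mem' := by
    rintro g h ⟨c, hc⟩ ⟨d, hd⟩
    exact ⟨d * c, by rw [map_mul, Module.End.mul_apply, hd, map_smul, hc, smul_smul]⟩
  inv_mem' := by
    rintro g ⟨c, hc⟩
    have h1 : ρ g⁻¹ (ρ g w) = w := by rw [← Module.End.mul_apply, ← map_mul]; simp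
    have hc0 : c ≠ 0 := by
      rintro rfl
      rw [hc] at h1; simp at h1; exact hw h1.symm
    refine ⟨c⁻¹, ?_⟩
    rw [hc, map_smul] at h1
    rw [eq_inv_smul_iff₀ hc0]; exact h1

lemma finiteIndex_of_cyc {G : Type*} [Group G] (K : Subgroup G) [K.Normal] (b : G)
    (hb : ∀ g : G, ∃ k : ℤ, (b ^ k)⁻¹ * g ∈ K) (L : Subgroup K) [hL : L.FiniteIndex]
    (hLc : ∀ (φ : K ≃* K), ∀ x ∈ L, φ x ∈ L) (G' : Subgroup G) (h1 : ∀ x ∈ L, (x : G) ∈ G')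
    (m : ℕ) (hm : 0 < m) (h2 : b ^ m ∈ G') : G'.FiniteIndex := by
  haveI : Finite (K ⧸ L) := Subgroup.finite_quotient_of_finiteIndex
  suffices Finite (G ⧸ G') from Subgroup.finiteIndex_of_finite_quotient
  refine Finite.of_surjective (fun p : (K ⧸ L) × Fin m =>
    (QuotientGroup.mk ((Quotient.out p.1 : K) * b ^ (p.2 : ℕ)) : G ⧸ G')) ?_
  intro q
  induction q using QuotientGroup.induction_on with
  | H g =>
    obtain ⟨k, hk⟩ := hb g
    have hy : g * (b ^ k)⁻¹ ∈ K := by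
      have := ‹K.Normal›.conj_mem _ hk (b ^ k)
      simpa [mul_assoc] using this
    set y : K := ⟨g * (b ^ k)⁻¹, hy⟩ with hyd
    set t : K := Quotient.out (QuotientGroup.mk y : K ⧸ L) with ht
    have hz : t⁻¹ * y ∈ L := by
      rw [← QuotientGroup.eq, ht]
      exact Quotient.out_eq' _
    have hm' : (0:ℤ) < m := by exact_mod_cast hm
    have hj := Int.emod_nonneg k hm'.ne'
    have hj2 := Int.emod_lt_of_pos k hm'
    refine ⟨(QuotientGroup.mk y, ⟨(k % m).toNat, by omega⟩), ?_⟩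
    change (QuotientGroup.mk ((t : G) * b ^ ((k % m).toNat)) : G ⧸ G') = _
    rw [QuotientGroup.eq]
    have hbj : b ^ ((k % m).toNat) = b ^ (k % m) := by
      rw [← zpow_natCast, Int.toNat_of_nonneg hj]
    have hk2 : b ^ k = b ^ (k % m) * (b ^ m) ^ (k / m) := by
      rw [← zpow_natCast, ← zpow_mul, ← zpow_add, Int.emod_add_mul_ediv]
    have hg : ((t : G) * b ^ ((k % m).toNat))⁻¹ * g =
        ((MulAut.conjNormal ((b ^ (k % m))⁻¹) (t⁻¹ * y) : K) : G) * (b ^ m) ^ (k / m) := by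
      have hgy : g = (y : G) * b ^ k := by simp [hyd]
      rw [hgy, MulAut.conjNormal_apply, hbj, hk2]
      push_cast
      group
    rw [hg]
    exact mul_mem (h1 _ (hLc _ _ hz)) (zpow_mem h2 _)

lemma exists_eig : ∀ (n : ℕ) {G : Type u} [Group G] (h : PolyCyc n G) {V : Type v} [AddCommGroup V]
    [Module ℂ V] [FiniteDimensional ℂ V] [Nontrivial V] (ρ : G →* Module.End ℂ V),
    ∃ G' : Subgroup G, G'.FiniteIndex ∧ ∃ v : V, v ≠ 0 ∧ ∀ g ∈ G', ∃ c : ℂ, ρ g v = c • v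
  | 0, G, _, h, V, _, _, _, _, ρ => by
    haveI : Subsingleton G := h
    obtain ⟨v, hv⟩ := exists_ne (0 : V)
    refine ⟨⊤, inferInstance, v, hv, fun g _ => ⟨1, ?_⟩⟩
    rw [Subsingleton.elim g 1]; simp
  | n + 1, G, _, h, V, _, _, _, _, ρ => by
    obtain ⟨K, hK, hP, b, hb⟩ := h
    obtain ⟨K', hK', v, hv, hev⟩ := exists_eig n hP (ρ.comp K.subtype)
    obtain ⟨L, hLK, hLf, hLc⟩ := exists_char_fi (PolyCyc.fg n hP) K' hK'
    have hinj : ∀ g : G, ∀ w : V, ρ g⁻¹ (ρ g w) = w := by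
      intro g w; rw [← Module.End.mul_apply, ← map_mul]; simp
    -- conjugation
    have hcomm : ∀ (g : G) (x : K) (w : V), ρ x (ρ g w) = ρ g (ρ (MulAut.conjNormal g⁻¹ x : K) w) := by
      intro g x w
      rw [← Module.End.mul_apply, ← Module.End.mul_apply, ← map_mul, ← map_mul]
      congr 2
      rw [MulAut.conjNormal_apply]; group
    set vk : ℕ → V := fun k => ρ (b ^ k) v with hvk
    have hvk0 : ∀ k, vk k ≠ 0 := by
      intro k h0
      apply hv
      rw [← hinj (b ^ k) v]
      change ρ _ (vk k) = 0
      rw [h0, map_zero]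
    have hex : ∀ (k : ℕ) (x : L), ∃ c : ℂ, ρ (x : K) (vk k) = c • vk k := by
      intro k x
      obtain ⟨c, hc⟩ := hev (MulAut.conjNormal (b ^ k)⁻¹ (x : K)) (hLK (hLc _ _ x.2))
      refine ⟨c, ?_⟩
      rw [hvk]
      dsimp only
      rw [hcomm]
      change ρ _ (ρ _ v) = _
      have hc' : ρ ((MulAut.conjNormal (b ^ k)⁻¹ (x : K) : K) : G) v = c • v := hc
      rw [hc', map_smul]
    choose c hc using hex
    have hnc : ¬ Function.Injective c := by
      intro hi
      have := indep_of_char (fun x : L => ρ ((x : K) : G)) vk hvk0 c hi (fun i x => hc i x)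
      exact Set.infinite_univ (α := ℕ) (Set.finite_univ_iff.2 this.finite)
    simp only [Function.Injective, not_forall] at hnc
    obtain ⟨k0, l0, hkl0, hne0⟩ := hnc
    obtain ⟨k, l, hlt, hkl⟩ : ∃ k l, k < l ∧ c k = c l := by
      rcases lt_or_gt_of_ne hne0 with h | h
      · exact ⟨_, _, h, hkl0⟩
      · exact ⟨_, _, h, hkl0.symm⟩
    obtain ⟨m, hm, rfl⟩ : ∃ m, 0 < m ∧ l = m + k := ⟨l - k, by omega, by omega⟩
    set U : Submodule ℂ V :=
      { carrier := {w | ∀ x : L, ρ (x : K) w = c k x • w}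
        add_mem' := by
          intro p q hp hq x
          rw [map_add, hp x, hq x, smul_add]
        zero_mem' := by intro x; simp
        smul_mem' := by
          intro z p hp x
          rw [map_smul, hp x, smul_comm] } with hU
    have hinvc : ∀ x : L, c k ⟨MulAut.conjNormal (b ^ m)⁻¹ (x : K), hLc _ _ x.2⟩ = c k x := by
      intro x
      have h1 := hc (m + k) x
      have h2 : vk (m + k) = ρ (b ^ m) (vk k) := by
        simp only [hvk]
        rw [← Module.End.mul_apply, ← map_mul, pow_add]
      have h3 := hc k ⟨MulAut.conjNormal (b ^ m)⁻¹ (x : K), hLc _ _ x.2⟩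
      rw [← hkl, h2, hcomm] at h1
      dsimp only at h3
      rw [h3, map_smul, ← h2] at h1
      exact smul_left_injective ℂ (hvk0 _) h1
    have hUs : ∀ w ∈ U, ρ (b ^ m) w ∈ U := by
      intro w hw x
      rw [hcomm]
      have := hw ⟨MulAut.conjNormal (b ^ m)⁻¹ (x : K), hLc _ _ x.2⟩
      dsimp only at this
      rw [this, map_smul, hinvc]
    haveI : Nontrivial U := ⟨⟨⟨vk k, fun x => hc k x⟩, 0, fun h => hvk0 k (congrArg Subtype.val h)⟩⟩
    obtain ⟨μ, hμ⟩ := Module.End.exists_eigenvalue ((ρ (b ^ m)).restrict hUs)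
    obtain ⟨w, hw⟩ := hμ.exists_hasEigenvector
    have hw0 : (w : V) ≠ 0 := fun h => hw.2 (Subtype.ext h)
    have hwe : ρ (b ^ m) w = μ • (w : V) := congrArg Subtype.val hw.apply_eq_smul
    refine ⟨lineStab ρ w hw0, ?_, w, hw0, fun g hg => hg⟩
    refine finiteIndex_of_cyc K b hb L hLc _ (fun x hx => ?_) m hm ⟨μ, hwe⟩
    exact ⟨_, w.2 ⟨x, hx⟩⟩

end eig

section unip
universe u v

/-- Iterated unipotent action. -/
def NilpAct {G V : Type*} [Group G] [AddCommGroup V] [Module ℂ V] (ρ : G →* Module.End ℂ V)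
    (M : Subgroup G) : ℕ → V → Prop
  | 0, f => f = 0
  | e + 1, f => ∀ m ∈ M, NilpAct ρ M e (ρ m f - f)

lemma exists_unip : ∀ (d n : ℕ) {G : Type u} [Group G] (h : PolyCyc n G) {V : Type v} [AddCommGroup V]
    [Module ℂ V] [FiniteDimensional ℂ V] (hd : Module.finrank ℂ V ≤ d) (ρ : G →* Module.End ℂ V),
    ∃ G' : Subgroup G, G'.FiniteIndex ∧ ∃ e : ℕ, ∀ f, NilpAct ρ ⁅G', G'⁆ e f
  | 0, n, G, _, h, V, _, _, _, hd, ρ => by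
    refine ⟨⊤, inferInstance, 0, fun f => ?_⟩
    have : Module.finrank ℂ V = 0 := by omega
    haveI := Module.finrank_zero_iff.1 this
    exact Subsingleton.elim _ _
  | d + 1, n, G, _, h, V, _, _, _, hd, ρ => by
    rcases subsingleton_or_nontrivial V with hV | hV
    · exact ⟨⊤, inferInstance, 0, fun f => Subsingleton.elim _ _⟩
    obtain ⟨G1, hG1, v, hv, hev⟩ := exists_eig n h ρ
    set p : Submodule ℂ V := Submodule.span ℂ {v} with hp
    have hle : ∀ g : G1, p ≤ p.comap ((ρ.comp G1.subtype) g) := by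
      intro g
      rw [hp, Submodule.span_le]
      rintro x hx
      rw [Set.mem_singleton_iff] at hx
      subst hx
      obtain ⟨c, hc⟩ := hev g g.2
      change ρ g x ∈ Submodule.span ℂ {x}
      rw [hc]
      exact Submodule.smul_mem _ _ (Submodule.mem_span_singleton_self x)
    set ρq : G1 →* Module.End ℂ (V ⧸ p) := Representation.quotient (ρ.comp G1.subtype) p hle with hρq
    have hfr : Module.finrank ℂ (V ⧸ p) ≤ d := by
      have h1 := Submodule.finrank_quotient_add_finrank p
      have h2 : Module.finrank ℂ p = 1 := finrank_span_singleton hv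
      omega
    obtain ⟨G2, hG2, e, he⟩ := exists_unip d n (h.subgroup G1) hfr ρq
    have hmap : ⁅G2.map G1.subtype, G2.map G1.subtype⁆ = (⁅G2, G2⁆).map G1.subtype :=
      (Subgroup.map_commutator G2 G2 G1.subtype).symm
    refine ⟨G2.map G1.subtype, ⟨?_⟩, e + 1, ?_⟩
    · rw [Subgroup.index_map_subtype]
      exact Nat.mul_ne_zero hG2.1 hG1.1
    -- the commutator acts trivially on the line
    have htriv : ∀ m ∈ ⁅G1, G1⁆, ρ m v = v := by
      have : ⁅G1, G1⁆ ≤ (MulAction.stabilizer (Module.End ℂ V)ˣ v).comap ρ.toHomUnits := by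
        rw [Subgroup.commutator_le]
        intro g hg h hh
        rw [Subgroup.mem_comap, MulAction.mem_stabilizer_iff]
        change ρ (g * h * g⁻¹ * h⁻¹) v = v
        obtain ⟨c1, hc1⟩ := hev g hg
        obtain ⟨c2, hc2⟩ := hev h hh
        have e1 : ρ (g * h) v = ρ (h * g) v := by
          rw [map_mul, map_mul, Module.End.mul_apply, Module.End.mul_apply, hc1, hc2, map_smul,
            map_smul, hc1, hc2, smul_comm]
        have e2 : g * h * g⁻¹ * h⁻¹ = g * h * (h * g)⁻¹ := by group
        obtain ⟨c3, hc3⟩ := hev _ (G1.inv_mem hg)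
        obtain ⟨c4, hc4⟩ := hev _ (G1.inv_mem hh)
        have e4 : ρ ((h * g)⁻¹) v = (c3 * c4) • v := by
          rw [mul_inv_rev, map_mul, Module.End.mul_apply, hc4, map_smul, hc3, smul_smul, mul_comm]
        rw [e2, map_mul, Module.End.mul_apply, e4, map_smul, e1, ← map_smul, ← e4,
          ← Module.End.mul_apply, ← map_mul]
        simp
      intro m hm
      exact this hm
    have key : ∀ (e : ℕ) (f : V), NilpAct ρq ⁅G2, G2⁆ e (p.mkQ f) →
        NilpAct ρ ⁅G2.map G1.subtype, G2.map G1.subtype⁆ (e + 1) f := by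
      intro e
      induction e with
      | zero =>
        intro f hf m hm
        change p.mkQ f = 0 at hf
        rw [Submodule.mkQ_apply, Submodule.Quotient.mk_eq_zero, hp, Submodule.mem_span_singleton] at hf
        obtain ⟨z, rfl⟩ := hf
        change ρ m (z • v) - z • v = 0
        rw [map_smul, htriv m, sub_self]
        exact Subgroup.commutator_mono (Subgroup.map_subtype_le _) (Subgroup.map_subtype_le _) hm
      | succ e ih =>
        intro f hf m hm
        apply ih
        rw [hmap] at hm
        obtain ⟨m', hm', rfl⟩ := hm
        have := hf m' hm'
        rw [map_sub]
        exact this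
    intro f
    exact key e f (he _)

lemma tors_fin (A : Type u) [AddCommGroup A] [AddGroup.FG A] :
    {x : A | ∀ f : A →+ ℂ, f x = 0}.Finite := by
  obtain ⟨n, ι, hι, p, hp, e, ⟨φ⟩⟩ := AddCommGroup.equiv_free_prod_directSum_zmod A
  haveI : Finite (DirectSum ι fun i => ZMod (p i ^ e i)) := by
    haveI : ∀ i, NeZero (p i ^ e i) := fun i => ⟨pow_ne_zero _ (hp i).ne_zero⟩
    exact Finite.of_injective (fun x : DirectSum ι fun i => ZMod (p i ^ e i) => (fun i => x i)) DFunLike.coe_injective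
  refine (Set.finite_range fun y : DirectSum ι fun i => ZMod (p i ^ e i) => φ.symm (0, y)).subset ?_
  intro x hx
  refine ⟨(φ x).2, ?_⟩
  rw [AddEquiv.symm_apply_eq]
  ext1
  · symm
    ext i
    have := hx ((Int.castAddHom ℂ).comp ((Finsupp.applyAddHom i).comp ((AddMonoidHom.fst _ _).comp φ.toAddMonoidHom)))
    simpa using this
  · rfl

/-- conjugation representation on additive characters -/
def conjRep {G : Type u} [Group G] (K : Subgroup G) [K.Normal] :
    G →* Module.End ℂ (Additive K →+ ℂ) where
  toFun g :=
    { toFun := fun f => f.comp (MonoidHom.toAdditive (MulAut.conjNormal g⁻¹ : K ≃* K).toMonoidHom)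
      map_add' := by intro f f'; rfl
      map_smul' := by intro c f; rfl }
  map_one' := by
    ext f x; simp
  map_mul' g h := by
    ext f x
    simp

lemma conjRep_apply {G : Type u} [Group G] (K : Subgroup G) [K.Normal] (g : G) (f : Additive K →+ ℂ)
    (x : K) : conjRep K g f (Additive.ofMul x) = f (Additive.ofMul (MulAut.conjNormal g⁻¹ x)) := rfl

lemma finDim_char {K : Type u} [Group K] (h : Group.FG K) : FiniteDimensional ℂ (Additive K →+ ℂ) := by
  obtain ⟨S, hS, hSf⟩ := Group.fg_iff.1 h
  haveI := hSf.to_subtype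
  let T : (Additive K →+ ℂ) →ₗ[ℂ] (S → ℂ) :=
    { toFun := fun f x => f (Additive.ofMul (x : K))
      map_add' := by intro f g; rfl
      map_smul' := by intro c f; rfl }
  refine FiniteDimensional.of_injective T ?_
  intro f g hfg
  have : AddMonoidHom.toMultiplicativeRight f = AddMonoidHom.toMultiplicativeRight g := by
    apply MonoidHom.eq_of_eqOn_dense hS
    intro x hx
    exact congrFun hfg ⟨x, hx⟩
  exact AddMonoidHom.toMultiplicativeRight.injective this

/-- action on the abelianization -/
def abAct {G : Type u} [Group G] (K : Subgroup G) [K.Normal] : G →* MulAut (Abelianization K) where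
  toFun g := MulEquiv.abelianizationCongr (MulAut.conjNormal g : K ≃* K)
  map_one' := by
    ext x
    induction x using QuotientGroup.induction_on with
    | H x => change Abelianization.of _ = Abelianization.of _; simp
  map_mul' g h := by
    ext x
    induction x using QuotientGroup.induction_on with
    | H x => change Abelianization.of _ = Abelianization.of _; simp

lemma abAct_of {G : Type u} [Group G] (K : Subgroup G) [K.Normal] (g : G) (x : K) :
    abAct K g (Abelianization.of x) = Abelianization.of (MulAut.conjNormal g x) := rfl

lemma exists_kill {G : Type u} [Group G] (n : ℕ) (h : PolyCyc n G) (K : Subgroup G) [hKn : K.Normal] :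
    ∃ G' : Subgroup G, G'.FiniteIndex ∧ ∃ e : ℕ, ∀ M : Subgroup G, M ≤ ⁅G', G'⁆ →
      (fun X : Subgroup G => ⁅X, M⁆)^[e] K ≤ ⁅K, K⁆ := by
  have hKfg : Group.FG K := PolyCyc.fg n (h.subgroup K)
  haveI := finDim_char hKfg
  obtain ⟨G1, hG1, e, he⟩ := exists_unip _ n h le_rfl (conjRep K)
  haveI : Group.FG (Abelianization K) :=
    Group.fg_of_surjective (f := Abelianization.of) (QuotientGroup.mk_surjective)
  have hTf := tors_fin (Additive (Abelianization K))
  set T : Set (Abelianization K) := {x | ∀ f : Additive (Abelianization K) →+ ℂ, f (Additive.ofMul x) = 0} with hT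
  have hTfin : T.Finite := hTf
  letI : MulAction G (Abelianization K) := MulAction.compHom _ (abAct K)
  have hsm : ∀ (g : G) (x : Abelianization K), g • x = abAct K g x := fun g x => rfl
  have hTst : ∀ g : G, ∀ x ∈ T, g • x ∈ T := by
    intro g x hx f
    exact hx (f.comp (MonoidHom.toAdditive (abAct K g).toMonoidHom))
  haveI := hTfin.to_subtype
  set C : Subgroup G := ⨅ x : T, MulAction.stabilizer G (x : Abelianization K) with hC
  have hCf : C.FiniteIndex := by
    refine Subgroup.finiteIndex_iInf fun x => ⟨?_⟩
    rw [MulAction.index_stabilizer]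
    have hfin : (MulAction.orbit G (x : Abelianization K)).Finite := by
      refine hTfin.subset ?_
      rintro _ ⟨g, rfl⟩
      exact hTst g _ x.2
    have hpos := (Set.ncard_pos hfin).2 (MulAction.nonempty_orbit _)
    omega
  refine ⟨G1 ⊓ C, inferInstance, e + 1, fun M hM => ?_⟩
  have hM1 : M ≤ ⁅G1, G1⁆ := hM.trans (Subgroup.commutator_mono inf_le_left inf_le_left)
  have hM2 : M ≤ C := hM.trans ((Subgroup.commutator_le_self _).trans inf_le_right)
  have hle : ∀ e, (fun X : Subgroup G => ⁅X, M⁆)^[e] K ≤ K := by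
    intro e
    induction e with
    | zero => exact le_rfl
    | succ e ih =>
      rw [Function.iterate_succ_apply']
      exact (Subgroup.commutator_mono ih le_rfl).trans (Subgroup.commutator_le_left K M)
  have key : ∀ (e : ℕ) (f : Additive K →+ ℂ), NilpAct (conjRep K) ⁅G1, G1⁆ e f →
      ∀ x : K, (x : G) ∈ (fun X : Subgroup G => ⁅X, M⁆)^[e] K → f (Additive.ofMul x) = 0 := by
    intro e
    induction e with
    | zero =>
      intro f hf x _
      change f = 0 at hf
      rw [hf]; rfl
    | succ e ih =>
      intro f hf x hx
      have hsub : (fun X : Subgroup G => ⁅X, M⁆)^[e + 1] K ≤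
          ((AddMonoidHom.toMultiplicativeRight f).ker).map K.subtype := by
        rw [Function.iterate_succ_apply', Subgroup.commutator_le]
        intro y hy m hm
        have hyK := hle e hy
        refine ⟨⟨y, hyK⟩ * (MulAut.conjNormal m ⟨y, hyK⟩)⁻¹, ?_, ?_⟩
        · have h1 := ih _ (hf m⁻¹ (hM1 (M.inv_mem hm))) ⟨y, hyK⟩ hy
          rw [AddMonoidHom.sub_apply, conjRep_apply, inv_inv] at h1
          change f (Additive.ofMul _) = 0
          rw [ofMul_mul, ofMul_inv, map_add, map_neg]
          linear_combination -h1
        · simp [commutatorElement_def]; group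
      obtain ⟨x', hx', hxx⟩ := hsub hx
      have : x' = x := Subtype.ext hxx
      subst this
      exact hx'
  rw [Function.iterate_succ_apply', Subgroup.commutator_le]
  intro y hy m hm
  have hyK := hle e hy
  have h1 : Abelianization.of (⟨y, hyK⟩ : K) ∈ T := by
    intro f
    exact key e (f.comp (MonoidHom.toAdditive Abelianization.of)) (he _) ⟨y, hyK⟩ hy
  have h2 := hM2 hm
  rw [hC, Subgroup.mem_iInf] at h2
  have h3 := h2 ⟨_, h1⟩
  rw [MulAction.mem_stabilizer_iff, hsm, abAct_of] at h3
  have h4 : (⟨y, hyK⟩ : K) * (MulAut.conjNormal m ⟨y, hyK⟩)⁻¹ ∈ commutator K := by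
    rw [← Abelianization.ker_of, MonoidHom.mem_ker, map_mul, map_inv, h3, mul_inv_cancel]
  rw [← Subgroup.map_subtype_commutator]
  refine ⟨_, h4, ?_⟩
  simp [commutatorElement_def]; group

lemma exists_nilp {G : Type u} [Group G] (n : ℕ) (h : PolyCyc n G) :
    ∃ G' : Subgroup G, G'.FiniteIndex ∧ G'.Normal ∧ Group.IsNilpotent (⁅G', G'⁆ : Subgroup G) := by
  have hs : Group.IsSolvable G := PolyCyc.solvable n h
  obtain ⟨l, hl⟩ := hs.solvable
  choose G1 hG1 e he using fun j => exists_kill n h (derivedSeries G j)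
  set G2 : Subgroup G := ⨅ j : Fin l, G1 j with hG2
  haveI : G2.FiniteIndex := Subgroup.finiteIndex_iInf fun j => hG1 j
  refine ⟨G2.normalCore, inferInstance, inferInstance, ?_⟩
  set M := ⁅G2.normalCore, G2.normalCore⁆ with hM
  have hMj : ∀ j < l, M ≤ ⁅G1 j, G1 j⁆ := by
    intro j hj
    have : G2.normalCore ≤ G1 j := (Subgroup.normalCore_le _).trans (iInf_le _ (⟨j, hj⟩ : Fin l))
    exact Subgroup.commutator_mono this this
  have hmono : ∀ e, Monotone ((fun X : Subgroup G => ⁅X, M⁆)^[e]) := by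
    intro e
    apply Monotone.iterate
    intro X Y hXY
    exact Subgroup.commutator_mono hXY le_rfl
  have hit : ∀ j ≤ l, ∃ E, (fun X : Subgroup G => ⁅X, M⁆)^[E] ⊤ ≤ derivedSeries G j := by
    intro j
    induction j with
    | zero => intro _; exact ⟨0, by simp⟩
    | succ j ih =>
      intro hj
      obtain ⟨E, hE⟩ := ih (by omega)
      refine ⟨e j + E, ?_⟩
      rw [Function.iterate_add_apply, derivedSeries_succ]
      exact (hmono _ hE).trans (he j M (hMj j (by omega)))
  obtain ⟨E, hE⟩ := hit l le_rfl
  rw [hl, le_bot_iff] at hE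
  apply Subgroup.isNilpotent_of_lowerCentralSeries_eq_bot (n := E)
  have hlc : ∀ k, Subgroup.lowerCentralSeries M k ≤ (fun X : Subgroup G => ⁅X, M⁆)^[k] ⊤ := by
    intro k
    induction k with
    | zero => exact le_top
    | succ k ih =>
      rw [Function.iterate_succ_apply', Subgroup.lowerCentralSeries_succ]
      exact Subgroup.commutator_mono ih le_rfl
  have := hlc E
  rwa [hE, le_bot_iff] at this

end unip

section polyg
universe u

lemma conj_pow_mem {M : Type u} [Group M] (K : Subgroup M) [K.Normal] (c : ℕ)
    (hc : (⊤ : Subgroup M).lowerCentralSeries c = ⊥) (b : M) :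
    ∀ j ≤ c, ∀ κ ∈ K, κ ∈ (⊤ : Subgroup M).lowerCentralSeries (c - j) →
      ∃ S : Set M, S.Finite ∧ 1 ∈ S ∧ S ⊆ K ∧
        ∀ f : ℕ, (b ^ f)⁻¹ * κ * b ^ f ∈ S ^ ((f + 1) ^ j) := by
  intro j
  induction j with
  | zero =>
    intro _ κ _ hκ
    rw [Nat.sub_zero, hc, Subgroup.mem_bot] at hκ
    subst hκ
    refine ⟨{1}, Set.finite_singleton _, rfl, by simpa using K.one_mem, fun f => by simp⟩
  | succ j ih =>
    intro hj κ hK hκ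
    have h1 : κ⁻¹ * b⁻¹ * κ * b ∈ K := by
      have := K.mul_mem (K.inv_mem hK) (Subgroup.Normal.conj_mem inferInstance κ hK b⁻¹)
      simpa [mul_assoc] using this
    have h2 : κ⁻¹ * b⁻¹ * κ * b ∈ (⊤ : Subgroup M).lowerCentralSeries (c - j) := by
      have e : c - j = (c - (j + 1)) + 1 := by omega
      rw [e, Subgroup.lowerCentralSeries_succ]
      have := Subgroup.commutator_mem_commutator (Subgroup.inv_mem _ hκ) (Subgroup.mem_top b⁻¹)
      simpa [commutatorElement_def] using this
    obtain ⟨S, hS, hS1, hSK, hS2⟩ := ih (by omega) _ h1 h2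
    refine ⟨insert κ S, hS.insert _, Or.inr hS1, ?_, ?_⟩
    · intro x hx
      rcases hx with rfl | hx
      · exact hK
      · exact hSK hx
    have key : ∀ N f : ℕ, f ≤ N →
        (b ^ f)⁻¹ * κ * b ^ f ∈ (insert κ S) ^ (1 + f * (N + 1) ^ j) := by
      intro N f
      induction f with
      | zero => intro _; simp
      | succ f ihf =>
        intro hf
        have e : (b ^ (f + 1))⁻¹ * κ * b ^ (f + 1) =
            ((b ^ f)⁻¹ * κ * b ^ f) * ((b ^ f)⁻¹ * (κ⁻¹ * b⁻¹ * κ * b) * b ^ f) := by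
          rw [pow_succ' b f]
          have : b * b ^ f = b ^ f * b := (pow_succ' b f).symm.trans (pow_succ b f)
          rw [this]
          group
        rw [e, show 1 + (f + 1) * (N + 1) ^ j = (1 + f * (N + 1) ^ j) + (N + 1) ^ j by ring, pow_add]
        refine Set.mul_mem_mul (ihf (by omega)) ?_
        have := hS2 f
        have h3 : S ^ ((f + 1) ^ j) ⊆ S ^ ((N + 1) ^ j) :=
          Set.pow_subset_pow_right hS1 (Nat.pow_le_pow_left (by omega) _)
        exact Set.pow_subset_pow_left (Set.subset_insert κ S) (h3 this)
    intro f
    have hm1 : (1 : M) ∈ insert κ S := Set.mem_insert_of_mem _ hS1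
    refine Set.pow_subset_pow_right hm1 ?_ (key f f le_rfl)
    have : 1 ≤ (f + 1) ^ j := Nat.one_le_pow _ _ (by omega)
    rw [pow_succ]; nlinarith

lemma conj_zpow_mem {M : Type u} [Group M] [Group.IsNilpotent M] (K : Subgroup M) [K.Normal] (b : M) :
    ∃ c : ℕ, ∀ κ ∈ K, ∃ S : Set M, S.Finite ∧ 1 ∈ S ∧ S ⊆ K ∧
        ∀ f : ℤ, (b ^ f)⁻¹ * κ * b ^ f ∈ S ^ ((f.natAbs + 1) ^ c) := by
  obtain ⟨c, hc⟩ := Subgroup.nilpotent_iff_lowerCentralSeries.1 (inferInstance : Group.IsNilpotent M)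
  refine ⟨c, fun κ hκ => ?_⟩
  obtain ⟨S, hS, hS1, hSK, hS2⟩ := conj_pow_mem K c hc b c le_rfl κ hκ (by simp)
  obtain ⟨T, hT, hT1, hTK, hT2⟩ := conj_pow_mem K c hc b⁻¹ c le_rfl κ hκ (by simp)
  refine ⟨S ∪ T, hS.union hT, Or.inl hS1, Set.union_subset hSK hTK, fun f => ?_⟩
  obtain ⟨m, rfl | rfl⟩ := f.eq_nat_or_neg
  · have := hS2 m
    simpa using Set.pow_subset_pow_left (Set.subset_union_left (t := T)) this
  · have := hT2 m
    simpa using Set.pow_subset_pow_left (Set.subset_union_right (s := S)) this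

lemma poly_growth : ∀ (n : ℕ) {M : Type u} [Group M] (h : PolyCyc n M) [Group.IsNilpotent M]
    (S : Set M) (hS : S.Finite), ∃ C D : ℕ, ∀ k : ℕ, (S ^ k).ncard ≤ C * (k + 1) ^ D
  | 0, M, _, h, _, S, hS => by
    haveI : Subsingleton M := h
    refine ⟨1, 0, fun k => ?_⟩
    rw [pow_zero, mul_one]
    exact Set.ncard_le_one_of_subsingleton _
  | n + 1, M, _, h, _, S, hS => by
    obtain ⟨K, hKn, hK, b, hb⟩ := h
    obtain ⟨c, hc⟩ := conj_zpow_mem K b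
    choose e he using hb
    have hc' := fun s : M => hc _ (he s)
    choose T hT hT1 hTK hT2 using hc'
    set U : Set M := {1} ∪ ⋃ s ∈ S, T s with hU
    have hUf : U.Finite := (Set.finite_singleton _).union (hS.biUnion fun s _ => hT s)
    have hU1 : (1 : M) ∈ U := Or.inl rfl
    have hUK : U ⊆ K := by
      rintro x (rfl | hx)
      · exact K.one_mem
      · simp only [Set.mem_iUnion] at hx
        obtain ⟨s, _, hs⟩ := hx
        exact hTK s hs
    have hTU : ∀ s ∈ S, T s ⊆ U := fun s hs x hx => Or.inr (Set.mem_biUnion hs hx)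
    obtain ⟨e0, he0⟩ : ∃ e0 : ℕ, ∀ s ∈ S, (e s).natAbs ≤ e0 := by
      obtain ⟨m, hm⟩ := (hS.image fun s => (e s).natAbs).bddAbove
      exact ⟨m, fun s hs => hm ⟨s, hs, rfl⟩⟩
    set U' : Set K := Subtype.val ⁻¹' U with hU'
    have hU'f : U'.Finite := hUf.preimage Subtype.val_injective.injOn
    have hUU : Subtype.val '' U' = U := by
      ext x
      constructor
      · rintro ⟨y, hy, rfl⟩; exact hy
      · intro hx; exact ⟨⟨x, hUK hx⟩, hx, rfl⟩
    obtain ⟨C, D, hCD⟩ := poly_growth n hK U' hU'f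
    have hcard : ∀ k, (U ^ k).ncard ≤ C * (k + 1) ^ D := by
      intro k
      have : U ^ k = (K.subtype) '' (U' ^ k) := by
        rw [Set.image_pow]; congr 1; exact hUU.symm
      rw [this]
      exact (Set.ncard_image_le (set_finite_pow hU'f k)).trans (hCD k)
    have key : ∀ N k : ℕ, k ≤ N → ∀ g ∈ S ^ k, ∃ m : ℤ, m.natAbs ≤ e0 * k ∧
        (b ^ m)⁻¹ * g ∈ U ^ (k * (e0 * N + 1) ^ c) := by
      intro N k
      induction k with
      | zero =>
        intro _ g hg
        rw [pow_zero, Set.mem_one] at hg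
        subst hg
        exact ⟨0, by simp, by simp⟩
      | succ k ih =>
        intro hk g hg
        rw [pow_succ'] at hg
        obtain ⟨s, hs, g', hg', rfl⟩ := hg
        obtain ⟨m, hm, hmg⟩ := ih (by omega) g' hg'
        refine ⟨e s + m, ?_, ?_⟩
        · have := he0 s hs
          have h2 := Int.natAbs_add_le (e s) m
          rw [mul_add, mul_one]; omega
        · have eq : (b ^ (e s + m))⁻¹ * (s * g') =
              ((b ^ m)⁻¹ * ((b ^ e s)⁻¹ * s) * b ^ m) * ((b ^ m)⁻¹ * g') := by
            rw [zpow_add]; group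
          change (b ^ (e s + m))⁻¹ * (s * g') ∈ _
          rw [eq, show (k + 1) * (e0 * N + 1) ^ c = (e0 * N + 1) ^ c + k * (e0 * N + 1) ^ c by ring,
            pow_add]
          refine Set.mul_mem_mul ?_ hmg
          have h3 := Set.pow_subset_pow_left (hTU s hs) (hT2 s m)
          refine Set.pow_subset_pow_right hU1 (Nat.pow_le_pow_left ?_ _) h3
          have : e0 * k ≤ e0 * N := Nat.mul_le_mul_left _ (by omega)
          omega
    refine ⟨(2 * e0 + 1) * (C * (e0 + 1) ^ (c * D)), 1 + (c + 1) * D, fun k => ?_⟩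
    have hsub : S ^ k ⊆ (fun p : ℤ × M => b ^ p.1 * p.2) ''
        ((Set.Icc (-(e0 * k : ℤ)) (e0 * k)) ×ˢ (U ^ (k * (e0 * k + 1) ^ c))) := by
      intro g hg
      obtain ⟨m, hm, hmg⟩ := key k k le_rfl g hg
      refine ⟨(m, (b ^ m)⁻¹ * g), ⟨?_, hmg⟩, by simp⟩
      constructor <;> zify at hm <;> have := abs_le.1 hm <;> simp <;> linarith
    have hfin : ((Set.Icc (-(e0 * k : ℤ)) (e0 * k)) ×ˢ (U ^ (k * (e0 * k + 1) ^ c))).Finite :=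
      (Set.finite_Icc _ _).prod (set_finite_pow hUf _)
    refine (Set.ncard_le_ncard hsub (hfin.image _)).trans ((Set.ncard_image_le hfin).trans ?_)
    rw [Set.ncard_prod]
    have h1 : (Set.Icc (-(e0 * k : ℤ)) (e0 * k)).ncard ≤ (2 * e0 + 1) * (k + 1) := by
      rw [Set.ncard_eq_toFinset_card', Set.toFinset_Icc, Int.card_Icc]
      have : ((e0 : ℤ) * k + 1 - -(e0 * k)).toNat = 2 * (e0 * k) + 1 := by
        have : ((e0 : ℤ) * k + 1 - -(e0 * k)) = ((2 * (e0 * k) + 1 : ℕ) : ℤ) := by push_cast; ring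
        rw [this, Int.toNat_natCast]
      rw [this]; nlinarith
    have h2 : k * (e0 * k + 1) ^ c + 1 ≤ (k + 1) * ((e0 + 1) * (k + 1)) ^ c := by
      have h4 : (e0 * k + 1) ^ c ≤ ((e0 + 1) * (k + 1)) ^ c := Nat.pow_le_pow_left (by nlinarith) _
      have h5 : 1 ≤ ((e0 + 1) * (k + 1)) ^ c := Nat.one_le_pow _ _ (by positivity)
      nlinarith [Nat.mul_le_mul_left k h4]
    calc _ ≤ ((2 * e0 + 1) * (k + 1)) * (C * ((k + 1) * ((e0 + 1) * (k + 1)) ^ c) ^ D) :=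
          Nat.mul_le_mul h1 ((hcard _).trans (Nat.mul_le_mul_left _ (Nat.pow_le_pow_left h2 _)))
      _ = _ := by rw [mul_pow, mul_pow, mul_pow]; ring

end polyg

section sig
universe u
variable {G : Type u} [Group G]

lemma mem_pow_of_closure (S : Set G) (hinv : ∀ x ∈ S, x⁻¹ ∈ S) (x : G)
    (hx : x ∈ Subgroup.closure S) : ∃ c : ℕ, x ∈ S ^ c := by
  have hSi : S⁻¹ = S := by
    ext y; rw [Set.mem_inv]
    exact ⟨fun h => by simpa using hinv _ h, fun h => hinv _ h⟩
  induction hx using Subgroup.closure_induction with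
  | mem x hx => exact ⟨1, by simpa using hx⟩
  | one => exact ⟨0, by simp⟩
  | mul x y _ _ hx hy =>
    obtain ⟨c, hc⟩ := hx; obtain ⟨d, hd⟩ := hy
    exact ⟨c + d, by rw [pow_add]; exact Set.mul_mem_mul hc hd⟩
  | inv x _ hx =>
    obtain ⟨c, hc⟩ := hx
    refine ⟨c, ?_⟩
    rw [← hSi, inv_pow, Set.mem_inv, inv_inv]; exact hc

lemma inv_mem_pow (S : Set G) (hinv : ∀ x ∈ S, x⁻¹ ∈ S) (n : ℕ) (x : G) (hx : x ∈ S ^ n) :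
    x⁻¹ ∈ S ^ n := by
  have hSi : S⁻¹ = S := by
    ext y; rw [Set.mem_inv]
    exact ⟨fun h => by simpa using hinv _ h, fun h => hinv _ h⟩
  rw [← hSi, inv_pow, Set.mem_inv, inv_inv]; exact hx

lemma subset_pow_of_closure (S : Set G) (h1 : 1 ∈ S) (hinv : ∀ x ∈ S, x⁻¹ ∈ S) (X : Set G) (hX : X.Finite)
    (hXS : X ⊆ Subgroup.closure S) : ∃ K : ℕ, 1 ≤ K ∧ X ⊆ S ^ K := by
  choose! c hc using fun x (hx : x ∈ X) => mem_pow_of_closure S hinv x (hXS hx)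
  obtain ⟨m, hm⟩ := (hX.image c).bddAbove
  exact ⟨m + 1, by omega, fun x hx => Set.pow_subset_pow_right h1 ((hm ⟨x, hx, rfl⟩).trans (by omega)) (hc x hx)⟩

lemma conj_mem_pow (S : Set G) (K : ℕ) (q : G) (hq : ∀ s ∈ S, q * s * q⁻¹ ∈ S ^ K) (p : ℕ) (m : G)
    (hm : m ∈ S ^ p) : q * m * q⁻¹ ∈ S ^ (K * p) := by
  have : (MulAut.conj q).toMonoidHom '' S ⊆ S ^ K := by
    rintro _ ⟨s, hs, rfl⟩; exact hq s hs
  have h2 := Set.pow_subset_pow_left (n := p) this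
  rw [← Set.image_pow, ← pow_mul] at h2
  exact h2 ⟨m, hm, rfl⟩

lemma conj_mem_pow' (S Q : Set G) (K : ℕ) (hq : ∀ q ∈ Q, ∀ s ∈ S, q * s * q⁻¹ ∈ S ^ K) (L p : ℕ) (x m : G)
    (hx : x ∈ Q ^ L) (hm : m ∈ S ^ p) : x * m * x⁻¹ ∈ S ^ (K ^ L * p) := by
  induction L generalizing x with
  | zero =>
    rw [pow_zero, Set.mem_one] at hx; subst hx; simpa using hm
  | succ L ih =>
    rw [pow_succ'] at hx
    obtain ⟨q, hqq, y, hy, rfl⟩ := hx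
    have := conj_mem_pow S K q (hq q hqq) _ _ (ih y hy)
    rw [← mul_assoc, ← pow_succ'] at this
    convert this using 1
    simp [mul_assoc]

lemma comm_mem_pow (S Q : Set G) (h1 : 1 ∈ S) (K c : ℕ) (hq : ∀ q ∈ Q, ∀ s ∈ S, q * s * q⁻¹ ∈ S ^ K) (h : G)
    (hc : ∀ q ∈ Q, q * h * q⁻¹ * h⁻¹ ∈ S ^ c) (L : ℕ) (x : G) (hx : x ∈ Q ^ L) :
    x * h * x⁻¹ * h⁻¹ ∈ S ^ ((K + c) ^ (L + 1)) := by
  induction L generalizing x with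
  | zero =>
    rw [pow_zero, Set.mem_one] at hx; subst hx
    have : (1 : G) ∈ S ^ ((K + c) ^ 1) := Set.one_mem_pow h1
    simpa using this
  | succ L ih =>
    rw [pow_succ'] at hx
    obtain ⟨q, hqq, y, hy, rfl⟩ := hx
    have h3 := Set.mul_mem_mul (conj_mem_pow S K q (hq q hqq) _ _ (ih y hy)) (hc q hqq)
    rw [← pow_add] at h3
    have e : q * (y * h * y⁻¹ * h⁻¹) * q⁻¹ * (q * h * q⁻¹ * h⁻¹) = q * y * h * (q * y)⁻¹ * h⁻¹ := by group
    rw [e] at h3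
    refine Set.pow_subset_pow_right h1 ?_ h3
    rcases Nat.eq_zero_or_pos c with rfl | hcp
    · simp [pow_succ']
    have : 1 ≤ (K + c) ^ (L + 1) := Nat.one_le_pow _ _ (by omega)
    rw [pow_succ' (K + c) (L + 1), add_mul]
    have := Nat.mul_le_mul_left c this
    omega

/-- Ordered products of powers. -/
def sig : (d : ℕ) → (Fin d → G) → (Fin d → ℤ) → G
  | 0, _, _ => 1
  | d + 1, g, n => g 0 ^ n 0 * sig d (fun i => g i.succ) (fun i => n i.succ)

lemma zpow_mem_pow (Q : Set G) (h1 : 1 ∈ Q) (g : G) (hg : g ∈ Q) (hg' : g⁻¹ ∈ Q) (n : ℤ) (N : ℕ) (hn : n.natAbs ≤ N) :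
    g ^ n ∈ Q ^ N := by
  refine Set.pow_subset_pow_right h1 hn ?_
  obtain ⟨m, rfl | rfl⟩ := n.eq_nat_or_neg
  · simpa using Set.pow_mem_pow hg
  · have := Set.pow_mem_pow hg' (n := m)
    simpa using this

lemma sig_mem (Q : Set G) (h1 : 1 ∈ Q) : ∀ (d : ℕ) (g : Fin d → G) (hg : ∀ i, g i ∈ Q)
    (hg' : ∀ i, (g i)⁻¹ ∈ Q) (n : Fin d → ℤ) (N : ℕ) (hn : ∀ i, (n i).natAbs ≤ N), sig d g n ∈ Q ^ (d * N)
  | 0, g, hg, hg', n, N, hn => by simp [sig]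
  | d + 1, g, hg, hg', n, N, hn => by
    rw [sig, show (d + 1) * N = N + d * N by ring, pow_add]
    exact Set.mul_mem_mul (zpow_mem_pow Q h1 _ (hg 0) (hg' 0) _ _ (hn 0))
      (sig_mem Q h1 d _ (fun i => hg _) (fun i => hg' _) _ _ fun i => hn _)

lemma sig_gen (S Q : Set G) (h1 : 1 ∈ S) (hQ1 : 1 ∈ Q) (K c : ℕ) (hK : 1 ≤ K)
    (hq : ∀ q ∈ Q, ∀ s ∈ S, q * s * q⁻¹ ∈ S ^ K)
    (hc : ∀ q ∈ Q, ∀ h ∈ Q, q * h * q⁻¹ * h⁻¹ ∈ S ^ c) :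
    ∀ (d : ℕ) (g : Fin d → G) (hg : ∀ i, g i ∈ Q) (hg' : ∀ i, (g i)⁻¹ ∈ Q) (i : Fin d),
    ∃ C : ℕ, ∀ (N : ℕ) (n : Fin d → ℤ), (∀ i, (n i).natAbs ≤ N) →
      sig d g n * g i * (sig d g (n + Pi.single i 1))⁻¹ ∈ S ^ (C ^ (N + 1))
  | 0, g, hg, hg', i => i.elim0
  | d + 1, g, hg, hg', i => by
    refine Fin.cases ?_ (fun i => ?_) i
    · refine ⟨K * (K + c) ^ (d + 1), fun N n hn => ?_⟩
      have e1 : (fun i : Fin d => (n + Pi.single 0 1 : Fin (d + 1) → ℤ) i.succ) = fun i : Fin d => n i.succ := by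
        funext j; simp
      have e2 : (n + Pi.single 0 1 : Fin (d + 1) → ℤ) 0 = n 0 + 1 := by simp
      rw [sig, sig, e1, e2]
      set B := sig d (fun i => g i.succ) (fun i => n i.succ)
      have hB : B ∈ Q ^ (d * N) := sig_mem Q hQ1 d _ (fun i => hg _) (fun i => hg' _) _ _ fun i => hn _
      have h2 := conj_mem_pow' S Q K hq N _ _ _ (zpow_mem_pow Q hQ1 _ (hg 0) (hg' 0) _ N (hn 0))
        (comm_mem_pow S Q h1 K c hq (g 0) (fun q hqq => hc q hqq _ (hg 0)) _ B hB)
      have e3 : g 0 ^ n 0 * B * g 0 * (g 0 ^ (n 0 + 1) * B)⁻¹ = g 0 ^ n 0 * (B * g 0 * B⁻¹ * (g 0)⁻¹) * (g 0 ^ n 0)⁻¹ := by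
        rw [zpow_add]; group
      rw [e3]
      refine Set.pow_subset_pow_right h1 ?_ h2
      rw [mul_pow, ← pow_mul]
      refine Nat.mul_le_mul (Nat.pow_le_pow_right hK (by omega)) (Nat.pow_le_pow_right (by omega) (by nlinarith))
    · obtain ⟨C, hC⟩ := sig_gen S Q h1 hQ1 K c hK hq hc d (fun i => g i.succ) (fun i => hg _) (fun i => hg' _) i
      refine ⟨K * C, fun N n hn => ?_⟩
      have e1 : (fun j : Fin d => (n + Pi.single i.succ 1 : Fin (d + 1) → ℤ) j.succ) = ((fun i : Fin d => n i.succ) + Pi.single i 1 : Fin d → ℤ) := by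
        funext j
        simp only [Pi.add_apply]
        congr 1
        by_cases hij : j = i
        · subst hij; simp
        · rw [Pi.single_eq_of_ne hij, Pi.single_eq_of_ne (by simpa using hij)]
      have e2 : (n + Pi.single i.succ 1 : Fin (d + 1) → ℤ) 0 = n 0 := by
        rw [Pi.add_apply, Pi.single_eq_of_ne (Fin.succ_ne_zero i).symm, add_zero]
      rw [sig, sig, e1, e2]
      have h2 := conj_mem_pow' S Q K hq N _ _ _ (zpow_mem_pow Q hQ1 _ (hg 0) (hg' 0) _ N (hn 0))
        (hC N (fun i => n i.succ) fun i => hn _)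
      set B := sig d (fun i => g i.succ) (fun i => n i.succ)
      set B' := sig d (fun i => g i.succ) ((fun i => n i.succ) + Pi.single i 1)
      have e3 : g 0 ^ n 0 * B * g i.succ * (g 0 ^ n 0 * B')⁻¹ = g 0 ^ n 0 * (B * g i.succ * B'⁻¹) * (g 0 ^ n 0)⁻¹ := by
        group
      rw [e3]
      refine Set.pow_subset_pow_right h1 ?_ h2
      rw [mul_pow]
      exact Nat.mul_le_mul_right _ (Nat.pow_le_pow_right hK (by omega))

lemma sig_all (S Q : Set G) (h1 : 1 ∈ S) (hinv : ∀ x ∈ S, x⁻¹ ∈ S) (hQ1 : 1 ∈ Q) (K c : ℕ) (hK : 1 ≤ K)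
    (hq : ∀ q ∈ Q, ∀ s ∈ S, q * s * q⁻¹ ∈ S ^ K)
    (hc : ∀ q ∈ Q, ∀ h ∈ Q, q * h * q⁻¹ * h⁻¹ ∈ S ^ c)
    (d : ℕ) (g : Fin d → G) (hg : ∀ i, g i ∈ Q) (hg' : ∀ i, (g i)⁻¹ ∈ Q) (h : G)
    (hh : h ∈ Subgroup.closure (Set.range g)) :
    ∃ (k : Fin d → ℤ) (C : ℕ), ∀ (N : ℕ) (n : Fin d → ℤ), (∀ i, (n i).natAbs ≤ N) →
      sig d g n * h * (sig d g (n + k))⁻¹ ∈ S ^ (C ^ (N + 1)) := by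
  induction hh using Subgroup.closure_induction with
  | mem x hx =>
    obtain ⟨i, rfl⟩ := hx
    obtain ⟨C, hC⟩ := sig_gen S Q h1 hQ1 K c hK hq hc d g hg hg' i
    exact ⟨_, C, hC⟩
  | one => exact ⟨0, 1, fun N n hn => by simpa using h1⟩
  | mul x y _ _ hx hy =>
    obtain ⟨k, C, hC⟩ := hx
    obtain ⟨k', C', hC'⟩ := hy
    obtain ⟨B, hB⟩ : ∃ B : ℕ, ∀ i, (k i).natAbs ≤ B := by
      obtain ⟨m, hm⟩ := (Set.finite_range fun i => (k i).natAbs).bddAbove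
      exact ⟨m, fun i => hm ⟨i, rfl⟩⟩
    refine ⟨k + k', C + (C' + 1) ^ (B + 1), fun N n hn => ?_⟩
    have h2 := Set.mul_mem_mul (hC N n hn) (hC' (N + B) (n + k) fun i =>
      (Int.natAbs_add_le _ _).trans (add_le_add (hn i) (hB i)))
    rw [← pow_add] at h2
    have e : sig d g n * x * (sig d g (n + k))⁻¹ * (sig d g (n + k) * y * (sig d g (n + k + k'))⁻¹) =
      sig d g n * (x * y) * (sig d g (n + (k + k')))⁻¹ := by
      rw [add_assoc]; group
    rw [e] at h2
    refine Set.pow_subset_pow_right h1 ?_ h2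
    calc C ^ (N + 1) + C' ^ (N + B + 1) ≤ C ^ (N + 1) + ((C' + 1) ^ (B + 1)) ^ (N + 1) := by
          rw [← pow_mul]
          refine Nat.add_le_add_left ?_ _
          exact (Nat.pow_le_pow_left (by omega) _).trans (Nat.pow_le_pow_right (by omega) (by nlinarith))
      _ ≤ _ := pow_add_pow_le (by positivity) (by positivity) (by omega)
  | inv x _ hx =>
    obtain ⟨k, C, hC⟩ := hx
    obtain ⟨B, hB⟩ : ∃ B : ℕ, ∀ i, (k i).natAbs ≤ B := by
      obtain ⟨m, hm⟩ := (Set.finite_range fun i => (k i).natAbs).bddAbove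
      exact ⟨m, fun i => hm ⟨i, rfl⟩⟩
    refine ⟨-k, (C + 1) ^ (B + 1), fun N n hn => ?_⟩
    have h2 := inv_mem_pow S hinv _ _ (hC (N + B) (n + -k) fun i =>
      (Int.natAbs_add_le _ _).trans (add_le_add (hn i) (by simpa using hB i)))
    rw [neg_add_cancel_right] at h2
    have e : (sig d g (n + -k) * x * (sig d g n)⁻¹)⁻¹ = sig d g n * x⁻¹ * (sig d g (n + -k))⁻¹ := by group
    rw [e] at h2
    refine Set.pow_subset_pow_right h1 ?_ h2
    rw [← pow_mul]
    exact (Nat.pow_le_pow_left (by omega) _).trans (Nat.pow_le_pow_right (by omega) (by nlinarith))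

end sig

section box

/-- Boxes in `ℤ^d`. -/
def boxF (d R : ℕ) : Finset (Fin d → ℤ) := Fintype.piFinset fun _ => Finset.Icc (-(R : ℤ)) R

lemma mem_boxF {d R : ℕ} {n : Fin d → ℤ} : n ∈ boxF d R ↔ ∀ i, (n i).natAbs ≤ R := by
  simp only [boxF, Fintype.mem_piFinset, Finset.mem_Icc]
  refine forall_congr' fun i => ?_
  omega

lemma mem_boxF_norm {d R : ℕ} {n : Fin d → ℤ} : n ∈ boxF d R ↔ ‖n‖ ≤ R := by
  rw [mem_boxF, pi_norm_le_iff_of_nonneg (Nat.cast_nonneg R)]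
  refine forall_congr' fun i => ?_
  rw [Int.norm_eq_abs]
  constructor
  · intro h
    have : (((n i).natAbs : ℕ) : ℝ) ≤ R := by exact_mod_cast h
    simpa using this
  · intro h
    have : (((n i).natAbs : ℕ) : ℝ) ≤ R := by simpa using h
    exact_mod_cast this

lemma card_boxF (d R : ℕ) : (boxF d R).card = (2 * R + 1) ^ d := by
  simp only [boxF, Fintype.card_piFinset, Int.card_Icc, Finset.prod_const, Finset.card_univ, Fintype.card_fin]
  congr 1
  omega

lemma norm_gt_of_notMem {d R : ℕ} {n : Fin d → ℤ} (h : n ∉ boxF d R) : (R : ℝ) + 1 ≤ ‖n‖ := by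
  rw [mem_boxF] at h
  push Not at h
  obtain ⟨i, hi⟩ := h
  have h1 : ((R + 1 : ℕ) : ℝ) ≤ ((n i).natAbs : ℕ) := by exact_mod_cast hi
  have h2 := norm_le_pi_norm n i
  rw [Int.norm_eq_abs] at h2
  have h3 : (((n i).natAbs : ℕ) : ℝ) = |((n i : ℤ) : ℝ)| := by simp
  push_cast at h1
  rw [h3] at h1
  linarith

/-- Tent function. -/
def tent {d : ℕ} (R : ℕ) (n : Fin d → ℤ) : ℝ := max 0 ((R : ℝ) + 1 - ‖n‖)

lemma tent_lip {d : ℕ} (R : ℕ) (n k : Fin d → ℤ) : |tent R n - tent R (n + k)| ≤ ‖k‖ := by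
  unfold tent
  have h1 : |‖n‖ - ‖n + k‖| ≤ ‖k‖ := by
    have := abs_norm_sub_norm_le n (n + k)
    simpa using this
  rw [abs_le] at h1 ⊢
  constructor
  · rcases max_cases (0:ℝ) ((R : ℝ) + 1 - ‖n‖) with h | h <;>
    rcases max_cases (0:ℝ) ((R : ℝ) + 1 - ‖n + k‖) with h' | h' <;> rw [h.1, h'.1] <;> linarith
  · rcases max_cases (0:ℝ) ((R : ℝ) + 1 - ‖n‖) with h | h <;>
    rcases max_cases (0:ℝ) ((R : ℝ) + 1 - ‖n + k‖) with h' | h' <;> rw [h.1, h'.1] <;> linarith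

variable {d : ℕ} {T ι : Type*} [Fintype T] [Nonempty T] [Fintype ι] [Nonempty ι]

/-- Skew product walk. -/
def skew (kk : T → ι → (Fin d → ℤ)) (tt : ι → T → T) (l : ι) (x : (Fin d → ℤ) × T) : (Fin d → ℤ) × T :=
  (x.1 + kk x.2 l, tt l x.2)

lemma box_walk (kk : T → ι → (Fin d → ℤ)) (tt : ι → T → T) (inv : ι ≃ ι)
    (h1 : ∀ l t, tt (inv l) (tt l t) = t) (h2 : ∀ l t, tt l (tt (inv l) t) = t)
    (h3 : ∀ l t, kk (tt l t) (inv l) = - kk t l) :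
    ∃ (C : ℝ) (R0 : ℕ), 0 < C ∧ 1 ≤ R0 ∧ ∀ R : ℕ, R0 ≤ R → ∃ x ∈ (boxF d R ×ˢ (Finset.univ : Finset T)),
      Real.exp (-C * R) ≤ stayP (skew kk tt) ((boxF d R ×ˢ (Finset.univ : Finset T) : Finset _) : Set _) (R ^ 3) x := by
  classical
  obtain ⟨B0, hB0⟩ : ∃ B0 : ℕ, ∀ t l, ‖kk t l‖ ≤ B0 := by
    obtain ⟨m, hm⟩ := (Set.finite_range fun p : T × ι => ‖kk p.1 p.2‖).bddAbove
    exact ⟨⌈m⌉₊, fun t l => (hm ⟨(t, l), rfl⟩).trans (Nat.le_ceil m)⟩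
  have hinv : ∀ i x, skew kk tt (inv i) (skew kk tt i x) = x := by
    rintro i ⟨n, t⟩
    simp only [skew, h1, h3]
    simp
  have hinv2 : ∀ i x, skew kk tt i (skew kk tt (inv i) x) = x := by
    rintro i ⟨n, t⟩
    have := h3 i (tt (inv i) t)
    rw [h2] at this
    simp only [skew, h2, this]
    simp
  set A : ℝ := 2 * B0 ^ 2 * (2 * B0 + 5) ^ d + 1 with hA
  have hA0 : 0 < A := by positivity
  refine ⟨4 * A, ⌈2 * A⌉₊ + 1, by positivity, by omega, fun R hR => ?_⟩
  have hRA : 2 * A ≤ R := by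
    have h5 : 2 * A ≤ ⌈2 * A⌉₊ := Nat.le_ceil _
    have h6 : ((⌈2 * A⌉₊ + 1 : ℕ) : ℝ) ≤ R := by exact_mod_cast hR
    push_cast at h6; linarith
  have hR1 : (1:ℝ) ≤ R := by exact_mod_cast (by omega : 1 ≤ R)
  have hRN : 1 ≤ R := by exact_mod_cast hR1
  set B : Finset ((Fin d → ℤ) × T) := boxF d R ×ˢ Finset.univ with hB
  set B' : Finset ((Fin d → ℤ) × T) := boxF d (R + 1 + B0) ×ˢ Finset.univ with hB'
  set f : (Fin d → ℤ) × T → ℝ := fun x => tent R x.1 with hf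
  have hf0 : ∀ x, x ∉ B → f x = 0 := by
    intro x hx
    have hx' : x.1 ∉ boxF d R := by
      intro h; exact hx (by simp [hB, h])
    have := norm_gt_of_notMem hx'
    simp only [hf, tent]
    rw [max_eq_left]; linarith
  have hBB : B ⊆ B' := by
    intro x hx
    simp only [hB, hB', Finset.mem_product, Finset.mem_univ, and_true, mem_boxF] at hx ⊢
    intro i; have := hx i; omega
  -- lower bound on the ℓ² norm
  have hsum : (R:ℝ) ^ 2 / 4 * ((R:ℝ) ^ d * Fintype.card T) ≤ ∑ x ∈ B, f x ^ 2 := by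
    set B2 : Finset ((Fin d → ℤ) × T) := boxF d (R / 2) ×ˢ Finset.univ with hB2
    have hsub : B2 ⊆ B := by
      intro x hx
      simp only [hB, hB2, Finset.mem_product, Finset.mem_univ, and_true, mem_boxF] at hx ⊢
      intro i; have := hx i; omega
    have hcard : (R:ℝ) ^ d * Fintype.card T ≤ B2.card := by
      rw [hB2, Finset.card_product, card_boxF, Finset.card_univ]
      push_cast
      gcongr
      have : R ≤ 2 * (R / 2) + 1 := by omega
      exact_mod_cast this
    calc (R:ℝ) ^ 2 / 4 * ((R:ℝ) ^ d * Fintype.card T) ≤ (R:ℝ) ^ 2 / 4 * B2.card := by gcongr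
      _ = ∑ x ∈ B2, (R:ℝ) ^ 2 / 4 := by rw [Finset.sum_const, nsmul_eq_mul, mul_comm]
      _ ≤ ∑ x ∈ B2, f x ^ 2 := by
        refine Finset.sum_le_sum fun x hx => ?_
        simp only [hB2, Finset.mem_product, Finset.mem_univ, and_true, mem_boxF_norm] at hx
        have h7 : ((R / 2 : ℕ) : ℝ) ≤ R / 2 := Nat.cast_div_le
        have h8 : (R:ℝ) / 2 ≤ f x := le_trans (by linarith) (le_max_right _ _)
        calc (R:ℝ) ^ 2 / 4 = (R / 2) ^ 2 := by ring
          _ ≤ _ := by gcongr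
      _ ≤ _ := Finset.sum_le_sum_of_subset_of_nonneg hsub fun _ _ _ => sq_nonneg _
  have hT : (0:ℝ) < Fintype.card T := by exact_mod_cast Fintype.card_pos
  have hpos : 0 < ∑ x ∈ B, f x ^ 2 := lt_of_lt_of_le (by positivity) hsum
  have hB'card : (B'.card : ℝ) ≤ (2 * B0 + 5) ^ d * ((R:ℝ) ^ d * Fintype.card T) := by
    rw [hB', Finset.card_product, card_boxF, Finset.card_univ]
    push_cast
    rw [← mul_assoc, ← mul_pow]
    gcongr
    have : (B0:ℝ) ≤ B0 * R := le_mul_of_one_le_right (by positivity) hR1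
    nlinarith
  have hterm : ∀ i, ∑ x ∈ B, f x ^ 2 - B0 ^ 2 * B'.card / 2 ≤ ∑ x ∈ B, f x * f (skew kk tt i x) := by
    intro i
    have e1 : ∑ x ∈ B, f x * f (skew kk tt i x) = ∑ x ∈ B', f x * f (skew kk tt i x) :=
      Finset.sum_subset hBB fun x _ hx => by rw [hf0 x hx, zero_mul]
    have e2 : ∑ x ∈ B, f x ^ 2 = ∑ x ∈ B', f x ^ 2 :=
      Finset.sum_subset hBB fun x _ hx => by rw [hf0 x hx]; ring
    have e3 : ∑ x ∈ B, f x ^ 2 ≤ ∑ x ∈ B', f (skew kk tt i x) ^ 2 := by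
      have : ∑ x ∈ B, f x ^ 2 = ∑ x ∈ B.image (skew kk tt (inv i)), f (skew kk tt i x) ^ 2 := by
        rw [Finset.sum_image]
        · exact Finset.sum_congr rfl fun x _ => by rw [hinv2]
        · intro x _ y _ hxy
          have := congrArg (skew kk tt i) hxy
          simpa [hinv2] using this
      rw [this]
      refine Finset.sum_le_sum_of_subset_of_nonneg ?_ fun _ _ _ => sq_nonneg _
      intro y hy
      obtain ⟨x, hx, rfl⟩ := Finset.mem_image.1 hy
      simp only [hB, hB', Finset.mem_product, Finset.mem_univ, and_true, mem_boxF_norm] at hx ⊢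
      have h9 := norm_add_le x.1 (kk x.2 (inv i))
      have h10 := hB0 x.2 (inv i)
      simp only [skew]
      push_cast
      linarith
    have e4 : ∑ x ∈ B', (f x - f (skew kk tt i x)) ^ 2 ≤ B0 ^ 2 * B'.card := by
      calc _ ≤ ∑ x ∈ B', (B0:ℝ) ^ 2 := by
            refine Finset.sum_le_sum fun x _ => ?_
            have := (tent_lip R x.1 (kk x.2 i)).trans (hB0 x.2 i)
            rw [← sq_abs]
            gcongr
            exact this
        _ = _ := by rw [Finset.sum_const, nsmul_eq_mul, mul_comm]
    have e5 : ∑ x ∈ B', (f x - f (skew kk tt i x)) ^ 2 =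
        ∑ x ∈ B', f x ^ 2 + ∑ x ∈ B', f (skew kk tt i x) ^ 2 - 2 * ∑ x ∈ B', f x * f (skew kk tt i x) := by
      rw [Finset.mul_sum, ← Finset.sum_add_distrib, ← Finset.sum_sub_distrib]
      exact Finset.sum_congr rfl fun x _ => by ring
    rw [e1]
    linarith
  set κ : ℝ := 1 - A / R ^ 2 with hκ
  have hAR : A / (R:ℝ) ^ 2 ≤ 1 / 2 := by
    rw [div_le_iff₀ (by positivity)]
    nlinarith
  have hκ0 : 0 ≤ κ := by rw [hκ]; linarith
  have hq : κ * ∑ x ∈ B, f x ^ 2 ≤ (∑ i, ∑ x ∈ B, f x * f (skew kk tt i x)) / (Fintype.card ι : ℝ) := by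
    rw [le_div_iff₀ (by exact_mod_cast Fintype.card_pos)]
    have e6 : κ * ∑ x ∈ B, f x ^ 2 ≤ ∑ x ∈ B, f x ^ 2 - B0 ^ 2 * B'.card / 2 := by
      have e7 : (B0:ℝ) ^ 2 * B'.card / 2 ≤ A / R ^ 2 * ((R:ℝ) ^ 2 / 4 * ((R:ℝ) ^ d * Fintype.card T)) := by
        have e8 : A / R ^ 2 * ((R:ℝ) ^ 2 / 4 * ((R:ℝ) ^ d * Fintype.card T)) = A / 4 * ((R:ℝ) ^ d * Fintype.card T) := by
          field_simp
        rw [e8]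
        calc (B0:ℝ) ^ 2 * B'.card / 2 ≤ (B0:ℝ) ^ 2 * ((2 * B0 + 5) ^ d * ((R:ℝ) ^ d * Fintype.card T)) / 2 := by gcongr
          _ = (2 * B0 ^ 2 * (2 * B0 + 5) ^ d) / 4 * ((R:ℝ) ^ d * Fintype.card T) := by ring
          _ ≤ _ := by
            have : (0:ℝ) ≤ (R:ℝ) ^ d * Fintype.card T := by positivity
            gcongr; rw [hA]; linarith
      have e9 : A / R ^ 2 * ((R:ℝ) ^ 2 / 4 * ((R:ℝ) ^ d * Fintype.card T)) ≤ A / R ^ 2 * ∑ x ∈ B, f x ^ 2 := by gcongr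
      rw [hκ, sub_mul, one_mul]
      linarith
    calc _ ≤ (∑ x ∈ B, f x ^ 2 - B0 ^ 2 * B'.card / 2) * (Fintype.card ι : ℝ) := by gcongr
      _ = ∑ i : ι, (∑ x ∈ B, f x ^ 2 - B0 ^ 2 * B'.card / 2) := by
        rw [Finset.sum_const, nsmul_eq_mul, mul_comm, Finset.card_univ]
      _ ≤ _ := Finset.sum_le_sum fun i _ => hterm i
  set j := Nat.clog 2 (R ^ 3) with hj
  have hj1 : R ^ 3 ≤ 2 ^ j := Nat.le_pow_clog (by norm_num) _
  have hj2 : 2 ^ j ≤ 2 * R ^ 3 := by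
    rcases Nat.eq_zero_or_pos j with h0 | h0
    · rw [h0]; have : 0 < R ^ 3 := by positivity
      omega
    · obtain ⟨j', hj'⟩ : ∃ j', j = j' + 1 := ⟨j - 1, by omega⟩
      have : 2 ^ j' < R ^ 3 := Nat.pow_lt_of_lt_clog (by omega)
      rw [hj', pow_succ]; omega
  obtain ⟨x, hx, hst⟩ := exists_stayP_ge (skew kk tt) B inv hinv hinv2 f hf0 κ hκ0 hpos hq j
  refine ⟨x, hx, le_trans ?_ (hst.trans (stayP_anti _ _ x hj1))⟩
  have e10 : Real.exp (-(2 * (A / R ^ 2))) ≤ κ := by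
    set y := A / (R:ℝ) ^ 2 with hy
    have hy0 : 0 ≤ y := by positivity
    rw [hκ, Real.exp_neg, inv_le_comm₀ (Real.exp_pos _) (by linarith)]
    have h11 := Real.add_one_le_exp (2 * y)
    refine le_trans ?_ h11
    rw [inv_le_iff_one_le_mul₀ (by linarith)]
    nlinarith
  calc Real.exp (-(4 * A) * R) ≤ Real.exp (((2 ^ j : ℕ) : ℝ) * (-(2 * (A / R ^ 2)))) := by
        apply Real.exp_le_exp.2
        have h12 : ((2 ^ j : ℕ) : ℝ) ≤ 2 * (R:ℝ) ^ 3 := by exact_mod_cast hj2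
        have h13 : ((2 ^ j : ℕ) : ℝ) * (2 * (A / R ^ 2)) ≤ 2 * (R:ℝ) ^ 3 * (2 * (A / R ^ 2)) := by gcongr
        have h14 : 2 * (R:ℝ) ^ 3 * (2 * (A / R ^ 2)) = 4 * A * R := by field_simp; ring
        linarith
    _ = Real.exp (-(2 * (A / R ^ 2))) ^ (2 ^ j) := by rw [← Real.exp_nat_mul]
    _ ≤ _ := by gcongr

end box

section conf
universe u

lemma poly_growth_sub {G : Type u} [Group G] (n : ℕ) (K : Subgroup G) (hK : PolyCyc n K)
    (hnil : Group.IsNilpotent K) (U : Set G) (hUf : U.Finite) (hUK : U ⊆ K) :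
    ∃ C D : ℕ, ∀ k : ℕ, (U ^ k).ncard ≤ C * (k + 1) ^ D := by
  set U' : Set K := Subtype.val ⁻¹' U with hU'
  have hU'f : U'.Finite := hUf.preimage Subtype.val_injective.injOn
  have hUU : Subtype.val '' U' = U := by
    ext x
    constructor
    · rintro ⟨y, hy, rfl⟩; exact hy
    · intro hx; exact ⟨⟨x, hUK hx⟩, hx, rfl⟩
  obtain ⟨C, D, hCD⟩ := poly_growth n hK U' hU'f
  refine ⟨C, D, fun k => ?_⟩
  have : U ^ k = (K.subtype) '' (U' ^ k) := by
    rw [Set.image_pow]; congr 1; exact hUU.symm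
  rw [this]
  exact (Set.ncard_image_le (set_finite_pow hU'f k)).trans (hCD k)

lemma card_est (Cp D d t C0 : ℕ) (hC0 : 1 ≤ C0) :
    ∀ R : ℕ, 1 ≤ R → ((Cp * (R ^ 3 * C0 ^ (R + 1) + 1) ^ D * ((2 * R + 1) ^ d * t) : ℕ) : ℝ) ≤
      Real.exp ((Cp + D * (4 + 2 * Real.log C0) + 3 * d + t) * R) := by
  intro R hR
  have hR1 : (1:ℝ) ≤ R := by exact_mod_cast hR
  have hC : (1:ℝ) ≤ C0 := by exact_mod_cast hC0
  have hlin : ∀ x : ℝ, 0 ≤ x → x ≤ Real.exp (x * R) := by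
    intro x hx
    have h1 := Real.add_one_le_exp (x * R)
    nlinarith
  have hRe : (R:ℝ) ≤ Real.exp R := by linarith [Real.add_one_le_exp (R:ℝ)]
  have h2e : (2:ℝ) ≤ Real.exp R := by linarith [Real.add_one_le_exp (R:ℝ)]
  have h3 : (2 * (R:ℝ) + 1) ≤ Real.exp (3 * R) := by
    have h4 : Real.exp (3 * R) = Real.exp R * Real.exp R * Real.exp R := by
      rw [← Real.exp_add, ← Real.exp_add]; ring_nf
    rw [h4]
    have : (2:ℝ) * 2 * R ≤ Real.exp R * Real.exp R * Real.exp R := by gcongr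
    linarith
  have h5 : (R:ℝ) ^ 3 * C0 ^ (R + 1) + 1 ≤ Real.exp ((4 + 2 * Real.log C0) * R) := by
    have h6 : Real.exp ((4 + 2 * Real.log C0) * R) =
        Real.exp R * Real.exp R ^ 3 * (C0 : ℝ) ^ (2 * R) := by
      rw [← Real.exp_nat_mul, show ((C0:ℝ) ^ (2 * R)) = Real.exp (Real.log C0 * (2 * R : ℕ)) by
        rw [Real.exp_mul, Real.exp_log (by linarith)]; norm_cast, ← Real.exp_add, ← Real.exp_add]
      push_cast; ring_nf
    rw [h6]
    have h7 : (C0:ℝ) ^ (R + 1) ≤ (C0 : ℝ) ^ (2 * R) := pow_le_pow_right₀ hC (by omega)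
    have h8 : (1:ℝ) ≤ (R:ℝ) ^ 3 * C0 ^ (R + 1) := by
      have := one_le_pow₀ hR1 (n := 3)
      have h9 := one_le_pow₀ hC (n := R + 1)
      nlinarith
    calc (R:ℝ) ^ 3 * C0 ^ (R + 1) + 1 ≤ 2 * (R:ℝ) ^ 3 * C0 ^ (R + 1) := by linarith
      _ ≤ _ := by gcongr
  have e : Real.exp ((Cp + D * (4 + 2 * Real.log C0) + 3 * d + t) * R) =
      Real.exp (Cp * R) * Real.exp ((4 + 2 * Real.log C0) * R) ^ D * (Real.exp (3 * R) ^ d * Real.exp (t * R)) := by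
    rw [← Real.exp_nat_mul, ← Real.exp_nat_mul, ← Real.exp_add, ← Real.exp_add, ← Real.exp_add]
    ring_nf
  rw [e]
  push_cast
  gcongr
  · exact hlin _ (by positivity)
  · exact hlin _ (by positivity)

lemma conf {G : Type u} [Group G] (n : ℕ) (h : PolyCyc n G) (r : ℕ) (hr : 0 < r) (a : Fin r → G) :
    ∃ (C : ℝ) (R0 : ℕ), 0 < C ∧ 1 ≤ R0 ∧ ∀ R : ℕ, R0 ≤ R → ∃ Ω : Finset G, 1 ∈ Ω ∧
      (Ω.card : ℝ) ≤ Real.exp (C * R) ∧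
      Real.exp (-C * R) ≤ stayP (ract (stepOf a)) (Ω : Set G) (R ^ 3) 1 := by
  classical
  haveI : Nonempty (Fin r) := ⟨⟨0, hr⟩⟩
  obtain ⟨G', hfi, hnorm, hnil⟩ := exists_nilp n h
  set M : Subgroup G := ⁅G', G'⁆ with hM
  haveI : M.Normal := by rw [hM]; infer_instance
  have hfg1 : Group.FG G' := PolyCyc.fg n (h.subgroup G')
  have hfg2 : Group.FG M := PolyCyc.fg n (h.subgroup M)
  rw [Group.fg_iff_subgroup_fg] at hfg1 hfg2
  obtain ⟨Sg, hSg⟩ := hfg1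
  obtain ⟨S0, hS0⟩ := hfg2
  set d := Sg.card with hd
  set g : Fin d → G := fun i => (Sg.equivFin.symm i : G) with hg
  have hrange : Set.range g = (Sg : Set G) := by
    ext x
    constructor
    · rintro ⟨i, rfl⟩; exact (Sg.equivFin.symm i).2
    · intro hx; exact ⟨Sg.equivFin ⟨x, hx⟩, by simp [hg]⟩
  have hgG : ∀ i, g i ∈ G' := fun i => by
    rw [← hSg]; exact Subgroup.subset_closure (Sg.equivFin.symm i).2
  -- the symmetric generating set of M
  set S : Set G := (S0 : Set G) ∪ (S0 : Set G)⁻¹ ∪ {1} with hS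
  have hSf : S.Finite := ((Finset.finite_toSet S0).union (Finset.finite_toSet S0).inv).union (Set.finite_singleton _)
  have hS1 : (1:G) ∈ S := Or.inr rfl
  have hSinv : ∀ x ∈ S, x⁻¹ ∈ S := by
    rintro x ((hx | hx) | hx)
    · exact Or.inl (Or.inr (by simpa using hx))
    · exact Or.inl (Or.inl hx)
    · rw [Set.mem_singleton_iff] at hx; subst hx; rw [inv_one]; exact hS1
  have hSM : S ⊆ M := by
    rintro x ((hx | hx) | hx)
    · rw [← hS0]; exact Subgroup.subset_closure hx
    · have : x⁻¹ ∈ M := by rw [← hS0]; exact Subgroup.subset_closure hx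
      simpa using M.inv_mem this
    · rw [Set.mem_singleton_iff] at hx; subst hx; exact M.one_mem
  have hMS : (M : Set G) ⊆ Subgroup.closure S := by
    have : M ≤ Subgroup.closure S := by
      rw [← hS0]; exact Subgroup.closure_mono fun x hx => Or.inl (Or.inl hx)
    exact this
  obtain ⟨Cp, D, hCp⟩ := poly_growth_sub n M (h.subgroup M) hnil S hSf hSM
  set Q : Set G := Set.range g ∪ (Set.range g)⁻¹ ∪ {1} with hQ
  have hQf : Q.Finite := ((Set.finite_range g).union (Set.finite_range g).inv).union (Set.finite_singleton _)
  have hQ1 : (1:G) ∈ Q := Or.inr rfl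
  have hgQ : ∀ i, g i ∈ Q := fun i => Or.inl (Or.inl ⟨i, rfl⟩)
  have hgQ' : ∀ i, (g i)⁻¹ ∈ Q := fun i => Or.inl (Or.inr (by simp))
  have hQG : ∀ q ∈ Q, q ∈ G' := by
    rintro x ((⟨i, rfl⟩ | hx) | hx)
    · exact hgG i
    · obtain ⟨i, hi⟩ := hx
      have : x = (g i)⁻¹ := by rw [hi, inv_inv]
      rw [this]; exact G'.inv_mem (hgG i)
    · rw [Set.mem_singleton_iff] at hx; subst hx; exact G'.one_mem
  obtain ⟨K, hK1, hK⟩ := subset_pow_of_closure S hS1 hSinv ((fun p : G × G => p.1 * p.2 * p.1⁻¹) '' (Q ×ˢ S))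
    ((hQf.prod hSf).image _) (by
      rintro _ ⟨⟨q, s⟩, ⟨hq, hs⟩, rfl⟩
      exact hMS (Subgroup.Normal.conj_mem inferInstance s (hSM hs) q))
  obtain ⟨c, hc1, hc⟩ := subset_pow_of_closure S hS1 hSinv ((fun p : G × G => p.1 * p.2 * p.1⁻¹ * p.2⁻¹) '' (Q ×ˢ Q))
    ((hQf.prod hQf).image _) (by
      rintro _ ⟨⟨q, s⟩, ⟨hq, hs⟩, rfl⟩
      exact hMS (Subgroup.commutator_mem_commutator (hQG q hq) (hQG s hs)))
  have hall := sig_all S Q hS1 hSinv hQ1 K c hK1 (fun q hq s hs => hK ⟨(q, s), ⟨hq, hs⟩, rfl⟩)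
    (fun q hq s hs => hc ⟨(q, s), ⟨hq, hs⟩, rfl⟩) d g hgQ hgQ'
  -- the quotient
  haveI : Finite (G ⧸ G') := inferInstance
  letI : Fintype (G ⧸ G') := Fintype.ofFinite _
  set τ : G ⧸ G' → G := Quotient.out with hτ
  have hτmk : ∀ t : G ⧸ G', (QuotientGroup.mk (τ t) : G ⧸ G') = t := fun t => QuotientGroup.out_eq' t
  set ab : Fin r → G ⧸ G' := fun i => QuotientGroup.mk (a i) with hab
  have hsec : ∀ (t : G ⧸ G') (i : Fin r), τ t * a i * (τ (t * ab i))⁻¹ ∈ Subgroup.closure (Set.range g) := by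
    intro t i
    rw [hrange, hSg, ← QuotientGroup.eq_one_iff, QuotientGroup.mk_mul, QuotientGroup.mk_mul, QuotientGroup.mk_inv,
      hτmk, hτmk, mul_inv_cancel]
  choose k C hkC using fun t i => hall _ (hsec t i)
  obtain ⟨C0, hC01, hC0⟩ : ∃ C0 : ℕ, 1 ≤ C0 ∧ ∀ t i, C t i ≤ C0 := by
    obtain ⟨m, hm⟩ := (Set.finite_range fun p : (G ⧸ G') × Fin r => C p.1 p.2).bddAbove
    exact ⟨m + 1, by omega, fun t i => (hm ⟨(t, i), rfl⟩).trans (by omega)⟩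
  set kk : G ⧸ G' → Letter r → (Fin d → ℤ) := fun t l =>
    if l.2.2 then 0 else if l.2.1 then k t l.1 else -k (t * (ab l.1)⁻¹) l.1 with hkk
  set tt : Letter r → G ⧸ G' → G ⧸ G' := fun l t => t * stepOf ab l with htt
  obtain ⟨Cb, R0, hCb, hR0, hbox⟩ := box_walk kk tt (letterInv r)
    (by intro l t; simp [htt, stepOf_inv]) (by intro l t; simp [htt, stepOf_inv])
    (by
      rintro ⟨i, b, z⟩ t
      cases b <;> cases z <;> simp [hkk, htt, letterInv, stepOf])
  have hstep : ∀ (R : ℕ) (l : Letter r) (m : Fin d → ℤ) (t : G ⧸ G'), m ∈ boxF d R → m + kk t l ∈ boxF d R →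
      sig d g m * τ t * stepOf a l * (sig d g (m + kk t l) * τ (tt l t))⁻¹ ∈ S ^ (C0 ^ (R + 1)) := by
    rintro R ⟨i, b, z⟩ m t hm hm'
    rw [mem_boxF] at hm hm'
    cases z
    · cases b
      · have e1 : kk t (i, false, false) = -k (t * (ab i)⁻¹) i := by simp [hkk]
        have e2 : tt (i, false, false) t = t * (ab i)⁻¹ := by simp [htt, stepOf]
        have e3 : stepOf a (i, false, false) = (a i)⁻¹ := by simp [stepOf]
        rw [e1] at hm' ⊢
        rw [e2, e3]
        have h2 := inv_mem_pow S hSinv _ _ (hkC (t * (ab i)⁻¹) i R _ hm')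
        rw [inv_mul_cancel_right, neg_add_cancel_right] at h2
        have h3 := Set.pow_subset_pow_right hS1 (Nat.pow_le_pow_left (hC0 (t * (ab i)⁻¹) i) (R + 1)) h2
        convert h3 using 1
        group
      · have e1 : kk t (i, true, false) = k t i := by simp [hkk]
        have e2 : tt (i, true, false) t = t * ab i := by simp [htt, stepOf]
        have e3 : stepOf a (i, true, false) = a i := by simp [stepOf]
        rw [e1, e2, e3]
        have h2 := hkC t i R _ hm
        have h3 := Set.pow_subset_pow_right hS1 (Nat.pow_le_pow_left (hC0 t i) (R + 1)) h2
        convert h3 using 1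
        group
    · have e1 : kk t (i, b, true) = 0 := by simp [hkk]
      have e2 : tt (i, b, true) t = t := by simp [htt, stepOf]
      have e3 : stepOf a (i, b, true) = 1 := by simp [stepOf]
      rw [e1, e2, e3]
      have : (1:G) ∈ S ^ (C0 ^ (R + 1)) := Set.one_mem_pow hS1
      simpa using this
  set Cx : ℝ := (Cp + D * (4 + 2 * Real.log C0) + 3 * d + Fintype.card (G ⧸ G')) with hCx
  have hlog : 0 ≤ Real.log C0 := Real.log_natCast_nonneg C0
  have hCx0 : 0 ≤ Cx := by positivity
  refine ⟨Cb + Cx, R0, by linarith, hR0, fun R hR => ?_⟩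
  have hR1 : 1 ≤ R := hR0.trans hR
  obtain ⟨⟨n0, t0⟩, hx0, hst⟩ := hbox R hR
  set B : Finset ((Fin d → ℤ) × (G ⧸ G')) := boxF d R ×ˢ Finset.univ with hB
  set w0 : G := sig d g n0 * τ t0 with hw0
  set E := C0 ^ (R + 1) with hE
  set W : Set (G × ((Fin d → ℤ) × (G ⧸ G'))) := (S ^ (R ^ 3 * E)) ×ˢ (B : Set ((Fin d → ℤ) × (G ⧸ G'))) with hW
  have hWf : W.Finite := (set_finite_pow hSf _).prod (Finset.finite_toSet B)
  set φ : G × ((Fin d → ℤ) × (G ⧸ G')) → G := fun p => w0⁻¹ * (p.1 * (sig d g p.2.1 * τ p.2.2)) with hφ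
  have hΩf : (φ '' W).Finite := hWf.image φ
  refine ⟨hΩf.toFinset, ?_, ?_, ?_⟩
  · rw [Set.Finite.mem_toFinset]
    exact ⟨(1, (n0, t0)), ⟨Set.one_mem_pow hS1, hx0⟩, by simp [hφ, hw0]⟩
  · rw [← Set.ncard_eq_toFinset_card _ hΩf]
    have h1 : (φ '' W).ncard ≤ Cp * (R ^ 3 * E + 1) ^ D * ((2 * R + 1) ^ d * Fintype.card (G ⧸ G')) := by
      refine (Set.ncard_image_le hWf).trans ?_
      rw [hW, Set.ncard_prod, Set.ncard_coe_finset, hB, Finset.card_product, card_boxF, Finset.card_univ]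
      exact Nat.mul_le_mul_right _ (hCp _)
    have h2 := card_est Cp D d (Fintype.card (G ⧸ G')) C0 hC01 R hR1
    calc ((φ '' W).ncard : ℝ) ≤ _ := by exact_mod_cast h1
      _ ≤ _ := h2
      _ ≤ _ := by
        apply Real.exp_le_exp.2
        rw [← hCx]
        gcongr
        linarith
  · have hl := stayP_lift (skew kk tt) (ract (stepOf a)) (B : Set _) (hΩf.toFinset : Set G)
      (fun j y x => ∃ m ∈ S ^ (j * E), w0 * y = m * (sig d g x.1 * τ x.2)) (R ^ 3)
      (by
        rintro j y ⟨m, t⟩ l hj ⟨p, hp, hpe⟩ hx hx'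
        have hx1 : m ∈ boxF d R := by simpa [hB] using hx
        have hx2 : m + kk t l ∈ boxF d R := by simpa [hB, skew] using hx'
        refine ⟨p * (sig d g m * τ t * stepOf a l * (sig d g (m + kk t l) * τ (tt l t))⁻¹), ?_, ?_⟩
        · rw [add_mul, one_mul, pow_add]
          exact Set.mul_mem_mul hp (hstep R l m t hx1 hx2)
        · simp only [ract, skew]
          rw [← mul_assoc w0, hpe]
          group)
      (by
        rintro j y ⟨m, t⟩ hj ⟨p, hp, hpe⟩ hx
        rw [Set.Finite.coe_toFinset]
        refine ⟨(p, (m, t)), ⟨Set.pow_subset_pow_right hS1 (Nat.mul_le_mul_right _ hj) hp, hx⟩, ?_⟩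
        simp only [hφ]
        rw [← hpe]; group)
      (R ^ 3) 0 1 (n0, t0) (by omega) ⟨1, by simp, by simp [hw0]⟩
    refine le_trans ?_ (hst.trans hl)
    apply Real.exp_le_exp.2
    have : (0:ℝ) ≤ Cx * R := by positivity
    linarith

end conf

section magnus
universe u

open Classical in
lemma kmat_pow_le {ι X : Type*} [Fintype ι] (act : ι → X → X) (B : Finset X) (v : B → ℝ) (f : X → ℝ)
    (hf : ∀ x, 0 ≤ f x) (hv : ∀ y : B, v y ≤ f y) (n : ℕ) (x : B) :
    ((kmat act B) ^ n).mulVec v x ≤ (avgOp act)^[n] f x := by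
  induction n generalizing x with
  | zero => simpa using hv x
  | succ n ih =>
    rw [pow_succ', ← Matrix.mulVec_mulVec, Function.iterate_succ_apply']
    set F : X → ℝ := fun y => if h : y ∈ B then ((kmat act B) ^ n).mulVec v ⟨y, h⟩ else 0 with hF
    have e : ((kmat act B) ^ n).mulVec v = fun y : B => F y := by
      funext y; simp [hF]
    rw [e, kmat_mulVec act B F (fun y hy => by simp [hF, hy])]
    refine avgOp_mono act _ fun i => ?_
    simp only [hF]
    split_ifs with h
    · exact ih ⟨_, h⟩
    · exact iter_nonneg act hf n _

lemma return_lower {ι X : Type*} [Fintype ι] (act : ι → X → X) (B : Finset X) (inv : ι ≃ ι)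
    (hinv : ∀ i x, act (inv i) (act i x) = x) (hinv2 : ∀ i x, act i (act (inv i) x) = x)
    (x : X) (hx : x ∈ B) (n : ℕ) :
    stayP act (B : Set X) n x ^ 2 / B.card ≤ (avgOp act)^[2 * n] (fun y => ind (y = x)) x := by
  classical
  have hs := kmat_symm act B inv hinv hinv2
  have h1 := loop_ge (kmat act B) hs n ⟨x, hx⟩
  rw [kmat_pow_stay] at h1
  have hc : (0:ℝ) < B.card := by exact_mod_cast Finset.card_pos.2 ⟨x, hx⟩
  have h2 : stayP act (B : Set X) n x ^ 2 / B.card ≤ (kmat act B ^ (2 * n)) ⟨x, hx⟩ ⟨x, hx⟩ := by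
    rw [div_le_iff₀ hc]
    simpa [mul_comm] using h1
  refine h2.trans ?_
  have h3 := kmat_pow_le act B (Pi.single ⟨x, hx⟩ 1) (fun y => ind (y = x)) (fun y => ind_nonneg _) (by
    intro y
    by_cases h : y = ⟨x, hx⟩
    · subst h; simp [ind]
    · rw [Pi.single_eq_of_ne h]; exact ind_nonneg _) (2 * n) ⟨x, hx⟩
  simpa [Matrix.mulVec_single_one] using h3

variable {G : Type u} [Group G] {r : ℕ} (a : Fin r → G)

lemma ker_comm (x y : FreeGroup (Fin r)) (hx : x ∈ (FreeGroup.lift a).ker) (hy : y ∈ (FreeGroup.lift a).ker) :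
    (QuotientGroup.mk x : FreeGroup (Fin r) ⧸ ⁅(FreeGroup.lift a).ker, (FreeGroup.lift a).ker⁆) * QuotientGroup.mk y =
      QuotientGroup.mk y * QuotientGroup.mk x := by
  rw [← QuotientGroup.mk_mul, ← QuotientGroup.mk_mul, eq_comm, QuotientGroup.eq]
  have := Subgroup.commutator_mem_commutator (Subgroup.inv_mem _ hx) (Subgroup.inv_mem _ hy)
  simpa [commutatorElement_def, mul_assoc] using this

lemma magnus_lower (hsurj : Function.Surjective (FreeGroup.lift a)) (Ω : Finset G) (h1Ω : 1 ∈ Ω) (n : ℕ) :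
    stayP (ract (stepOf a)) (Ω : Set G) n 1 ^ 2 / ((2 * n + 1) ^ (r * Ω.card) * Ω.card) ≤
      (avgOp (ract (qstep ⁅(FreeGroup.lift a).ker, (FreeGroup.lift a).ker⁆)))^[2 * n] (fun q => ind (q = 1)) 1 := by
  classical
  set N := (FreeGroup.lift a).ker with hN
  set Γ := FreeGroup (Fin r) ⧸ ⁅N, N⁆ with hΓ
  set mk : FreeGroup (Fin r) →* Γ := QuotientGroup.mk' ⁅N, N⁆ with hmk
  set NN : Subgroup Γ := N.map mk with hNN
  letI : CommGroup NN := { (inferInstance : Group NN) with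
    mul_comm := by
      rintro ⟨_, x, hx, rfl⟩ ⟨_, y, hy, rfl⟩
      exact Subtype.ext (ker_comm a x y hx hy) }
  set σ : G → FreeGroup (Fin r) := Function.surjInv hsurj with hσ
  have hσs : ∀ x, FreeGroup.lift a (σ x) = x := Function.surjInv_eq hsurj
  have hcm : ∀ (x : G) (i : Fin r), σ x * FreeGroup.of i * (σ (x * a i))⁻¹ ∈ N := by
    intro x i
    rw [hN, MonoidHom.mem_ker, map_mul, map_mul, map_inv, hσs, hσs, FreeGroup.lift_apply_of, mul_inv_cancel]
  set c : G × Fin r → NN := fun p => ⟨mk (σ p.1 * FreeGroup.of p.2 * (σ (p.1 * a p.2))⁻¹), _, hcm p.1 p.2, rfl⟩ with hc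
  have hcstep : ∀ x i, (c (x, i) : Γ) * mk (σ (x * a i)) = mk (σ x) * mk (FreeGroup.of i) := by
    intro x i
    simp only [hc]
    rw [← map_mul, ← map_mul]; congr 1; group
  set I : Finset (G × Fin r) := Ω ×ˢ Finset.univ with hI
  set P : (I → ℤ) → NN := fun k => ∏ p : I, c p ^ k p with hP
  have hPadd : ∀ (k : I → ℤ) (p : I) (e : ℤ), P (k + Pi.single p e) = c p ^ e * P k := by
    intro k p e
    simp only [hP, Pi.add_apply, zpow_add, Finset.prod_mul_distrib]
    rw [mul_comm]
    congr 1
    rw [Finset.prod_eq_single p]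
    · simp
    · intro q _ hq; rw [Pi.single_eq_of_ne hq, zpow_zero]
    · intro h; exact absurd (Finset.mem_univ p) h
  set box : Finset (I → ℤ) := Fintype.piFinset fun _ => Finset.Icc (-(n:ℤ)) n with hbox
  set A : Finset Γ := (box ×ˢ Ω).image (fun p => (mk (σ 1))⁻¹ * ((P p.1 : Γ) * mk (σ p.2))) with hA
  have hAcard : (A.card : ℝ) ≤ (2 * n + 1) ^ (r * Ω.card) * Ω.card := by
    have h1 : A.card ≤ (2 * n + 1) ^ (r * Ω.card) * Ω.card := by
      refine Finset.card_image_le.trans ?_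
      rw [Finset.card_product, hbox, Fintype.card_piFinset]
      simp only [Int.card_Icc, Finset.prod_const, Finset.card_univ, Fintype.card_coe, hI,
        Finset.card_product, Fintype.card_fin]
      rw [mul_comm Ω.card r, show ((n:ℤ) + 1 - -n).toNat = 2 * n + 1 by omega]
    exact_mod_cast h1
  have h1A : (1 : Γ) ∈ A := by
    refine Finset.mem_image.2 ⟨(0, 1), ?_, ?_⟩
    · simp [hbox, h1Ω]
    · simp [hP]
  have hqs : ∀ l, qstep ⁅N, N⁆ l = mk (stepOf FreeGroup.of l) := by
    intro l; rw [stepOf_map]; rfl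
  have hl := stayP_lift (ract (stepOf a)) (ract (qstep ⁅N, N⁆)) (Ω : Set G) (A : Set Γ)
    (fun j y x => ∃ k : I → ℤ, (∀ p, |k p| ≤ j) ∧ mk (σ 1) * y = (P k : Γ) * mk (σ x)) n
    (by
      rintro j y x ⟨i, b, z⟩ hj ⟨k, hk, hky⟩ hx hx'
      have hsing : ∀ (p : I) (e : ℤ), |e| ≤ 1 → ∀ q, |(k + Pi.single p e : I → ℤ) q| ≤ ((j + 1 : ℕ) : ℤ) := by
        intro p e he q
        have h3 : |(Pi.single p e : I → ℤ) q| ≤ 1 := by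
          by_cases hqp : q = p
          · subst hqp; simpa using he
          · rw [Pi.single_eq_of_ne hqp]; simp
        push_cast
        exact (abs_add_le _ _).trans (add_le_add (hk q) h3)
      simp only [ract, hqs] at hx' ⊢
      cases z
      · cases b
        · simp only [stepOf, if_false, Bool.false_eq_true] at hx' ⊢
          have hp : (x * (a i)⁻¹, i) ∈ I := by simp [hI]; exact hx'
          refine ⟨k + Pi.single ⟨_, hp⟩ (-1), hsing _ _ (by simp), ?_⟩
          have h5 := hcstep (x * (a i)⁻¹) i
          rw [inv_mul_cancel_right] at h5
          rw [hPadd, ← mul_assoc, hky, mul_comm (c _ ^ (-1 : ℤ)) (P k), map_inv, zpow_neg_one, Subgroup.coe_mul,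
            Subgroup.coe_inv, mul_assoc, mul_assoc, mul_right_inj]
          rw [eq_inv_mul_iff_mul_eq, ← mul_assoc, mul_inv_eq_iff_eq_mul]
          have h6 : mk (σ x) = ((c (x * (a i)⁻¹, i) : Γ))⁻¹ * (mk (σ (x * (a i)⁻¹)) * mk (FreeGroup.of i)) := by
            rw [← h5]; group
          rw [h6]; group
        · simp only [stepOf, if_false, if_true, Bool.false_eq_true] at hx' ⊢
          have hp : (x, i) ∈ I := by simp [hI]; exact hx
          refine ⟨k + Pi.single ⟨_, hp⟩ 1, hsing _ _ (by simp), ?_⟩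
          rw [hPadd, ← mul_assoc, hky, mul_comm (c _ ^ (1 : ℤ)) (P k), zpow_one, Subgroup.coe_mul,
            mul_assoc, mul_assoc, hcstep]
      · refine ⟨k, fun p => (hk p).trans (by push_cast; omega), ?_⟩
        simpa [stepOf] using hky)
    (by
      rintro j y x hj ⟨k, hk, hky⟩ hx
      refine Finset.mem_coe.2 (Finset.mem_image.2 ⟨(k, x), ?_, ?_⟩)
      · rw [Finset.mem_product]
        refine ⟨?_, hx⟩
        rw [hbox, Fintype.mem_piFinset]
        intro p
        have := abs_le.1 (hk p)
        rw [Finset.mem_Icc]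
        change -(n:ℤ) ≤ k p ∧ k p ≤ n
        constructor <;> omega
      · simp only; rw [← hky]; group)
    n 0 1 1 (by omega) ⟨0, by simp, by simp [hP]⟩
  have hret := return_lower (ract (qstep ⁅N, N⁆)) A (letterInv r)
    (by intro l q; simp only [ract, hqs, stepOf_inv, map_inv]; group)
    (by intro l q; simp only [ract, hqs, stepOf_inv, map_inv]; group) 1 h1A n
  refine le_trans ?_ hret
  have hApos : (0:ℝ) < A.card := by exact_mod_cast Finset.card_pos.2 ⟨_, h1A⟩
  have hst0 := stayP_nonneg (ract (stepOf a)) (Ω : Set G) n 1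
  gcongr

lemma return_pos (hr : 0 < r) (n : ℕ) :
    (1 / (Fintype.card (Letter r) : ℝ)) ^ (2 * n) ≤
      (avgOp (ract (qstep ⁅(FreeGroup.lift a).ker, (FreeGroup.lift a).ker⁆)))^[2 * n] (fun q => ind (q = 1)) 1 := by
  classical
  haveI : Nonempty (Fin r) := ⟨⟨0, hr⟩⟩
  set N := (FreeGroup.lift a).ker with hN
  set act := ract (qstep ⁅N, N⁆)
  have hstep : ∀ m, (1 / (Fintype.card (Letter r) : ℝ)) ^ m ≤ (avgOp act)^[m] (fun q => ind (q = 1)) 1 := by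
    intro m
    induction m with
    | zero => simp [ind]
    | succ m ih =>
      rw [Function.iterate_succ_apply', pow_succ', avgOp]
      rw [div_mul_eq_mul_div, one_mul]
      gcongr
      have hnn : ∀ i ∈ (Finset.univ : Finset (Letter r)), 0 ≤ (avgOp act)^[m] (fun q => ind (q = 1)) (act i 1) :=
        fun i _ => iter_nonneg act (fun q => ind_nonneg _) m _
      have h := Finset.single_le_sum hnn (Finset.mem_univ ((⟨0, hr⟩, true, true) : Letter r))
      have e : act (⟨0, hr⟩, true, true) 1 = 1 := by
        simp [act, ract, qstep, stepOf]
      rw [e] at h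
      exact ih.trans h
  exact hstep (2 * n)

end magnus

section finallower
universe u
variable {G : Type u} [Group G] {r : ℕ} (a : Fin r → G)

lemma lower_R (hr : 0 < r) (hsurj : Function.Surjective (FreeGroup.lift a)) (C : ℝ) (hC : 0 < C) (R : ℕ) (hR : 1 ≤ R)
    (Ω : Finset G) (h1 : 1 ∈ Ω) (hcard : (Ω.card:ℝ) ≤ Real.exp (C * R))
    (hst : Real.exp (-C * R) ≤ stayP (ract (stepOf a)) (Ω : Set G) (R ^ 3) 1) (n : ℕ) :
    Real.exp (-(3 * C * (n / R ^ 2) + 7 * (C * R) + r * Real.exp (C * R) * Real.log (2 * n + 1))) ≤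
      convPow (lazySRWQuot r ⁅(FreeGroup.lift a).ker, (FreeGroup.lift a).ker⁆) (2 * n) 1 := by
  rw [return_eq r hr]
  refine le_trans ?_ (magnus_lower a hsurj Ω h1 n)
  haveI : Nonempty (Fin r) := ⟨⟨0, hr⟩⟩
  have hRpos : (0:ℝ) < R := by exact_mod_cast hR
  have hcp : (0:ℝ) < Ω.card := by exact_mod_cast Finset.card_pos.2 ⟨_, h1⟩
  set q := n / (2 * R ^ 3) + 1 with hq
  have hloop := stayP_loops (ract (stepOf a)) Ω (letterInv r)
    (by intro l x; simp only [ract, stepOf_inv]; group)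
    (by intro l x; simp only [ract, stepOf_inv]; group) 1 h1 (R ^ 3) q
  have hnq : n ≤ 2 * R ^ 3 * q := by
    have := Nat.lt_mul_div_succ n (show 0 < 2 * R ^ 3 by positivity)
    exact this.le
  have hanti := stayP_anti (ract (stepOf a)) (Ω : Set G) 1 hnq
  have hbase : Real.exp (-(3 * C * R)) ≤ stayP (ract (stepOf a)) (Ω : Set G) (R ^ 3) 1 ^ 2 / Ω.card := by
    rw [le_div_iff₀ hcp]
    calc Real.exp (-(3 * C * R)) * Ω.card ≤ Real.exp (-(3 * C * R)) * Real.exp (C * R) := by gcongr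
      _ = Real.exp (-C * R) ^ 2 := by rw [← Real.exp_add, ← Real.exp_nat_mul]; congr 1; push_cast; ring
      _ ≤ _ := by gcongr
  have hqb : (q:ℝ) ≤ n / (2 * R ^ 3) + 1 := by
    rw [hq]; push_cast
    have := @Nat.cast_div_le ℝ _ _ _ n (2 * R ^ 3)
    push_cast at this
    linarith
  have hstay : Real.exp (-(3 * C * (n / R ^ 2) / 2 + 3 * (C * R))) ≤ stayP (ract (stepOf a)) (Ω : Set G) n 1 := by
    refine le_trans ?_ hanti
    refine le_trans ?_ hloop
    calc Real.exp (-(3 * C * (n / R ^ 2) / 2 + 3 * (C * R))) ≤ Real.exp (q * (-(3 * C * R))) := by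
          apply Real.exp_le_exp.2
          have h2 : (3 * C * R) * q ≤ (3 * C * R) * (n / (2 * R ^ 3) + 1) := by gcongr
          have h3 : (3 * C * R) * ((n:ℝ) / (2 * R ^ 3) + 1) = 3 * C * (n / R ^ 2) / 2 + 3 * (C * R) := by
            field_simp
          linarith
      _ = Real.exp (-(3 * C * R)) ^ q := by rw [Real.exp_nat_mul]
      _ ≤ _ := by gcongr
  have hlog : 0 ≤ Real.log (2 * n + 1) := Real.log_nonneg (by have : (0:ℝ) ≤ n := by positivity
                                                              linarith)
  have hden : ((2 * n + 1 : ℝ) ^ (r * Ω.card)) ≤ Real.exp (r * Real.exp (C * R) * Real.log (2 * n + 1)) := by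
    have : (2 * n + 1 : ℝ) = Real.exp (Real.log (2 * n + 1)) := (Real.exp_log (by positivity)).symm
    conv_lhs => rw [this]
    rw [← Real.exp_nat_mul]
    apply Real.exp_le_exp.2
    push_cast
    gcongr
  rw [le_div_iff₀ (by positivity)]
  calc _ ≤ Real.exp (-(3 * C * (n / R ^ 2) + 7 * (C * R) + r * Real.exp (C * R) * Real.log (2 * n + 1))) *
        (Real.exp (r * Real.exp (C * R) * Real.log (2 * n + 1)) * Real.exp (C * R)) := by gcongr
    _ = Real.exp (-(3 * C * (n / R ^ 2) / 2 + 3 * (C * R))) ^ 2 := by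
      rw [← Real.exp_add, ← Real.exp_add, ← Real.exp_nat_mul]; congr 1; push_cast; ring
    _ ≤ _ := by gcongr

lemma ev_logpow (K : ℝ) : ∀ᶠ n : ℕ in Filter.atTop, K * Real.log n ^ 6 ≤ n := by
  have h := (@Real.isLittleO_pow_log_id_atTop 6).bound (show (0:ℝ) < 1 / (|K| + 1) by positivity)
  have h2 := tendsto_natCast_atTop_atTop (R := ℝ) |>.eventually h
  filter_upwards [h2] with n hn
  have h6 : 0 ≤ Real.log n ^ 6 := by positivity
  simp only [id, Real.norm_eq_abs, abs_of_nonneg h6, Nat.abs_cast] at hn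
  rw [div_mul_eq_mul_div, one_mul, le_div_iff₀ (by positivity)] at hn
  nlinarith [le_abs_self K]

lemma lower_bound (m : ℕ) (hp : PolyCyc m G) (hr : 0 < r) (hsurj : Function.Surjective (FreeGroup.lift a)) :
    ∃ C0 : ℝ, 1 ≤ C0 ∧ ∀ C, C0 ≤ C → ∀ n : ℕ, 2 ≤ n →
      Real.exp (-C * (n : ℝ) / (Real.log n) ^ 2) ≤
        convPow (lazySRWQuot r ⁅(FreeGroup.lift a).ker, (FreeGroup.lift a).ker⁆) (2 * n) 1 := by
  obtain ⟨C, R0, hC, hR0, hconf⟩ := conf m hp r hr a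
  haveI : Nonempty (Fin r) := ⟨⟨0, hr⟩⟩
  set ε : ℝ := 1 / (2 * C) with hε
  have hεp : 0 < ε := by positivity
  have hev := ((ev_log ((R0 + 2) / ε)).and (ev_log 4)).and (ev_logpow (9 * r ^ 2))
  obtain ⟨n0, hn0⟩ := Filter.eventually_atTop.1 hev
  set K1 : ℝ := 12 * C / ε ^ 2 + 4 + 1 with hK1
  set cL : ℝ := (Fintype.card (Letter r) : ℝ) with hcL
  have hcL1 : 1 ≤ cL := by
    have : 0 < Fintype.card (Letter r) := Fintype.card_pos
    rw [hcL]; exact_mod_cast this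
  set K2 : ℝ := 2 * Real.log cL * Real.log (n0 + 2) ^ 2 with hK2
  refine ⟨max 1 (max K1 K2), le_max_left _ _, fun C' hC' n hn2 => ?_⟩
  have hCK1 : K1 ≤ C' := (le_max_left _ _).trans ((le_max_right _ _).trans hC')
  have hCK2 : K2 ≤ C' := (le_max_right _ _).trans ((le_max_right _ _).trans hC')
  have hlogpos : 0 < Real.log n := Real.log_pos (by exact_mod_cast hn2)
  have hnp : (0:ℝ) < n := by positivity
  by_cases hnn : n0 ≤ n
  · obtain ⟨⟨⟨hl1, hlR, -⟩, ⟨-, -, hl7⟩⟩, hl6⟩ := hn0 n hnn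
    set L := Real.log n with hL
    set R := ⌊ε * L⌋₊ with hR
    have hRle : (R:ℝ) ≤ ε * L := Nat.floor_le (by positivity)
    have hRlt : ε * L < R + 1 := Nat.lt_floor_add_one _
    have hRR : R0 + 2 ≤ ε * L := by rw [div_le_iff₀ hεp] at hlR; linarith
    have hRge : R0 ≤ R := by
      have : (R0:ℝ) < R := by linarith
      exact_mod_cast this.le
    have hRhalf : ε / 2 * L ≤ R := by
      have : (0:ℝ) ≤ R0 := by positivity
      linarith
    obtain ⟨Ω, h1, hcard, hst⟩ := hconf R hRge
    refine le_trans ?_ (lower_R a hr hsurj C hC R (hR0.trans hRge) Ω h1 hcard hst n)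
    apply Real.exp_le_exp.2
    have hRpos : (0:ℝ) < R := lt_of_lt_of_le (by positivity) hRhalf
    have hCR : C * R ≤ L / 2 := by
      calc C * R ≤ C * (ε * L) := by gcongr
        _ = L / 2 := by rw [hε]; field_simp
    have t1 : 3 * C * (n / R ^ 2) ≤ 12 * C / ε ^ 2 * (n / L ^ 2) := by
      calc 3 * C * ((n:ℝ) / R ^ 2) ≤ 3 * C * (n / (ε / 2 * L) ^ 2) := by gcongr
        _ = _ := by field_simp; ring
    have t2 : 7 * (C * R) ≤ 4 * (n / L ^ 2) := by
      have : 0 ≤ (n:ℝ) / L ^ 2 := by positivity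
      linarith
    have t3 : r * Real.exp (C * R) * Real.log (2 * n + 1) ≤ n / L ^ 2 := by
      have e1 : Real.exp (C * R) ≤ Real.sqrt n := by
        rw [Real.le_sqrt (Real.exp_pos _).le hnp.le, ← Real.exp_nat_mul]
        calc Real.exp ((2:ℕ) * (C * R)) ≤ Real.exp L := by
              apply Real.exp_le_exp.2; push_cast; linarith
          _ = (n:ℝ) := Real.exp_log hnp
      have e2 : Real.log (2 * n + 1) ≤ 3 * L := by
        have h2n : (2:ℝ) ≤ n := by exact_mod_cast hn2
        calc Real.log (2 * n + 1) ≤ Real.log ((n:ℝ) ^ 3) := by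
              apply Real.log_le_log (by positivity)
              nlinarith [mul_nonneg (sub_nonneg.2 h2n) (sub_nonneg.2 h2n), mul_nonneg (sub_nonneg.2 h2n) (sq_nonneg (n:ℝ))]
          _ = 3 * L := by rw [Real.log_pow]; push_cast; rfl
      have e3 : 3 * r * L ^ 3 ≤ Real.sqrt n := by
        apply Real.le_sqrt_of_sq_le
        calc (3 * (r:ℝ) * L ^ 3) ^ 2 = 9 * (r:ℝ) ^ 2 * L ^ 6 := by ring
          _ ≤ (n:ℝ) := hl6
      rw [le_div_iff₀ (by positivity)]
      calc (r:ℝ) * Real.exp (C * R) * Real.log (2 * n + 1) * L ^ 2 ≤ (r:ℝ) * Real.sqrt n * (3 * L) * L ^ 2 := by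
            have hl0 : 0 ≤ Real.log (2 * n + 1) := Real.log_nonneg (by linarith)
            gcongr
        _ = Real.sqrt n * (3 * r * L ^ 3) := by ring
        _ ≤ Real.sqrt n * Real.sqrt n := by gcongr
        _ = (n:ℝ) := Real.mul_self_sqrt hnp.le
    have t4 : K1 * (n / L ^ 2) ≤ C' * (n / L ^ 2) := by gcongr
    have t5 : -C' * (n:ℝ) / L ^ 2 = -(C' * (n / L ^ 2)) := by ring
    rw [t5]
    rw [hK1] at t4
    linarith
  · push Not at hnn
    rw [return_eq r hr]
    refine le_trans ?_ (return_pos a hr n)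
    have e : (1 / cL) ^ (2 * n) = Real.exp (-(2 * n * Real.log cL)) := by
      rw [Real.exp_neg, one_div, inv_pow]
      congr 1
      have : (2 * n * Real.log cL : ℝ) = ((2 * n : ℕ) : ℝ) * Real.log cL := by push_cast; ring
      rw [this, Real.exp_nat_mul, Real.exp_log (by linarith)]
    rw [e]
    apply Real.exp_le_exp.2
    rw [neg_mul, neg_div, neg_le_neg_iff, le_div_iff₀ (by positivity)]
    have hle : Real.log n ≤ Real.log (n0 + 2) := by
      apply Real.log_le_log hnp
      have : (n:ℝ) < n0 := by exact_mod_cast hnn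
      linarith
    have hlc : 0 ≤ Real.log cL := Real.log_nonneg hcL1
    calc 2 * n * Real.log cL * Real.log n ^ 2 ≤ 2 * n * Real.log cL * Real.log (n0 + 2) ^ 2 := by gcongr
      _ = K2 * n := by rw [hK2]; ring
      _ ≤ C' * n := by gcongr

end finallower

/-- Theorem: let `G` be a polycyclic group of exponential volume growth with a polycyclic
series `G = G₁ ⊳ … ⊳ G_{r+1} = {e}` (`r ≥ 2`) and associated standard polycyclic
presentation `G = F_r/N` (where `sᵢ ↦ aᵢ` and `aᵢ ∈ Gᵢ` generates `Gᵢ/Gᵢ₊₁`). The lazy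
simple random walk on `Γ₂(N) = F_r/[N,N]` satisfies `μ^{(2n)}(e) ≍ exp(− n/(log n)²)`. -/
theorem return_probability_polycyclic_exponential_cover
    {G : Type*} [Group G] (r : ℕ) (hr : 2 ≤ r)
    (H : Fin (r + 1) → Subgroup G)
    (htop : H 0 = ⊤) (hbot : H (Fin.last r) = ⊥)
    (a : Fin r → G) (ha : ∀ i : Fin r, a i ∈ H i.castSucc)
    (hnormal : ∀ i : Fin r, ∀ g ∈ H i.castSucc, ∀ x ∈ H i.succ, g * x * g⁻¹ ∈ H i.succ)
    (hcyclic : ∀ i : Fin r, ∀ g ∈ H i.castSucc, ∃ n : ℤ, ((a i) ^ n)⁻¹ * g ∈ H i.succ)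
    (hexp : HasExpGrowth G) :
    ∃ C : ℝ, 1 ≤ C ∧ ∀ n : ℕ, 2 ≤ n →
      Real.exp (-C * (n : ℝ) / (Real.log n) ^ 2)
        ≤ convPow (lazySRWQuot r ⁅(FreeGroup.lift a).ker, (FreeGroup.lift a).ker⁆) (2 * n) 1 ∧
      convPow (lazySRWQuot r ⁅(FreeGroup.lift a).ker, (FreeGroup.lift a).ker⁆) (2 * n) 1
        ≤ Real.exp (-(1 / C) * (n : ℝ) / (Real.log n) ^ 2) := by
  have hr0 : 0 < r := by omega
  have hsurj := surj_of_series r H htop hbot a hcyclic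
  obtain ⟨ρ, hρ, e0, he0⟩ := exists_rho hr H hbot a ha hnormal hcyclic
  obtain ⟨C1, h1, hup⟩ := upper_bound a hr0 hsurj hexp ρ hρ e0 he0
  obtain ⟨C2, h2, hlow⟩ := lower_bound a r (isPoly_of_series r H htop hbot a ha hnormal hcyclic) hr0 hsurj
  exact ⟨max C1 C2, h1.trans (le_max_left _ _), fun n hn =>
    ⟨hlow _ (le_max_right _ _) n hn, hup _ (le_max_left _ _) n hn⟩⟩

end
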